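/- For every integer s ≥ 3, the 𝔽₂-vector space (QP_5)_{5(2^s−1)+13·2^s} has dimension 1487. -/

import Mathlib

open MvPolynomial

noncomputable section

/-- `P n` is the polynomial algebra `𝔽₂[x_1, …, x_n]`. -/
abbrev P (n : ℕ) : Type := MvPolynomial (Fin n) (ZMod 2)

/-- The total Steenrod square: the `𝔽₂`-algebra endomorphism of `P n`
with `Sq (x_j) = x_j + x_j ^ 2`. -/
def SqT (n : ℕ) : P n →ₐ[ZMod 2] P n := aeval fun j => X j + X j ^ 2

/-- `u` is hit (in degree `d`): `u = ∑_{i ≥ 1} Sq^i (f i)` where `f i` is homogeneous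
of degree `d - i`; here `Sq^i (f i)` is the degree-`d` homogeneous component of
`Sq (f i)`. -/
def IsHit (n d : ℕ) (u : P n) : Prop :=
  ∃ f : ℕ → P n,
    (∀ i, f i ∈ homogeneousSubmodule (Fin n) (ZMod 2) (d - i)) ∧
    u = ∑ i ∈ Finset.Icc 1 d, homogeneousComponent d (SqT n (f i))

/-- The homogeneous part `(P_n)_d`. -/
abbrev homSub (n d : ℕ) : Submodule (ZMod 2) (P n) := homogeneousSubmodule (Fin n) (ZMod 2) d

/-- The subspace of hit elements of degree `d` (the span of the set of hit elements;
this set is already closed under addition, so this is just the set of hit elements). -/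
def hitSub (n d : ℕ) : Submodule (ZMod 2) (P n) := Submodule.span (ZMod 2) {u | IsHit n d u}

/-- The cohit space `(QP_n)_d = (P_n)_d / (A⁺P_n)_d`. -/
abbrev QP (n d : ℕ) : Type :=
  ↥(homSub n d) ⧸ (hitSub n d).comap (homSub n d).subtype

/-- The class `[f]` in `(QP_n)_d` of a polynomial `f` (via its degree-`d` homogeneous
component; for `f` homogeneous of degree `d` this is the class of `f` itself). -/
def cls (n d : ℕ) (f : P n) : QP n d :=
  Submodule.Quotient.mk
    ⟨homogeneousComponent d f,
      (mem_homogeneousSubmodule _ _).2 (homogeneousComponent_isHomogeneous d f)⟩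

/-- The monomial `x^a = x_1^{a_1} ⋯ x_n^{a_n}`. -/
def mono {n : ℕ} (a : Fin n →₀ ℕ) : P n := monomial a 1

/-- The (total) degree of the monomial with exponent vector `a`. -/
def degA {n : ℕ} (a : Fin n →₀ ℕ) : ℕ := ∑ i, a i

/-- The weight vector: `wVec a t = ω_{t+1}(x^a) = ∑_j α_t(a_j)`. -/
def wVec {n : ℕ} (a : Fin n →₀ ℕ) : ℕ → ℕ :=
  fun t => ∑ j, if Nat.testBit (a j) t then 1 else 0

/-- Left lexicographic (strict) order on sequences. -/
def lexLtN (f g : ℕ → ℕ) : Prop := ∃ i, (∀ j, j < i → f j = g j) ∧ f i < g i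

/-- Left lexicographic (strict) order on exponent vectors. -/
def lexLtS {n : ℕ} (a b : Fin n →₀ ℕ) : Prop :=
  ∃ i : Fin n, (∀ j, j < i → a j = b j) ∧ a i < b i

/-- The order on monomials: `u < v` iff `ω(u) < ω(v)` lexicographically, or
`ω(u) = ω(v)` and `σ(u) < σ(v)` lexicographically. -/
def monLt {n : ℕ} (a b : Fin n →₀ ℕ) : Prop :=
  lexLtN (wVec a) (wVec b) ∨ (wVec a = wVec b ∧ lexLtS a b)

/-- A monomial is admissible iff it is not inadmissible, i.e. there is no finite set of
monomials of the same degree, all smaller than it, such that subtracting their sum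
yields a hit polynomial. -/
def Admissible {n : ℕ} (a : Fin n →₀ ℕ) : Prop :=
  ¬ ∃ S : Finset (Fin n →₀ ℕ),
      (∀ b ∈ S, degA b = degA a ∧ monLt b a) ∧
      IsHit n (degA a) (mono a - ∑ b ∈ S, mono b)

/-- `P_n^0`: the span of the monomials in which some variable has exponent `0`. -/
def PzeroSub (n : ℕ) : Submodule (ZMod 2) (P n) :=
  Submodule.span (ZMod 2) {x : P n | ∃ a : Fin n →₀ ℕ, (∃ i, a i = 0) ∧ x = mono a}

/-- `P_n^+`: the span of the monomials in which every variable occurs. -/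
def PplusSub (n : ℕ) : Submodule (ZMod 2) (P n) :=
  Submodule.span (ZMod 2) {x : P n | ∃ a : Fin n →₀ ℕ, (∀ i, 0 < a i) ∧ x = mono a}

/-- `(QP_n^0)_d`: the image of `(P_n^0)_d` in `(QP_n)_d`. -/
def Qzero (n d : ℕ) : Submodule (ZMod 2) (QP n d) :=
  (((PzeroSub n).comap (homSub n d).subtype)).map
    ((hitSub n d).comap (homSub n d).subtype).mkQ

/-- `(QP_n^+)_d`: the image of `(P_n^+)_d` in `(QP_n)_d`. -/
def Qplus (n d : ℕ) : Submodule (ZMod 2) (QP n d) :=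
  (((PplusSub n).comap (homSub n d).subtype)).map
    ((hitSub n d).comap (homSub n d).subtype).mkQ

/-- Kameko-type map `S_5 : P_5 → P_5`, the `𝔽₂`-linear map with
`S_5(x_1x_2x_3x_4x_5 · y²) = y` on monomials of that form and `S_5 = 0` on all
other monomials. -/
def S5 : P 5 →ₗ[ZMod 2] P 5 :=
  (basisMonomials (Fin 5) (ZMod 2)).constr (ZMod 2) fun a =>
    if ∀ i, Odd (a i) then mono (Finsupp.equivFunOnFinite.symm fun i => a i / 2) else 0

/-- `Φ(f) = x_1x_2x_3x_4x_5 · f²`. -/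
def Phi (f : P 5) : P 5 := (∏ i : Fin 5, X i) * f ^ 2

set_option maxRecDepth 100000
set_option linter.all false

abbrev R5 := P 5

def xs (s : Finset (Fin 5)) : R5 := ∏ i ∈ s, X i

def sqt : R5 →ₐ[ZMod 2] Polynomial R5 :=
  aeval fun j => Polynomial.C (X j) + Polynomial.X * Polynomial.C (X j ^ 2)

def stq (q : ℕ) : R5 →ₗ[ZMod 2] R5 :=
  ((Polynomial.lcoeff R5 q).restrictScalars (ZMod 2)) ∘ₗ sqt.toLinearMap

lemma stq_def (q : ℕ) (f : R5) : stq q f = (sqt f).coeff q := rfl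

lemma two0 : (2 : R5) = 0 := CharTwo.two_eq_zero

lemma sqt_X (j : Fin 5) : sqt (X j) = Polynomial.C (X j) + Polynomial.X * Polynomial.C (X j ^ 2) := by
  simp [sqt]

lemma sqt_C (a : ZMod 2) : sqt (C a) = Polynomial.C (C a) := by
  simp [sqt]

lemma sqt_eval1 (f : R5) : Polynomial.eval 1 (sqt f) = SqT 5 f := by
  induction f using MvPolynomial.induction_on with
  | C a => simp [sqt_C, SqT]
  | add p q hp hq => simp [hp, hq]
  | mul_X p i hp => simp [hp, sqt_X, SqT]

lemma stq_zero (f : R5) : stq 0 f = f := by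
  rw [stq_def, Polynomial.coeff_zero_eq_eval_zero]
  induction f using MvPolynomial.induction_on with
  | C a => simp [sqt_C]
  | add p q hp hq => simp [hp, hq]
  | mul_X p i hp => simp [hp, sqt_X]

lemma SqT_eq_sum (f : R5) : SqT 5 f = ∑ q ∈ Finset.range ((sqt f).natDegree + 1), stq q f := by
  rw [← sqt_eval1, Polynomial.eval_eq_sum_range]; simp [stq_def]

lemma bih_mul {d e : ℕ} {F G : Polynomial R5} (hF : ∀ q, (F.coeff q).IsHomogeneous (d + q))
    (hG : ∀ q, (G.coeff q).IsHomogeneous (e + q)) (q : ℕ) : ((F * G).coeff q).IsHomogeneous (d + e + q) := by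
  rw [Polynomial.coeff_mul]
  refine IsHomogeneous.sum _ _ _ fun p hp => ?_
  rw [Finset.HasAntidiagonal.mem_antidiagonal] at hp
  have := (hF p.1).mul (hG p.2)
  convert this using 1; omega

lemma bih_mono (a : Fin 5 →₀ ℕ) (q : ℕ) : (stq q (monomial a 1)).IsHomogeneous (a.degree + q) := by
  induction a using Finsupp.induction_linear generalizing q with
  | zero =>
    rw [stq_def, ← C_apply, sqt_C, Polynomial.coeff_C]
    split_ifs with h
    · subst h; simpa using isHomogeneous_C (Fin 5) (1 : ZMod 2)
    · exact isHomogeneous_zero _ _ _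
  | add a b ha hb =>
    have : (monomial (a + b) 1 : R5) = monomial a 1 * monomial b 1 := by simp
    rw [stq_def, this, map_mul, map_add]
    exact bih_mul ha hb q
  | single i n =>
    rw [Finsupp.degree_single]
    have : (monomial (Finsupp.single i n) 1 : R5) = X i ^ n := by rw [X_pow_eq_monomial]
    rw [this, stq_def]
    clear this
    induction n generalizing q with
    | zero =>
      simp only [pow_zero, map_one, Polynomial.coeff_one]
      split_ifs with h
      · subst h; exact isHomogeneous_one _ _
      · exact isHomogeneous_zero _ _ _
    | succ n ih =>
      rw [pow_succ, map_mul]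
      refine bih_mul ih (fun q => ?_) q
      rw [sqt_X, Polynomial.coeff_add, Polynomial.coeff_C]
      rcases q with _ | _ | q
      · simpa using isHomogeneous_X (ZMod 2) i
      · simpa [-map_pow] using isHomogeneous_X_pow (R := ZMod 2) i 2
      · simpa [-map_pow, Polynomial.coeff_X_mul, Polynomial.coeff_C] using isHomogeneous_zero _ _ _

lemma stq_hom {d : ℕ} {f : R5} (hf : f.IsHomogeneous d) (q : ℕ) : (stq q f).IsHomogeneous (d + q) := by
  rw [f.as_sum, map_sum]
  refine IsHomogeneous.sum _ _ _ fun a ha => ?_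
  have h1 : a.degree = d := by
    have := hf (mem_support_iff.1 ha)
    rw [← this, Finsupp.degree_eq_weight_one]; rfl
  have : (monomial a (coeff a f) : R5) = (coeff a f) • monomial a 1 := by simp [smul_monomial]
  rw [this, map_smul, ← h1]
  exact (homogeneousSubmodule _ _ _).smul_mem _ (bih_mono a q)

lemma sqP_even (F : Polynomial R5) (j : ℕ) : (F ^ 2).coeff (2 * j) = F.coeff j ^ 2 := by
  rw [← Polynomial.map_frobenius_expand, Polynomial.coeff_map, mul_comm, Polynomial.coeff_expand_mul (by norm_num)]
  rfl

lemma sqP_odd (F : Polynomial R5) (j : ℕ) (h : j % 2 = 1) : (F ^ 2).coeff j = 0 := by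
  rw [← Polynomial.map_frobenius_expand, Polynomial.coeff_map, Polynomial.coeff_expand (by norm_num), if_neg (by omega), map_zero]

lemma xs_insert {i : Fin 5} {s : Finset (Fin 5)} (h : i ∉ s) : xs (insert i s) = X i * xs s := by
  simp [xs, Finset.prod_insert h]

lemma xs_mul (s t : Finset (Fin 5)) : xs s * xs t = xs (symmDiff s t) * xs (s ∩ t) ^ 2 := by
  have h1 : xs s = xs (s \ t) * xs (s ∩ t) := by
    rw [xs, xs, xs, ← Finset.prod_union (Finset.disjoint_sdiff_inter s t), Finset.sdiff_union_inter]
  have h2 : xs t = xs (t \ s) * xs (s ∩ t) := by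
    rw [Finset.inter_comm, xs, xs, xs, ← Finset.prod_union (Finset.disjoint_sdiff_inter t s), Finset.sdiff_union_inter]
  have h3 : xs (symmDiff s t) = xs (s \ t) * xs (t \ s) := by
    rw [symmDiff, Finset.sup_eq_union, xs, xs, xs, Finset.prod_union (disjoint_sdiff_sdiff)]
  rw [h3, h1, h2]
  simp only [h1.symm, h2.symm]
  rw [h1, h2]; ring

lemma sqt_xs (s : Finset (Fin 5)) : sqt (xs s) = ∑ t ∈ s.powerset,
    Polynomial.X ^ t.card * Polynomial.C (xs (s \ t) * xs t ^ 2) := by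
  rw [xs, map_prod]
  simp_rw [sqt_X, add_comm (Polynomial.C (X _))]
  rw [Finset.prod_add]
  refine Finset.sum_congr rfl fun t ht => ?_
  rw [Finset.prod_mul_distrib, Finset.prod_const, mul_assoc]
  congr 1
  simp only [map_mul, xs, map_prod, map_pow, Finset.prod_pow]
  ring

/-- the key formula -/
lemma stq_xs (q : ℕ) (s : Finset (Fin 5)) (f : R5) : stq q (xs s * f ^ 2) = ∑ t ∈ s.powerset,
    if t.card ≤ q ∧ (q - t.card) % 2 = 0 then xs (s \ t) * (xs t * stq ((q - t.card) / 2) f) ^ 2 else 0 := by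
  rw [stq_def, map_mul, sqt_xs, Finset.sum_mul, Polynomial.finset_sum_coeff, map_pow]
  refine Finset.sum_congr rfl fun t ht => ?_
  rw [mul_assoc, Polynomial.coeff_X_pow_mul', Polynomial.coeff_C_mul]
  by_cases h : t.card ≤ q
  · rw [if_pos h]
    rcases Nat.mod_two_eq_zero_or_one (q - t.card) with h2 | h2
    · rw [if_pos ⟨h, h2⟩, stq_def]
      obtain ⟨j, hj⟩ := Nat.dvd_of_mod_eq_zero h2
      rw [hj, sqP_even, Nat.mul_div_cancel_left _ (by norm_num)]; ring
    · rw [sqP_odd _ _ h2, if_neg (by omega), mul_zero]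
  · rw [if_neg h, if_neg (by tauto)]

lemma sq_add2 (a b : R5) : (a + b) ^ 2 = a ^ 2 + b ^ 2 := CharTwo.add_sq a b

lemma z2sq (c : ZMod 2) : c ^ 2 = c := by revert c; decide

lemma sq_sum2 {ι : Type*} (s : Finset ι) (f : ι → R5) : (∑ i ∈ s, f i) ^ 2 = ∑ i ∈ s, f i ^ 2 := CharTwo.sum_sq s f

def ind (J : Finset (Fin 5)) : Fin 5 →₀ ℕ := Finsupp.equivFunOnFinite.symm fun i => if i ∈ J then 1 else 0

lemma ind_apply (J : Finset (Fin 5)) (i : Fin 5) : ind J i = if i ∈ J then 1 else 0 := rfl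

lemma ind_degree (J : Finset (Fin 5)) : (ind J).degree = J.card := by
  rw [Finsupp.degree_eq_sum]; simp [ind_apply]

lemma xs_mono (s : Finset (Fin 5)) : xs s = monomial (ind s) 1 := by
  rw [monomial_eq, xs, Finsupp.prod_fintype _ _ (by simp)]
  simp [ind_apply, Finset.prod_ite_mem, pow_ite]

def oddS (a : Fin 5 →₀ ℕ) : Finset (Fin 5) := Finset.univ.filter fun i => a i % 2 = 1
def hlf (a : Fin 5 →₀ ℕ) : Fin 5 →₀ ℕ := Finsupp.equivFunOnFinite.symm fun i => a i / 2

lemma hlf_apply (a : Fin 5 →₀ ℕ) (i : Fin 5) : hlf a i = a i / 2 := rfl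

lemma oh (a : Fin 5 →₀ ℕ) : ind (oddS a) + 2 • hlf a = a := by
  ext i; simp [ind_apply, oddS, hlf_apply]; split_ifs <;> omega

lemma odd_ind (J : Finset (Fin 5)) (b : Fin 5 →₀ ℕ) : oddS (ind J + 2 • b) = J := by
  ext i; simp [ind_apply, oddS]; split_ifs <;> simp_all

lemma hlf_ind (J : Finset (Fin 5)) (b : Fin 5 →₀ ℕ) : hlf (ind J + 2 • b) = b := by
  ext i; simp [ind_apply, hlf_apply]; split_ifs <;> omega

/-- `kap J (x_I u²) = [I = J] u` -/
def kap (J : Finset (Fin 5)) : R5 →ₗ[ZMod 2] R5 :=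
  (basisMonomials (Fin 5) (ZMod 2)).constr (ZMod 2) fun a => if oddS a = J then monomial (hlf a) 1 else 0

lemma kap_mono (J : Finset (Fin 5)) (a : Fin 5 →₀ ℕ) (c : ZMod 2) :
    kap J (monomial a c) = if oddS a = J then monomial (hlf a) c else 0 := by
  have : (monomial a c : R5) = c • basisMonomials (Fin 5) (ZMod 2) a := by simp [smul_monomial]
  rw [this, map_smul, kap, Module.Basis.constr_basis]
  split_ifs <;> simp [smul_monomial]

lemma kap_mul (J s : Finset (Fin 5)) (f : R5) : kap J (xs s * f ^ 2) = if s = J then f else 0 := by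
  induction f using MvPolynomial.induction_on' with
  | monomial a c =>
    rw [xs_mono, monomial_pow, monomial_mul, kap_mono, odd_ind, hlf_ind, one_mul, z2sq]
  | add p q hp hq =>
    rw [sq_add2, mul_add, map_add, hp, hq]; split_ifs <;> simp

lemma kap_dec (f : R5) : f = ∑ J : Finset (Fin 5), xs J * kap J f ^ 2 := by
  induction f using MvPolynomial.induction_on' with
  | monomial a c =>
    rw [Finset.sum_eq_single (oddS a)]
    · rw [kap_mono, if_pos rfl, xs_mono, monomial_pow, monomial_mul, oh, one_mul, z2sq]
    · intro J _ h; rw [kap_mono, if_neg (Ne.symm h)]; simp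
    · simp
  | add p q hp hq =>
    simp_rw [map_add, sq_add2, mul_add]; rw [Finset.sum_add_distrib, ← hp, ← hq]

lemma kap_mulsq (J : Finset (Fin 5)) (f u : R5) : kap J (f * u ^ 2) = kap J f * u := by
  conv_lhs => rw [kap_dec f, Finset.sum_mul, map_sum]
  rw [Finset.sum_eq_single J]
  · rw [mul_assoc, ← mul_pow, kap_mul, if_pos rfl]
  · intro s _ h; rw [mul_assoc, ← mul_pow, kap_mul, if_neg h]
  · simp

lemma kap_coeff (J : Finset (Fin 5)) (f : R5) (b : Fin 5 →₀ ℕ) : coeff b (kap J f) = coeff (ind J + 2 • b) f := by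
  induction f using MvPolynomial.induction_on' with
  | monomial a c =>
    rw [kap_mono, coeff_monomial]
    by_cases h : a = ind J + 2 • b
    · rw [if_pos h, h, odd_ind, if_pos rfl, hlf_ind, coeff_monomial, if_pos rfl]
    · rw [if_neg h]
      split_ifs with h2
      · rw [coeff_monomial, if_neg]
        rintro rfl; exact h (by rw [← h2, oh])
      · simp
  | add p q hp hq => simp [hp, hq]

lemma hom_iff {f : R5} {d : ℕ} : f.IsHomogeneous d ↔ ∀ a, coeff a f ≠ 0 → a.degree = d := by
  simp only [IsHomogeneous, IsWeightedHomogeneous, Finsupp.degree_eq_weight_one]; rfl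

lemma kap_hom {J : Finset (Fin 5)} {f : R5} {d m : ℕ} (hf : f.IsHomogeneous d) (h : d = J.card + 2 * m) :
    (kap J f).IsHomogeneous m := by
  rw [hom_iff] at *
  intro a ha
  rw [kap_coeff] at ha
  have := hf _ ha
  rw [map_add, ind_degree, map_nsmul, smul_eq_mul] at this; omega

lemma kap_hom0 {J : Finset (Fin 5)} {f : R5} {d : ℕ} (hf : f.IsHomogeneous d) (h : ∀ m, d ≠ J.card + 2 * m) :
    kap J f = 0 := by
  rw [hom_iff] at hf
  ext a
  rw [kap_coeff]
  by_contra ha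
  have := hf _ ha
  rw [map_add, ind_degree, map_nsmul, smul_eq_mul] at this; exact h _ this.symm

lemma xs_hom (s : Finset (Fin 5)) : (xs s).IsHomogeneous s.card := by
  have := IsHomogeneous.prod s (fun i => (X i : R5)) (fun _ => 1) (fun i _ => isHomogeneous_X _ i)
  simpa [xs] using this

/-- global hits -/
def HH : Submodule (ZMod 2) R5 := Submodule.span (ZMod 2) {u | ∃ q f, 0 < q ∧ u = stq q f}

lemma stq_mem {q : ℕ} (h : 0 < q) (f : R5) : stq q f ∈ HH := Submodule.subset_span ⟨q, f, h, rfl⟩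

lemma comp_of_hom {f : R5} {e : ℕ} (h : f.IsHomogeneous e) (d : ℕ) : homogeneousComponent d f = if e = d then f else 0 := by
  rw [homogeneousComponent_of_mem ((mem_homogeneousSubmodule _ _).2 h)]; simp only [eq_comm]

lemma comp_stq (d q : ℕ) (f : R5) : homogeneousComponent d (stq q f) =
    if q ≤ d then stq q (homogeneousComponent (d - q) f) else 0 := by
  conv_lhs => rw [← sum_homogeneousComponent f, map_sum, map_sum]
  have h : ∀ i, homogeneousComponent d (stq q (homogeneousComponent i f)) =
      if i + q = d then stq q (homogeneousComponent i f) else 0 := fun i =>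
    comp_of_hom (stq_hom (homogeneousComponent_isHomogeneous i f) q) d
  simp_rw [h]
  split_ifs with hq
  · by_cases h2 : d - q ∈ Finset.range (f.totalDegree + 1)
    · rw [Finset.sum_eq_single (d - q)]
      · rw [if_pos (by omega)]
      · intro b _ hb; rw [if_neg (by omega)]
      · exact fun h => absurd h2 h
    · rw [homogeneousComponent_eq_zero (d - q) f (by simp at h2; omega), map_zero]
      refine Finset.sum_eq_zero fun i hi => ?_
      rw [if_neg]; rintro rfl; apply h2; simpa using hi
  · exact Finset.sum_eq_zero fun i _ => if_neg (by omega)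

lemma HH_comp {u : R5} (d : ℕ) (hu : u ∈ HH) : homogeneousComponent d u ∈ HH := by
  induction hu using Submodule.span_induction with
  | mem x hx =>
    obtain ⟨q, f, hq, rfl⟩ := hx
    rw [comp_stq]; split_ifs
    · exact stq_mem hq _
    · exact zero_mem _
  | zero => simp
  | add x y _ _ hx hy => rw [map_add]; exact add_mem hx hy
  | smul a x _ hx => rw [map_smul]; exact Submodule.smul_mem _ _ hx

lemma SqT_mod (f : R5) : SqT 5 f - f ∈ HH := by
  rw [SqT_eq_sum, Finset.sum_range_succ', stq_zero, add_sub_cancel_right]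
  exact Submodule.sum_mem _ fun q _ => stq_mem (by omega) f

lemma comp_SqT {e d : ℕ} {f : R5} (hf : f.IsHomogeneous e) (h : e ≤ d) : homogeneousComponent d (SqT 5 f) = stq (d - e) f := by
  rw [SqT_eq_sum, map_sum]
  have h1 : ∀ q, homogeneousComponent d (stq q f) = if e + q = d then stq q f else 0 := fun q =>
    comp_of_hom (stq_hom hf q) d
  simp_rw [h1]
  by_cases h2 : d - e ∈ Finset.range ((sqt f).natDegree + 1)
  · rw [Finset.sum_eq_single (d - e)]
    · rw [if_pos (by omega)]
    · intro b _ hb; rw [if_neg (by omega)]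
    · exact fun h => absurd h2 h
  · rw [stq_def, Polynomial.coeff_eq_zero_of_natDegree_lt (by simp at h2; omega)]
    refine Finset.sum_eq_zero fun i hi => ?_
    rw [if_neg]; rintro rfl; apply h2; simpa using hi

lemma hit_le (d : ℕ) : hitSub 5 d ≤ HH := by
  refine Submodule.span_le.2 ?_
  rintro u ⟨f, hf, rfl⟩
  refine Submodule.sum_mem _ fun i hi => ?_
  rw [Finset.mem_Icc] at hi
  rw [comp_SqT ((mem_homogeneousSubmodule _ _).1 (hf i)) (by omega)]
  exact stq_mem (by omega) _

lemma HH_hit {u : R5} (d : ℕ) (hu : u ∈ HH) : homogeneousComponent d u ∈ hitSub 5 d := by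
  induction hu using Submodule.span_induction with
  | mem x hx =>
    obtain ⟨q, f, hq, rfl⟩ := hx
    rw [comp_stq]; split_ifs with h
    · refine Submodule.subset_span ⟨fun i => if i = q then homogeneousComponent (d - q) f else 0, fun i => ?_, ?_⟩
      · dsimp only; split_ifs with h
        · subst h; exact homogeneousComponent_mem _ _
        · exact zero_mem _
      · rw [Finset.sum_eq_single q]
        · dsimp only; rw [if_pos rfl, comp_SqT (homogeneousComponent_isHomogeneous _ _) (by omega)]; congr 2; omega
        · intro b _ hb; dsimp only; rw [if_neg hb]; simp
        · intro h2; exact absurd (Finset.mem_Icc.2 ⟨hq, h⟩) h2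
    · exact zero_mem _
  | zero => simp
  | add x y _ _ hx hy => rw [map_add]; exact add_mem hx hy
  | smul a x _ hx => rw [map_smul]; exact Submodule.smul_mem _ _ hx

def pop (n : ℕ) : ℕ := if n = 0 then 0 else n % 2 + pop (n / 2)
termination_by n
decreasing_by omega

lemma pop_rec (n : ℕ) : pop n = n % 2 + pop (n / 2) := by
  by_cases h : n = 0
  · subst h; simp [pop]
  · rw [pop, if_neg h]

lemma pop_succ (n : ℕ) : pop (n + 1) ≤ pop n + 1 := by
  induction n using Nat.strong_induction_on with
  | _ n ih =>
    rw [pop_rec (n + 1), pop_rec n]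
    rcases Nat.mod_two_eq_zero_or_one n with h | h
    · rw [show (n + 1) / 2 = n / 2 by omega]; omega
    · rw [show (n + 1) / 2 = n / 2 + 1 by omega]
      have := ih (n / 2) (by omega); omega

lemma pop_add (a b : ℕ) : pop (a + b) ≤ pop a + pop b := by
  induction a using Nat.strong_induction_on generalizing b with
  | _ a ih =>
    by_cases h0 : a = 0
    · subst h0; simp
    have := ih (a / 2) (by omega) (b / 2)
    have h3 := pop_succ (a / 2 + b / 2)
    rw [pop_rec (a + b), pop_rec a, pop_rec b]
    by_cases h : a % 2 = 1 ∧ b % 2 = 1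
    · rw [show (a + b) / 2 = a / 2 + b / 2 + 1 by omega]; omega
    · rw [show (a + b) / 2 = a / 2 + b / 2 by omega]; omega

lemma pop_two_pow (k : ℕ) : pop (2 ^ k) = 1 := by
  induction k with
  | zero => rw [pop_rec]; simp [pop]
  | succ k ih => rw [pop_rec, pow_succ, Nat.mul_div_cancel _ (by norm_num), ih]; simp

lemma pop_pred (s m : ℕ) (hm : 0 < m) : pop (2 ^ s * m - 1) = s + pop (m - 1) := by
  induction s with
  | zero => simp
  | succ s ih =>
    have : 0 < 2 ^ s * m := by positivity
    have h2 : 2 ^ (s + 1) * m = 2 * (2 ^ s * m) := by ring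
    rw [pop_rec, show (2 ^ (s + 1) * m - 1) / 2 = 2 ^ s * m - 1 by omega, ih]; omega

lemma supp_mul {p q : R5} {a : Fin 5 →₀ ℕ} (h : coeff a (p * q) ≠ 0) :
    ∃ b c, coeff b p ≠ 0 ∧ coeff c q ≠ 0 ∧ a = b + c := by
  rw [coeff_mul] at h
  obtain ⟨x, hx, h⟩ := Finset.exists_ne_zero_of_sum_ne_zero h
  rw [Finset.HasAntidiagonal.mem_antidiagonal] at hx
  exact ⟨x.1, x.2, left_ne_zero_of_mul h, right_ne_zero_of_mul h, hx.symm⟩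

lemma top_mono (a : Fin 5 →₀ ℕ) : (sqt (monomial a 1)).natDegree ≤ a.degree ∧
    stq a.degree (monomial a 1) = monomial a 1 ^ 2 := by
  induction a using Finsupp.induction_linear with
  | zero =>
    have : (monomial 0 1 : R5) = 1 := rfl
    simp [this, stq_def]
  | add a b ha hb =>
    have : (monomial (a + b) 1 : R5) = monomial a 1 * monomial b 1 := by simp
    rw [this, map_mul, stq_def, map_mul, map_add]
    refine ⟨Polynomial.natDegree_mul_le.trans (add_le_add ha.1 hb.1), ?_⟩
    rw [Polynomial.coeff_mul_add_eq_of_natDegree_le ha.1 hb.1, ← stq_def, ← stq_def, ha.2, hb.2, mul_pow]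
  | single i n =>
    rw [Finsupp.degree_single]
    have : (monomial (Finsupp.single i n) 1 : R5) = X i ^ n := by rw [X_pow_eq_monomial]
    rw [this, stq_def, map_pow]
    have h1 : (sqt (X i)).natDegree ≤ 1 := by
      rw [sqt_X]
      refine (Polynomial.natDegree_add_le _ _).trans ?_
      rw [Polynomial.natDegree_C, Nat.zero_max]
      exact (Polynomial.natDegree_mul_C_le _ _).trans Polynomial.natDegree_X_le
    have h2 : (sqt (X i)).coeff 1 = X i ^ 2 := by
      rw [sqt_X, Polynomial.coeff_add, Polynomial.coeff_C]; simp [-map_pow]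
    refine ⟨(Polynomial.natDegree_pow_le_of_le n h1).trans (by simp), ?_⟩
    have := Polynomial.coeff_pow_of_natDegree_le h1 (m := n)
    rw [mul_one] at this
    rw [this, h2]; ring

lemma stq_top {e : ℕ} {y : R5} (hy : y.IsHomogeneous e) : stq e y = y ^ 2 := by
  rw [y.as_sum, map_sum, sq_sum2]
  refine Finset.sum_congr rfl fun a ha => ?_
  have h1 := hom_iff.1 hy a (mem_support_iff.1 ha)
  have : (monomial a (coeff a y) : R5) = (coeff a y) • monomial a 1 := by simp [smul_monomial]
  rw [this, map_smul, ← h1, (top_mono a).2, _root_.smul_pow, z2sq]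

def CN (N : ℕ) (i : Fin 5) : R5 := ∑ k ∈ Finset.range N, X i ^ 2 ^ k

lemma SqT_CN (N : ℕ) (i : Fin 5) : SqT 5 (CN N i) = X i + X i ^ 2 ^ N := by
  induction N with
  | zero => simp [CN, CharTwo.add_self_eq_zero]
  | succ N ih =>
    rw [CN, Finset.sum_range_succ, map_add, ← CN, ih]
    have : SqT 5 (X i ^ 2 ^ N) = X i ^ 2 ^ N + X i ^ 2 ^ (N + 1) := by
      rw [map_pow, SqT, aeval_X, add_pow_char_pow, ← pow_mul, pow_succ, mul_comm]
    rw [this, add_assoc, ← add_assoc (X i ^ 2 ^ N), CharTwo.add_self_eq_zero, zero_add]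

lemma CN_pop (N : ℕ) (s : Finset (Fin 5)) (a : Fin 5 →₀ ℕ) (h : coeff a (∏ i ∈ s, CN N i) ≠ 0) : pop a.degree ≤ s.card := by
  induction s using Finset.induction_on generalizing a with
  | empty =>
    rw [Finset.prod_empty, coeff_one] at h
    have : a = 0 := by by_contra h2; exact h (if_neg (Ne.symm h2))
    subst this; simp [pop]
  | insert i s hi ih =>
    rw [Finset.prod_insert hi] at h
    obtain ⟨b, c, hb, hc, rfl⟩ := supp_mul h
    rw [Finset.card_insert_of_notMem hi, map_add]
    have h1 : pop b.degree = 1 := by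
      rw [CN, coeff_sum] at hb
      obtain ⟨k, _, hk⟩ := Finset.exists_ne_zero_of_sum_ne_zero hb
      rw [X_pow_eq_monomial, coeff_monomial] at hk
      have : Finsupp.single i (2 ^ k) = b := by by_contra h2; exact hk (if_neg h2)
      rw [← this, Finsupp.degree_single, pop_two_pow]
    have := pop_add b.degree c.degree
    have := ih c hc
    omega

def big (M : ℕ) (z : R5) : Prop := ∀ a, coeff a z ≠ 0 → M ≤ a.degree

lemma big_mul {M : ℕ} {z : R5} (h : big M z) (p : R5) : big M (z * p) := by
  intro a ha
  obtain ⟨b, c, hb, hc, rfl⟩ := supp_mul ha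
  have := h b hb
  rw [map_add]; omega

lemma big_comp {M : ℕ} {z : R5} (h : big M z) {d : ℕ} (hd : d < M) : homogeneousComponent d z = 0 := by
  ext a
  rw [coeff_homogeneousComponent]
  split_ifs with h1
  · by_contra h2
    have := h a h2
    omega
  · simp

lemma prod_big (M : ℕ) (s : Finset (Fin 5)) : ∃ z, big M z ∧ ∏ i ∈ s, (X i + X i ^ M) = xs s + z := by
  induction s using Finset.induction_on with
  | empty => exact ⟨0, fun a ha => by simp at ha, by simp [xs]⟩
  | insert i s hi ih =>
    obtain ⟨z, hz, h⟩ := ih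
    refine ⟨z * X i + X i ^ M * (xs s + z), fun a ha => ?_, ?_⟩
    · rw [coeff_add] at ha
      by_cases h1 : coeff a (z * X i) = 0
      · rw [h1, zero_add] at ha
        refine big_mul (M := M) (fun b hb => ?_) _ a ha
        rw [X_pow_eq_monomial, coeff_monomial] at hb
        have : Finsupp.single i M = b := by by_contra h2; exact hb (if_neg h2)
        rw [← this, Finsupp.degree_single]
      · exact big_mul hz _ a h1
    · rw [Finset.prod_insert hi, h, xs_insert hi]; ring

lemma comp_mul_hom {f g : R5} {e d : ℕ} (hg : g.IsHomogeneous e) :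
    homogeneousComponent (d + e) (g * f) = g * homogeneousComponent d f := by
  conv_lhs => rw [← sum_homogeneousComponent f, Finset.mul_sum, map_sum]
  have h : ∀ i, homogeneousComponent (d + e) (g * homogeneousComponent i f) =
      if e + i = d + e then g * homogeneousComponent i f else 0 := fun i =>
    comp_of_hom (hg.mul (homogeneousComponent_isHomogeneous i f)) _
  simp_rw [h]
  by_cases h2 : d ∈ Finset.range (f.totalDegree + 1)
  · rw [Finset.sum_eq_single d]
    · rw [if_pos (by omega)]
    · intro b _ hb; rw [if_neg (by omega)]
    · exact fun h => absurd h2 h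
  · rw [homogeneousComponent_eq_zero d f (by simp at h2; omega), mul_zero]
    refine Finset.sum_eq_zero fun i hi => ?_
    rw [if_neg]; intro h3; apply h2; rwa [show d = i by omega]

lemma wood (s : Finset (Fin 5)) {y : R5} {e : ℕ} (hy : y.IsHomogeneous e) (h : s.card < pop (s.card + e)) :
    xs s * y ^ 2 ∈ HH := by
  set N := s.card + 2 * e
  have hN : N < 2 ^ N := Nat.lt_two_pow_self
  set c := ∏ i ∈ s, CN N i
  have h1 := HH_comp N (SqT_mod (y * c))
  have h2 : homogeneousComponent N (y * c) = 0 := by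
    rw [show N = (s.card + e) + e by omega, comp_mul_hom hy]
    have : homogeneousComponent (s.card + e) c = 0 := by
      ext a
      rw [coeff_homogeneousComponent]
      split_ifs with h1
      · by_contra h2
        have := CN_pop N s a h2
        rw [h1] at this; omega
      · simp
    rw [this, mul_zero]
  have h3 : homogeneousComponent N (SqT 5 (y * c)) = xs s * y ^ 2 := by
    obtain ⟨z, hz, hz2⟩ := prod_big (2 ^ N) s
    rw [map_mul, map_prod]
    simp_rw [SqT_CN]
    rw [hz2, mul_add, map_add, mul_comm _ z, big_comp (big_mul hz _) hN, add_zero, mul_comm,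
      show N = 2 * e + s.card by omega, comp_mul_hom (xs_hom s), comp_SqT hy (by omega),
      show 2 * e - e = e by omega, stq_top hy]
  rw [map_sub, h2, h3, sub_zero] at h1
  exact h1

lemma kap_stq (q : ℕ) (f : R5) : kap Finset.univ (stq q f) = if q % 2 = 0 then stq (q / 2) (kap Finset.univ f) else 0 := by
  conv_lhs => rw [kap_dec f, map_sum, map_sum]
  rw [Finset.sum_eq_single Finset.univ]
  · rw [stq_xs, map_sum, Finset.sum_eq_single ∅]
    · have : (xs ∅ : R5) = 1 := by simp [xs]
      simp only [Finset.card_empty, Nat.zero_le, true_and, Nat.sub_zero, Finset.sdiff_empty, this, one_mul]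
      split_ifs
      · rw [kap_mul, if_pos rfl]
      · simp
    · intro t _ ht
      split_ifs
      · rw [kap_mul, if_neg]
        intro h; apply ht
        ext i; have : i ∈ Finset.univ \ t := by rw [h]; simp
        simpa using this
      · simp
    · simp
  · intro s _ hs
    rw [stq_xs, map_sum]
    refine Finset.sum_eq_zero fun t _ => ?_
    split_ifs
    · rw [kap_mul, if_neg]
      intro h; apply hs
      refine Finset.eq_univ_iff_forall.2 fun i => ?_
      have : i ∈ s \ t := by rw [h]; simp
      exact (Finset.mem_sdiff.1 this).1
    · simp
  · simp

lemma kap_HH {u : R5} (hu : u ∈ HH) : kap Finset.univ u ∈ HH := by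
  induction hu using Submodule.span_induction with
  | mem x hx =>
    obtain ⟨q, f, hq, rfl⟩ := hx
    rw [kap_stq]; split_ifs
    · exact stq_mem (by omega) _
    · exact zero_mem _
  | zero => simp
  | add x y _ _ hx hy => rw [map_add]; exact add_mem hx hy
  | smul a x _ hx => rw [map_smul]; exact Submodule.smul_mem _ _ hx

def KC (d : ℕ) : Prop := ∀ r, r < 5 → r % 2 = 1 → r < pop (d + (5 + r) / 2)

lemma wood5 {d : ℕ} (hd : KC d) {J : Finset (Fin 5)} (hJ : J ≠ Finset.univ) {y : R5} {m : ℕ}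
    (hy : y.IsHomogeneous m) (h : 2 * d + 5 = J.card + 2 * m) : xs J * y ^ 2 ∈ HH := by
  have h1 : J.card < 5 := by
    have := Finset.card_lt_univ_of_notMem (s := J) (x := (Finset.univ \ J).min' (by
      rw [Finset.sdiff_nonempty]; intro h; exact hJ (Finset.univ_subset_iff.1 h)))
      (Finset.mem_sdiff.1 (Finset.min'_mem _ _)).2
    simpa using this
  refine wood J hy ?_
  have := hd J.card h1 (by omega)
  rwa [show J.card + m = d + (5 + J.card) / 2 by omega]

lemma Phi_HH {d : ℕ} (hd : KC d) {v : R5} (hv : v ∈ HH) : xs Finset.univ * homogeneousComponent d v ^ 2 ∈ HH := by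
  induction hv using Submodule.span_induction with
  | mem x hx =>
    obtain ⟨q, f, hq, rfl⟩ := hx
    rw [comp_stq]; split_ifs with h
    · set g := homogeneousComponent (d - q) f
      have hg : g.IsHomogeneous (d - q) := homogeneousComponent_isHomogeneous _ _
      have h1 := stq_mem (show 0 < 2 * q by omega) (xs Finset.univ * g ^ 2)
      rw [stq_xs, ← Finset.add_sum_erase _ _ (Finset.empty_mem_powerset _)] at h1
      have : (xs ∅ : R5) = 1 := by simp [xs]
      rw [if_pos (by simp), this, one_mul, Finset.card_empty, Nat.sub_zero, Nat.mul_div_cancel_left _ (by norm_num),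
        Finset.sdiff_empty] at h1
      refine (Submodule.add_mem_iff_left _ (Submodule.sum_mem _ fun t ht => ?_)).1 h1
      split_ifs with h2
      · have h3 := stq_hom hg ((2 * q - t.card) / 2)
        have h4 : (Finset.univ \ t).card = 5 - t.card := by rw [Finset.card_sdiff]; simp
        have h5 : t.card ≤ 5 := by simpa using Finset.card_le_univ t
        refine wood5 hd ?_ ((xs_hom t).mul h3) (by omega)
        intro h5
        apply (Finset.mem_erase.1 ht).1
        ext i; have : i ∈ Finset.univ \ t := by rw [h5]; simp
        simpa using this
      · exact zero_mem _
    · simp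
  | zero => simp
  | add x y _ _ hx hy => rw [map_add, sq_add2, mul_add]; exact add_mem hx hy
  | smul a x _ hx =>
    rw [map_smul, _root_.smul_pow, mul_smul_comm]; exact Submodule.smul_mem _ _ hx

lemma hit_of_HH {u : R5} {d : ℕ} (h : u.IsHomogeneous d) (hu : u ∈ HH) : u ∈ hitSub 5 d := by
  have := HH_hit d hu
  rwa [comp_of_hom h, if_pos rfl] at this

def kR (d : ℕ) : homSub 5 (2 * d + 5) →ₗ[ZMod 2] homSub 5 d :=
  (kap Finset.univ).restrict fun u hu => (mem_homogeneousSubmodule _ _).2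
    (kap_hom ((mem_homogeneousSubmodule _ _).1 hu) (by simp; ring))

theorem kameko (d : ℕ) (hd : KC d) : Module.finrank (ZMod 2) (QP 5 (2 * d + 5)) = Module.finrank (ZMod 2) (QP 5 d) := by
  let φ := ((hitSub 5 d).comap (homSub 5 d).subtype).mkQ ∘ₗ kR d
  have hs : Function.Surjective φ := by
    refine (Submodule.mkQ_surjective _).comp fun v => ?_
    refine ⟨⟨xs Finset.univ * v.1 ^ 2, ?_⟩, Subtype.ext ?_⟩
    · rw [mem_homogeneousSubmodule]
      have := (xs_hom Finset.univ).mul (((mem_homogeneousSubmodule _ _).1 v.2).pow 2)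
      convert this using 1; simp; ring
    · exact (kap_mul _ _ _).trans (if_pos rfl)
  have hk : LinearMap.ker φ = (hitSub 5 (2 * d + 5)).comap (homSub 5 (2 * d + 5)).subtype := by
    ext u
    have hu := (mem_homogeneousSubmodule _ _).1 u.2
    have hku : (kap Finset.univ u.1).IsHomogeneous d := kap_hom hu (by simp; ring)
    rw [LinearMap.mem_ker, LinearMap.comp_apply, Submodule.mkQ_apply, Submodule.Quotient.mk_eq_zero,
      Submodule.mem_comap, Submodule.mem_comap]
    change kap Finset.univ u.1 ∈ _ ↔ u.1 ∈ _
    constructor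
    · intro h
      refine hit_of_HH hu ?_
      rw [kap_dec u.1]
      refine Submodule.sum_mem _ fun J _ => ?_
      by_cases hJ : J = Finset.univ
      · subst hJ
        have := Phi_HH hd (hit_le d h)
        rwa [comp_of_hom hku, if_pos rfl] at this
      · by_cases hm : ∃ m, 2 * d + 5 = J.card + 2 * m
        · obtain ⟨m, hm⟩ := hm
          exact wood5 hd hJ (kap_hom hu hm) hm
        · push Not at hm
          rw [kap_hom0 hu hm]; simp
    · intro h
      exact hit_of_HH hku (kap_HH (hit_le _ h))
  have e := φ.quotKerEquivOfSurjective hs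
  rw [hk] at e
  exact e.finrank_eq

theorem red67 (s : ℕ) (hs : 2 ≤ s) : Module.finrank (ZMod 2) (QP 5 (18 * 2 ^ s - 5)) = Module.finrank (ZMod 2) (QP 5 67) := by
  induction s, hs using Nat.le_induction with
  | base => rfl
  | succ s hs ih =>
    have h4 : 4 ≤ 2 ^ s := by
      calc 4 = 2 ^ 2 := rfl
        _ ≤ 2 ^ s := Nat.pow_le_pow_right (by norm_num) hs
    have hK : KC (18 * 2 ^ s - 5) := ?_
    · rw [show 18 * 2 ^ (s + 1) - 5 = 2 * (18 * 2 ^ s - 5) + 5 by rw [pow_succ]; omega, kameko _ hK, ih]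
    · intro r h5 h2
      obtain rfl | rfl : r = 1 ∨ r = 3 := by omega
      · rw [pop_rec, show (18 * 2 ^ s - 5 + (5 + 1) / 2) / 2 = 2 ^ s * 9 - 1 by omega, pop_pred _ _ (by norm_num)]
        omega
      · rw [show 18 * 2 ^ s - 5 + (5 + 3) / 2 = 2 ^ s * 18 - 1 by omega, pop_pred _ _ (by norm_num)]
        have : pop (18 - 1) = 2 := by rw [show 18 - 1 = 2 ^ 4 * 1 + 1 by rfl]; simp [pop]
        omega

local notation "iF" b "thN" x "elS" y => @Bool.rec (fun _ => _) y x b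

inductive Tr where
  | e : Tr
  | lf : ℕ → ℕ → List ℕ → Tr
  | n : ℕ → Tr → Tr → Tr

def pc (a : ℕ) : ℕ := Nat.mod (Nat.shiftRight 55157063682984551670960690248 (Nat.mul 3 (Nat.mod a 32))) 8

/-- multiply by the squarefree monomial `S` -/
def mulx (n : ℕ) : ℕ → ℕ → ℕ := Nat.rec (fun _ c => c) (fun _ ih S c =>
  iF Nat.beq S 0 thN c elS ih (Nat.mul 32 (Nat.land S c)) (Nat.xor S c)) n

/-- forced map -/
def frc {β : Type} (n : ℕ) (f : ℕ → β) : β := Nat.rec (f 0) (fun m _ => f (Nat.succ m)) n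

def insX (x : ℕ) (l : List ℕ) : List ℕ := List.rec [x] (fun y r ih =>
  iF Nat.beq x y thN r elS iF Nat.ble y x thN x :: y :: r elS y :: ih) l

def ltC (ν : List ℕ) : ℕ → Bool := List.rec (fun _ => false) (fun a _ ih c =>
  iF Nat.beq (pc c) a thN ih (Nat.div c 32) elS Nat.blt (pc c) a) ν

def sizeList : List (ℕ × List ℕ) := [(0, [0]), (1, [1, 2, 4, 8, 16]), (2, [3, 5, 6, 9, 10, 12, 17, 18, 20, 24]),
  (3, [7, 11, 13, 14, 19, 21, 22, 25, 26, 28]), (4, [15, 23, 27, 29, 30]), (5, [31])]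

def mapA (o : ℕ) (l acc : List ℕ) : List ℕ := List.rec acc (fun a _ ih => Nat.add o (Nat.mul 32 a) :: ih) l

/-- terms of `x_C * Sq^q (mon w)` that are not lower than `ν` -/
def sqG (n : ℕ) : List ℕ → ℕ → ℕ → ℕ → List ℕ := Nat.rec (fun _ _ _ _ => []) (fun _ ih ν w q C =>
  iF Nat.beq q 0 thN (iF ltC ν (mulx 9 C w) thN [] elS [mulx 9 C w]) elS
  iF Nat.beq w 0 thN [] elS
  List.rec [] (fun p _ acc =>
    iF Nat.ble p.1 q thN 
      iF Nat.beq (Nat.mod (Nat.sub q p.1) 2) 0 thN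
        List.rec acc (fun S _ acc2 =>
          iF Nat.beq (Nat.land S (Nat.mod w 32)) S thN
            frc (Nat.xor (Nat.xor (Nat.mod w 32) S) C) fun o =>
            frc (Nat.lor S (Nat.land (Nat.mod w 32) C)) fun C' =>
            frc (Nat.div (Nat.sub q p.1) 2) fun q' =>
            frc (Nat.div w 32) fun w' =>
            List.rec (mapA o (ih [] w' q' C') acc2)
              (fun a μ _ => iF Nat.ble a (pc o) thN 
                iF Nat.beq a (pc o) thN mapA o (ih μ w' q' C') acc2 elS mapA o (ih [] w' q' C') acc2
                elS acc2) ν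
          elS acc2) p.2
      elS acc
    elS acc) sizeList) n

def mrg (a : List ℕ) : List ℕ → List ℕ := List.rec (fun b => b) (fun x a ih b =>
  List.rec (x :: a) (fun y b ihb => iF Nat.beq x y thN ih b elS iF Nat.ble y x thN x :: ih (y :: b) elS y :: ihb) b) a

def Tr.get (D : Tr) (c : ℕ) : Option (List ℕ) := Tr.rec none
  (fun M k t => iF Nat.beq (Nat.mod c M) k thN some t elS none)
  (fun m _ _ gl gr => iF Nat.beq (Nat.land c m) 0 thN gl elS gr) D

/-- nearest leaf key -/
def Tr.near (D : Tr) (c : ℕ) : ℕ := Tr.rec 0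
  (fun _ k _ => k)
  (fun m _ _ gl gr => iF Nat.beq (Nat.land c m) 0 thN gl elS gr) D

def mkN (m c : ℕ) (l : Tr) (D : Tr) : Tr := iF Nat.beq (Nat.land c m) 0 thN .n m l D elS .n m D l

/-- insert leaf `l` with key `c` at critical bit `m` -/
def Tr.insK {β : Type} (c m : ℕ) (l : Tr) (D : Tr) : (Tr → β) → β := Tr.rec (fun k => k l)
  (fun M c' t k => iF Nat.beq m 0 thN k l elS k (mkN m c l (.lf M c' t)))
  (fun m' a b ga gb k => iF Nat.blt m m' thN k (mkN m c l (.n m' a b)) elS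
    iF Nat.beq (Nat.land c m') 0 thN ga (fun a' => k (.n m' a' b)) elS gb (fun b' => k (.n m' a b'))) D

def mapS (c s : ℕ) (l : List ℕ) : List ℕ := List.rec [] (fun a _ ih => Nat.sub c (Nat.mul a s) :: ih) l

/-- one rewriting step with continuation -/
def rwK {β : Type} (D : Tr) (n : ℕ) (c : ℕ) (kn : β) (ks : List ℕ → β) : ℕ → ℕ → β := Nat.rec (fun _ _ => kn)
  (fun _ ih d s => frc d fun d => Option.rec (ih (Nat.div d 32) (Nat.mul 32 s)) (fun t => ks (mapS c s t)) (D.get d)) n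

def redL (D : Tr) (L : ℕ) (n : ℕ) : List ℕ → List ℕ := Nat.rec (fun p => p) (fun _ ih p =>
  List.rec [] (fun c r _ => frc c fun c => rwK D L c (c :: r) (fun t => ih (mrg r t)) c 1) p) n

def wtEq (ν : List ℕ) : ℕ → Bool := List.rec (fun c => Nat.beq c 0) (fun a _ ih c =>
  iF Nat.beq (pc c) a thN ih (Nat.div c 32) elS false) ν

/-- expansion of the items of a rule -/
def expd (ν : List ℕ) (its : List ℕ) : List ℕ := List.rec [] (fun N _ acc =>
  iF Nat.beq (Nat.mod N 32) 0 thN acc elS 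
  iF Nat.blt (Nat.mod N 32) (Nat.pow 2 ν.length) thN iF Nat.blt (Nat.div N 32) (Nat.pow 32 7) thN
    List.rec acc (fun x _ ih => insX x ih) (sqG 8 ν (Nat.div N 32) (Nat.mod N 32) 0)
  elS acc elS acc) its

/-- forced list with a check on all entries -/
def chW {β : Type} (p : ℕ → Bool) (kf : β) (l : List ℕ) : (List ℕ → β) → β := List.rec (fun k => k [])
  (fun c _ ih k => frc c fun c => iF p c thN ih (fun r => k (c :: r)) elS kf) l

/-- check the tail: all smaller than `c`; collect differences -/
def tlK {β : Type} (c : ℕ) (kf : β) (t : List ℕ) : (List ℕ → β) → β := List.rec (fun k => k [])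
  (fun u _ ih k => frc u fun u => iF Nat.blt u c thN ih (fun r => frc (Nat.sub c u) fun d => k (d :: r)) elS kf) t

def lowb (x : ℕ) : ℕ := Nat.xor x (Nat.land x (Nat.pred x))

def addR {β : Type} (ν : List ℕ) (D : Tr) (its : List ℕ) (k : Tr → β) : β :=
  chW (wtEq ν) (k D) (expd ν its) fun p => List.rec (k D) (fun c t _ => frc c fun c =>
    tlK c (k D) t fun t' => frc (Nat.pow 32 ν.length) fun M => frc (lowb (Nat.xor c (D.near c))) fun m => Tr.insK c m (.lf M c t') D k)
    (redL D ν.length 100000 p)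

def addG {β : Type} (ν : List ℕ) (rs : List (List ℕ)) : Tr → (Tr → β) → β := List.rec (fun D k => k D)
  (fun r _ ih D k => addR ν D r fun D => ih D k) rs

def allL {α : Type} (p : α → Bool) (l : List α) : Bool := List.rec true (fun a _ ih => iF p a thN ih elS false) l

def build {β : Type} (gs : List (List ℕ × List (List ℕ))) : Tr → (Tr → β) → β := List.rec (fun D k => k D)
  (fun g _ ih D k => iF allL (Nat.blt 0) g.1 thN addG g.1 g.2 D (fun D => ih D k) elS ih D k) gs

def bySize (a : ℕ) : List ℕ := List.rec [] (fun p _ ih => iF Nat.beq p.1 a thN p.2 elS ih) sizeList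

/-- irreducible words of weight `ν` in front of `acc` -/
def enum (D : Tr) (ν : List ℕ) : List ℕ := List.rec [0] (fun a _ ih =>
  List.rec [] (fun s _ acc => List.rec acc (fun I _ acc2 => frc (Nat.add I (Nat.mul 32 s)) fun c =>
    Option.rec (c :: acc2) (fun _ => acc2) (D.get c)) (bySize a)) ih) ν
def Tr.size (D : Tr) : ℕ := Tr.rec 0 (fun _ _ _ => 1) (fun _ _ _ a b => Nat.add a b) D
def len (l : List ℕ) : ℕ := List.rec 0 (fun _ _ ih => Nat.add 1 ih) l
def lenS (l : List (List ℕ)) (f : List ℕ → ℕ) : ℕ := List.rec 0 (fun a _ ih => Nat.add (f a) ih) l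
def wts : ℕ → ℕ → List (List ℕ)
  | 0, d => bif Nat.beq d 0 then [[]] else []
  | n + 1, d => bif Nat.beq d 0 then [[]] else
     ([0,1,2,3,4,5].filter fun a => Nat.ble a d && Nat.beq (a % 2) (d % 2) && Nat.ble (pc ((a + (d - a) / 2)) + pc ((a + (d - a) / 2) / 32)) a).flatMap fun a => (wts n ((d - a) / 2)).map fun ν => a :: ν

def rulesData : List (List ℕ × List (List ℕ)) := [
([1, 1],[[97],[161],[193],[289],[321],[385],[545],[577],[641],[769]]),
([1, 3],[[5217],[6241],[6305],[9313],[10337],[3457],[10529],[9377],[9409],[12449],[12577],[12385],[10433],[12481],[12609],[17505],[18529],[3713],[3841],[18977],[17569],[17601],[20641],[5889],[21025],[20577],[18625],[20673],[6913],[21057],[17697],[17729],[17793],[24865],[25121],[24673],[18753],[18817],[24897],[25153],[24737],[24769],[20865],[24961],[25217]]),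
([1, 5],[[29793],[30817],[30881],[31009],[31265]]),
([2, 1],[[225],[353],[417],[449],[609],[673],[705],[801],[833],[897]]),
([2, 2],[[1249],[2273],[4321],[1377],[1441],[1473],[2401],[2465],[2497],[8545],[8417],[4513],[4545],[8609],[8641],[1633],[1697],[1729],[1825],[1857],[1921],[2657],[2721],[2753],[2849],[2881],[2945],[16993],[16609],[4769],[4801],[4897],[4929],[4993],[17057],[17089],[16737],[16801],[16833],[8993],[9025],[9089],[17185],[17217],[17281],[482],[738],[866],[930],[962]]),
([2, 3],[[3297],[5345],[6369],[3425],[3489],[3521],[9569],[10593],[9441],[5537],[5569],[9633],[9665],[12705],[10465],[12513],[6593],[12641],[10689],[12737],[3681],[3745],[3777],[3873],[3905],[3969],[18017],[19041],[17633],[5793],[5825],[5921],[5953],[6017],[18081],[18113],[21153],[18657],[20705],[6849],[6945],[6977],[7041],[21089],[19137],[21185],[17761],[17825],[17857],[10017],[10049],[10113],[18209],[18241],[18305],[25377],[18785],[18849],[18881],[24929],[11073],[11137],[25185],[19265],[19329],[25409],[24801],[20897],[20929],[24993],[25025],[13185],[25249],[25281],[21377],[25473]]),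
([2, 4],[[11489],[13537],[14561],[13665],[14689],[14753],[19681],[21729],[22753],[7969],[8001],[8065],[22113],[23137],[23201],[19809],[19873],[19905],[25953],[26977],[12161],[26209],[27233],[20353],[27425],[25825],[21921],[21953],[26017],[26049],[29089],[26273],[26305],[29345],[29473],[26849],[28897],[22977],[29025],[27073],[29121],[29281],[27329],[29377],[29505]]),
([2, 5],[[27873],[29921],[30945],[30049],[31073],[31137],[30305],[31329],[31393],[31521]]),
([3, 1],[[481],[737],[865],[929],[961]]),
([3, 2],[[1505],[2529],[4577],[8673],[1761],[1889],[1953],[1985],[2785],[2913],[2977],[3009],[4833],[4961],[5025],[5057],[17121],[16865],[9057],[9121],[9153],[17249],[17313],[17345]]),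
([3, 3],[[3553],[5601],[9697],[6625],[10721],[12769],[3809],[3937],[4001],[4033],[5857],[5985],[6049],[6081],[18145],[6881],[7009],[7073],[7105],[19169],[21217],[17889],[10081],[10145],[10177],[18273],[18337],[18369],[18913],[11105],[11169],[11201],[19297],[19361],[19393],[25441],[20961],[25057],[13217],[13249],[25313],[21409],[21441],[25505],[25537]]),
([3, 4],[[7649],[11745],[13793],[14817],[7905],[8033],[8097],[8129],[20193],[22241],[23265],[19937],[12129],[12193],[12225],[20321],[20385],[20417],[26465],[27489],[21985],[26081],[14241],[14273],[26337],[22433],[22465],[26529],[26561],[29601],[23009],[27105],[29153],[15297],[27361],[29409],[23489],[29537],[27585],[29633]]),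
([3, 5],[[24033],[28129],[30177],[31201],[28385],[30433],[31457],[30561],[31585],[31649]]),
([4, 1],[[993]]),
([4, 2],[[2017],[3041],[5089],[9185],[17377]]),
([4, 3],[[4065],[6113],[7137],[10209],[18401],[11233],[19425],[13281],[21473],[25569]]),
([4, 4],[[8161],[12257],[20449],[14305],[22497],[26593],[15329],[23521],[27617],[29665]]),
([4, 5],[[16353],[24545],[28641],[30689],[31713]]),
([1, 1, 1],[[3169],[5281],[9505],[17953],[6337],[10561],[19009],[12673],[21121],[25345]]),
([1, 1, 3],[[110977],[119425],[123649],[189185],[221953]]),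
([1, 3, 2],[[48194],[56386],[60482],[48258],[56450],[62594],[63618],[81026],[89218],[158786],[95362],[96386],[60674],[62722],[63746],[93442],[95490],[96514],[161026],[162050],[95266],[63554],[158754]]),
([2, 1, 3],[[337058],[337090],[402626],[607394],[607426],[672962],[607522],[607554],[607618],[804162],[673058],[673090],[673154],[804226],[674114],[674178],[805250],[674082]]),
([2, 2, 2],[[40161],[72929],[44385],[77153],[52833],[85601],[138465],[46497],[47553],[144801],[54945],[56001],[153249],[80321],[145857],[88769],[154305],[273761],[275873],[59169],[60225],[62337],[288545],[276929],[92993],[95105],[289601],[160641],[291713],[544353],[546465],[550689],[547521],[551745],[553857],[79265],[87713],[91937],[157473],[158529],[269537],[531681],[535905],[538017],[539073]]),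
([2, 3, 2],[[48226],[80994],[56418],[89186],[60514],[93282],[48290],[48322],[146594],[56482],[56514],[154786],[62626],[160930],[63682],[81058],[81090],[146626],[89250],[89282],[154818],[158818],[95394],[96450],[161986],[277794],[60706],[60738],[290082],[62754],[62850],[292130],[63810],[63874],[277826],[93474],[93506],[290114],[95522],[95618],[96578],[96642],[293186],[161058],[161154],[292226],[162114],[162178],[293250],[548386],[552482],[554530],[548418],[552514],[555586],[554626],[555650],[60578],[93378],[160962],[62786],[159010],[292162],[159042],[96546],[161090],[554562],[60610],[93346],[62562],[96354],[285890],[161954],[63778],[95554],[293154],[162082],[555554],[63586],[62658],[285858],[158914],[96418],[548162],[548226],[552322],[158882],[552098]]),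
([2, 3, 4],[[646530],[650626],[718146],[751906]]),
([2, 4, 1],[[31842],[31906],[31938],[32034],[32066],[32130]]),
([3, 2, 1],[[29026],[25826],[26850],[28898]]),
([3, 2, 2],[[61794],[94562],[160098],[91362],[61666],[94434]]),
([3, 2, 3],[[306402],[308450],[339170],[342242],[406754],[407778],[576738],[578786],[609506],[612578],[677090],[678114],[406882],[407906],[576866],[576930],[576962],[583010],[609634],[609698],[609730],[616802],[812386],[813410],[578914],[578978],[583074],[677282],[677314],[684450],[812450],[812482],[815522],[612706],[612802],[616898],[678306],[678338],[684482],[813474],[813506],[815554],[677474],[678498],[812642],[813666],[812706],[812738],[815778],[813730],[813762],[815810],[309474],[341218],[579810],[611554],[584034],[615778],[579010],[583106],[586146],[579938],[677218],[584098],[681378],[611682],[612770],[616866],[618946],[684386],[682434],[127330],[192866],[225634],[812258],[580002],[580034],[584130],[586178],[675234],[678242],[615842],[615874],[618914],[611778],[808386],[127202],[813282]]),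
([3, 2, 4],[[707938],[708002],[708034],[839074],[839106],[740706],[740770],[740802],[871842],[871874],[742818],[742850],[939362],[939458],[877986],[878018],[943554],[878242],[878274],[943810],[651682],[874914],[940386]]),
([3, 3, 1],[[15841],[24289],[28513],[30625],[31681],[30050],[31074],[31138],[27874],[29922],[30946],[34786,33764],[67554,4068],[133090,6116],[264162,10212],[526306,18404],[68578,66532],[134114,7140],[265186,11236],[527330,19428],[136162,132068],[267234,13284],[529378,21476],[271330,263140],[533474,25572],[541666,525284]]),
([3, 4, 1],[[31970],[32098],[32162],[32194]]),
([3, 4, 2],[[64738],[97506],[163042],[64866],[64930],[64962],[97634],[97698],[97730],[294242],[163170],[163234],[163266],[294306],[294338],[556642],[556706],[556738]]),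
([3, 4, 3],[[130274],[195810],[228578],[130402],[130466],[130498],[327010],[359778],[195938],[196002],[196034],[327074],[327106],[425378],[228706],[228770],[228802],[359842],[359874],[425410],[589410],[622178],[589474],[589506],[687778],[622242],[622274],[687810],[818978],[819010]]),
([3, 4, 4],[[261474],[261538],[261570],[392610],[392642],[458178],[655010],[655042],[720578],[851778]]),
([4, 2, 4],[[708066],[839138],[841186],[740834],[871906],[874978],[742882],[939490],[940514],[878050],[943586],[944610],[878306],[943842],[944866],[651746],[842210]]),
([4, 4, 3],[[131041],[196577],[327649],[229345],[360417],[425953],[589793],[622561],[688097],[819169]]),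
([2, 1, 1, 1],[[169058],[304226],[574562],[304290],[304322],[574626],[574658],[574754],[574786],[574850],[202850],[338018],[608354],[338082],[338114],[608418],[608450],[608546],[608578],[608642],[405666],[405698],[676002],[676034],[676130],[676162],[676226],[811298],[811330],[811394]]),
([2, 1, 1, 3],[[19435812],[19435844],[6866306],[11060610]]),
([2, 3, 2, 2],[[1285444],[1285700],[1416516],[1420868],[2340388],[2471460],[1292868],[1423940],[1678916],[1683012],[1482116],[1482372],[1482500],[1488516],[1489540],[1744516],[1744644],[1750660],[1751684],[2530692],[1515140],[2537092],[1522308],[2793092],[1784452],[2563460],[2563716],[2569860],[2570884],[2825860],[2833028],[1879812],[1881860],[1882884],[2928388],[2930436],[1915652],[5027588],[1981188],[2961156],[2963204],[2964228],[3028740],[5061380],[5125892],[5126916],[1289796],[1416772],[2733604],[1686084],[4566564],[2536996],[2799140],[8625476],[8625732],[4566596],[1522244],[17014340],[4828740],[1784388],[17149508],[1515268],[1777412],[2799236],[17217156],[1981060],[4664900],[4927044],[2832004],[5058116],[3028612],[17250948],[8625444],[8625700],[17014308],[4828708],[17149476],[2930212],[1915460],[5025316],[17217060],[17250884],[2544964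],[8632868],[17021476],[2930308],[1915524],[2928260],[17020484],[17151556],[17152548],[17225028],[3028516],[1980996],[17258788]]),
([3, 2, 1, 3],[[21535140],[25733796],[25733828],[25768612],[21532004],[19436964],[19436996],[19441060],[19444132],[19441892],[19437988],[19438020],[19442116],[19444164],[21566916],[25733540],[25765316],[25831844],[19441092],[19442084],[21539236],[21539268],[21541316]]),
([3, 2, 2, 2],[[1420514],[1690850],[2469090],[2739426],[1690978],[1691042],[1691074],[2739554],[2739618],[2739650],[1488098],[1758434],[4633826],[4904162],[1758562],[1758626],[1758658],[4633954],[4634210],[1792354],[1792450],[4904354],[4904386],[4904546],[2570466],[4667618],[2840802],[4937954],[4667746],[4668002],[2840930],[2840994],[2841026],[4938146],[4938178],[4938338],[1893730],[1893794],[1893826],[8828258],[8828514],[9233762],[9233826],[9233858],[9234018],[9234082],[9234114],[8862050],[8862306],[2976098],[2976162],[2976194],[9267554],[9267618],[9267650],[9267810],[9267874],[9267906],[5140898],[5140930],[9335202],[9335234],[9335458],[9335490],[17487458],[17622626],[17622690],[17622722],[17521250],[17656418],[17656482],[17656514],[17724066],[17724098],[1792418],[4904290],[4938082],[2536674],[2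807010],[2807138],[2807202],[2942306],[5039522],[5073346],[2942370],[1927618],[1995202],[1995362],[3043746],[2807234],[1995106],[9031074],[9031106],[4566242],[4836578],[9031010],[9098658],[9132482],[5039714],[17723618],[5039458],[9132450],[5073506],[3043938],[1994978],[9098690],[3043554],[5073250],[5140834],[3043682],[17723746],[2942178],[9098850],[3192289,33633761,1416610,1162660],[3193313,33634785,1416642,1162692],[3200737,33642209,1679010,1171108],[3201761,33643233,1679042,1171140],[67156449,3226081,2465218,2211268],[67164897,3234529,2727618,2219716],[3204961,33646433,1683234,1175332],[3205985,33647457,1683266,1175364],[67169121,3238753,2731842,2223940],[134265313,5388769,4627906,4373956],[134273761,5397217,4890306,4382404],[5302177,33712033,1750818,1242916],[5305249,33715105,1750914,1243012],[134280097,5403553,4896642,4388740],[6384577,67267521,2833218,2325316],[6386625,67269569,2833282,2325380],[134312897,6452161,4930434,4422532],[268483041,9714145,8826306,8699332],[268495713,9726817,9219906,8712004],[268497825,9728929,9222018,8714116],[268530625,10777537,9255810,8747908],[536926945,18373345,17485506,17358532],[536931169,18377569,17616706,17362756],[536933281,18379681,17618818,17364868],[536966081,19428289,17652610,17398660],[5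338049,3306433,1784706,1276804],[17520994],[5322209,3290593,1514914,1260964],[5330657,3299041,1777314,1269412],[1548769,1489250,1423778,1422786],[9529185,3434337,1912610,1404708],[1819361,1759842,1694370,1693378],[1950561,1895010,1698594,1697602],[9594785,5531553,1980194,1472292],[2016161,1897122,1766178,1763202],[10644417,6581185,3029826,2521924],[3097537,2978498,2847554,2845570],[2597345,2537826,2472354,2471362],[2867937,2808418,2742946,2741954],[2999137,2943586,2747170,2746178],[8884705,8829154,8632738,8822210],[17535713,17488098,17029794,17473218],[5161889,5042850,4911906,4908930],[5194689,5075650,4944706,4942722],[17671009,17623394,17165090,17608514],[17736609,17625506,17232674,17610626],[17769409,17658306,17265474,17644418],[6339041,5323233,4562370,4308420],[6347489,5331681,4824770,4316868],[10546017,9530209,9023298,8515396],[12645281,9597857,9090946,8583044],[12678081,10646465,9124738,8616836],[5336001,3304385,1784642,1276740],[6353825,3306401,2799490,2291588],[6351713,5335905,4828994,4321092],[6350753,3303329,2799394,2291492],[6350689,5334881,4828962,4321060],[3064737,2945698,2814754,2811778],[5096289,5040738,4844322,4843330],[9532353,3437505,1915778,1407876],[12638945,9591521,9084610,8576708],[2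048961,1929922,1798978,1796994],[17277409,17217890,17152418,17151426],[10548129,3437473,2930562,2422660],[10541793,9525985,9019074,8511172],[12643169,5532513,5025602,4517700],[21019105,17971681,17210818,16956868],[10540769,9524961,9019042,8511140],[18921953,17906145,17145282,16891332],[18920929,17905121,17145250,16891300],[12636097,9591649,5532385,9084738,5025474,1536610,8576836,4517572,1473124]]),
([3, 2, 3, 2],[[1937284],[2985860],[4953444],[4954468],[8890020],[8890052],[8893092],[8891044],[8891076],[8893124],[17675044],[17675076],[8889956],[8890980],[17540804],[17543844],[17541796],[17668804],[17543876],[17667684],[17668708],[17540772]]),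
([3, 4, 2, 2],[[1523364],[1785508],[2571940],[2834084],[1916708],[1982244],[1982276],[2965284],[3030852],[5127972],[5128004],[2539108],[5029540],[5062340],[5062436],[2801252],[2932324],[2932388],[1916612],[1982148],[3030692],[5029476],[5062244],[5345250,3315682,33758178],[6393826,67278818,3349474],[9539554,3450850,33893346],[10588130,67413986,3484642],[1953505,1822561,1703522],[3002081,2871137,2752098],[134320098,6461410,5446626],[2012641,1554337,1506722],[12752866,134522850,5649378],[2021089,1824673,1769122],[5166817,4970401,4914850],[3095009,2603969,2588098],[5192161,4701121,4685250],[3103457,2874305,2850498],[5200609,4971457,4947650],[268537826,10790882,9776098],[268605410,12888034,9843682],[2025313,1959841,1900322],[2059105,1960897,1933122],[2061217,2028481,1998722],[9365345,9299873,9240354],[9386465,8895425,8879554],[3107681,3009473,2981698],[3109793,3077057,3047298],[9399137,9300929,9273154],[5206945,5174209,5144450],[9401249,9368513,9338754],[536973282,19449826,18435042],[537040866,21546978,18502626],[17753953,17688481,17628962],[17783521,17554369,17530562],[17787745,17689537,17661762],[17789857,17757121,17727362],[2046433,1555393,1539522],[2054881,1825729,1801922],[3061217,2602913,2555298],[3069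665,2873249,2817698],[3073889,3008417,2948898],[5171041,5105569,5046050],[5204833,5106625,5078850],[12685282,10655714,9640930],[21073890,19044322,18029538],[25268194,19179490,18164706],[25335778,21276642,18232290],[9394913,9165761,9141954],[68161506,3248098,3247076,3246052,3213288],[135272418,5412834,5411812,5408740,5375976],[136322018,6495202,6493156,6491108,6425576],[269494242,9742306,9741284,9734116,9701352],[270543842,10824674,10822628,10816484,10750952],[272643042,12989410,12985316,12981220,12850152],[537937890,18401250,18400228,18384868,18352104],[538987490,19483618,19481572,19467236,19401704],[541086690,21648354,21644260,21631972,21500904],[545285090,25977826,25969636,25961444,25699304],[5345250,33755106,3312612,3311588,1281000],[6393826,67276770,3345380,3344356,2328552],[9539554,33886178,3443684,3442660,1412072],[10588130,67407842,3476452,3475428,2459624],[17928162,34148322,3705828,3704804,1674216],[18976738,67669986,3738596,3737572,2721768],[134322146,6461410,5444580,5441508,4425704],[9607138,33953762,5542884,5539812,1479656],[12752866,134518754,5641188,5638116,4622312],[17995746,34215906,5805028,5801956,1741800],[21141474,134780898,5903332,5900260,4884456],[10689506,67509218,6624228,6622180,2561000],[12786658,134552546,6689764,6687716,4656104],[1907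8114,67771362,6886372,6884324,2823144],[21175266,134814690,6951908,6949860,4918248],[268543970,10790882,9774052,9766884,8751080],[268609506,12888034,9839588,9832420,8816616],[18130914,34351074,10003428,9996260,1876968],[25470946,269002722,10232804,10225636,9209832],[268643298,12921826,10888164,10882020,8850408],[19213282,67906530,11084772,11078628,2958312],[25504738,269036514,11281380,11275236,9243624],[21378018,135017442,13247460,13243364,5121000],[25572322,269104098,13378532,13374436,9311208],[536987618,19449826,18432996,18417636,17401832],[537053154,21546978,18498532,18483172,17467368],[537184226,25741282,18629604,18614244,17598440],[537086946,21580770,19547108,19532772,17501160],[537218018,25775074,19678180,19663844,17632232],[537285602,25842658,21775332,21763044,17699816],[134516706,5541858,134262756,5287908,5317608,5255144],[67422178,3459042,67168228,3205092,3679208,3172328],[5657570,33969122,5403620,33715172,5776360,5272552],[18506722,34235362,18379748,34108388,17855464,18093032],[268540898,10591202,268509156,10559460,10618856,10493928],[6476770,67294178,6445028,67262436,6817768,6313960],[268651490,10701794,268524516,10574820,11015144,10509288],[12889058,134523874,12857316,134492132,12595176,12650472],[268624866,12903394,25561060,268593124,12871652,9308136],[536980450,18983906,536948708,18952164,1913853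6,18886632],[537177058,25471970,537145316,25440228,25178088,25233384],[25742306,269011938,25710564,268980196,25186280,25233384],[67291106,68178914,3708898,67164132,3200996,3294184,3168232],[268848098,13380578,268657634,268594148,12872676,10896356,8864744],[538974178,19548130,67687394,19421156,67655652,18896872,19007464],[538981346,19682274,67789794,19428324,67662820,18904040,19141608],[71321570,67768290,6409186,6377444,67260388,3359716,2343912],[134615010,12785634,134519778,12722148,134488036,5639140,4623336],[135011298,134884322,21181410,13241316,21117924,134757348,5114856],[67417058,5581794,11541474,10658788,10589156,9636836,2532328],[537048034,10114018,22045666,21537764,21271524,6046692,17208296],[10659810,3549154,10532836,9769956,3422180,9540580,9507816],[18041826,3820514,19436516,18977764,17914852,3693540,18912232],[545263586,537208802,26233826,3957730,25725924,25273316,10044388,17146856],[23072738,71321570,67294178,18029538,6883300,21072868,6853604,2790376],[12798946,14701538,11148258,12671972,6702052,10640356,6636516,6570984],[21073890,19929058,34151394,6850532,3804132,3803108,3707876,1772520],[12785634,134555618,12694498,12853220,12726244,12722148,134492132,12591080],[537274338,25839586,25355234,537147364,25712612,25704420,25450468,25188328],[537078754,19287010,67789794,536951780,19413988,18969572,6766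2820,19141608],[269029346,67905506,11054050,268521444,10768356,10577892,67397604,10535912],[134531042,135291874,5556194,34223074,33969122,134277092,5302244,5522408,5269480],[10900450,14705634,7091170,12927972,134562788,10646500,6583268,6702052,12665832],[268996578,19179490,26225634,19171300,11044836,10226660,18162660,18155492,9013224],[25348066,26220514,10015714,25221092,18617316,9983972,9999332,34345956,18093032],[7084002,67520482,3560418,6449124,67266532,19047396,6353892,3306468,6318056,2794472],[269094882,269031394,25467874,25340898,21277666,25436132,268967908,25309156,21245924,11143140,9111528],[21080034,18223074,18127842,34157538,25332708,21269476,21016548,6032356,17969124,17873892,34094052,1969128],[13176802,14698466,7081954,6891490,134786018,134532066,21301220,134309860,12668900,6574052,6383588,5048296,6318056],[134817762,7096290,21539810,21095394,22031330,21508068,134754276,21063652,6842340,21269476,21079012,6032356,20983784,5016552]]),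
([3, 4, 3, 1],[[507492],[507556],[507588],[769700],[769732],[900900],[900932],[966436],[966532],[999236],[999300],[769636],[900708],[966308],[999108],[966468],[999204],[900772],[900804],[966340],[999076],[966244],[999012]]),
([3, 4, 4, 3],[[4177572],[4177604],[6274756],[4177700],[4177732],[4177796],[10469188],[6274852],[6274884],[6274948],[10469252],[7323428],[7323460],[7323524],[11517828],[18865988],[18866052],[19914628]]),
([4, 2, 2, 2],[[1691106],[2739682],[1758690],[1792482],[4904418],[2841058],[4938210],[1893858],[9233890],[9234146],[2976226],[9267682],[9267938],[5140962],[9335266],[9335522],[17622754],[17656546],[17724130],[2807266],[1927650],[1995234],[3043810],[9031138],[9132514],[9098722]]),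
([4, 2, 4, 1],[[1025764]]),
([4, 4, 3, 1],[[909028],[974564],[978788],[1007332],[1011556],[1013668]]),
([2, 1, 1, 1, 1],[[3248292],[3252516],[3260964],[5415204],[5423652],[9749028],[5415236],[5423684],[9749060],[9749124],[6496580],[6505028],[10830404],[10830468],[12993156]]),
([3, 2, 1, 1, 1],[[9735396],[18386148],[18386276],[18388388],[18388420],[18389412],[18389444],[19469732],[19469764],[19470756],[19470788],[12981476],[12982500],[21632228],[21633252],[25961828],[25961892],[25961924],[25962852],[25962916],[25962948],[25964964],[25964996],[9738468],[18389220],[18386340],[18386372],[18393444],[18388324],[18395556],[18395588],[10816740],[19467492],[19467620],[19467684],[19469668],[19476900],[19476932],[21632420],[21632452],[21633444],[21633476],[9737444],[18388196],[18392420],[18392484],[18392516],[18393316],[18393508],[18393540],[10818788],[10819812],[19469540],[19470564],[19467716],[19473764],[19474788],[19473828],[19473860],[19474660],[19474852],[19474884],[21636452],[21636516],[21637476],[21637572],[21639588],[21639620],[21636548],[21637540],[25958628],[21632356]]),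
([3, 4, 2, 2, 2],[[41008840],[41008968],[41009032],[41017160],[41017224],[41021320],[74563464],[74571656],[74575752],[45203272],[45203336],[45211464],[45211528],[45215624],[78757768],[78765960],[78770056],[53600072],[53600136],[53604232],[87154568],[87158664],[47366024],[47374216],[47378312],[47398792],[47406984],[148041608],[55762824],[55766920],[55795592],[156430216],[82001800],[82009992],[82014088],[149122952],[90398600],[90402696],[157511560],[60092296],[60125064],[60190600],[61239176],[94728072],[94793608],[163999624],[145874824],[145878920],[154267528],[276127560],[544563016],[47411080],[55799688],[147963688],[89308968],[156360488],[149012296],[48455496],[157409096],[548757320],[48906120],[156462984],[295919432],[93642536],[160751400],[93511464],[60120968],[276094760],[96788360],[171322338,1086532578,436311012,178361316,177290212,1086657508,1080310756,178295784,307303400,169163752,1078279144],[171592674,1094929378,704746468,186749924,185687012,1095308260,1080581092,186684392,575738856,169434088,1078549480],[305941474,1099254754,838968292,320971748,319908836,1099506660,1084779492,320906216,579937256,303655912,1082747880],[308040674,1099322338,839033828,323134436,319976420,1099572196,1086878692,323003368,580002792,303723496,1082815464],[342643682,2173064162,872621028,356721636,354579428,2173314020,2160620516,356590568,614605800,3383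26504,2156557288],[171330530,1080699874,1080255458,185678820,171013092,1094794212,1080128484,169425896,170947560,1078541288,1080062952],[2157491170,2157237218,111338466,2165585892,2157205476,119814116,111433700,2149332968,2156943336,103561192,111171560],[4304972770,4304718818,180478946,4313067492,4304687076,189018084,180637668,4296814568,4304424936,172765160,180375528],[2165879778,2165625826,119727074,2165848036,2157467620,120076260,111695844,2165323752,2149341160,119551976,103569384],[4313361378,4313107426,188867554,4313329636,4304949220,189280228,180899812,4312805352,4296822760,188755944,172773352],[4306053090,4305799138,214033378,4314116068,4305735652,222572516,214192100,4297863144,4305473512,206319592,213929960],[4314441698,4314187746,222421986,4314378212,4305997796,222834660,214454244,4313853928,4297871336,222310376,206327784],[8608324578,8607943650,327275490,8608292836,8595722212,327688164,315117540,8607768552,8591658984,327163880,311054312],[8609404898,8609023970,360829922,8609341412,8596770788,361242596,348671972,8608817128,8592707560,360718312,344608744],[8611565538,8611121122,428002274,8611438564,428351460,8596772836,413685732,8610914280,427827176,8594741224,411654120]]),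
([3, 4, 4, 3, 1],[[16244616],[24633224],[28831624],[30928776],[31977352],[16244552],[24633160],[16244520],[28827464],[30924680],[31973256],[24633128],[31973192],[28827432],[30924584],[28827528],[30924616]]),
([3, 2, 1, 1, 1, 1],[[103950696],[103959144],[104090216],[173298344],[173298376],[207901384],[806636208],[806636240],[346182312],[103949672],[336663984],[103958120],[605099696],[104089192],[605103920],[173295272],[672278320],[173296296],[173296328],[672279376],[207899336],[673327952],[403842416],[104089256],[104089288],[672286320],[806635120],[806635184],[806635216],[306465680],[207825252],[207833700],[346376804],[807684816],[415650468],[415650500],[672279344],[403983184],[806638288],[807684784],[202515888],[170010064],[202524336],[170018512],[336873264],[304367440],[403982128],[306464656],[346378916],[405031760],[340020112],[403843440],[672287344],[806636144],[806638256],[403983152],[207890792],[208161384],[346573416],[673327920],[807686864],[415781544],[415781576],[173295304],[403982160],[203704944],[173287016],[202909488],[207891048],[202655568],[403843696],[403785424],[806637808]])]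

/-- exponentwise division of `mon w` by the squarefree monomial `S`; `0` encodes failure -/
def dv (n : ℕ) : ℕ → ℕ → ℕ := Nat.rec (fun S _ => iF Nat.beq S 0 thN 1 elS 0) (fun _ ih S w =>
  iF Nat.beq S 0 thN Nat.succ w elS iF Nat.beq w 0 thN 0 elS
    Nat.rec 0 (fun r _ => Nat.succ (Nat.add (Nat.xor S (Nat.mod w 32)) (Nat.mul 32 r)))
      (ih (Nat.xor S (Nat.land S w)) (Nat.div w 32))) n

def push (s : List (List ℕ)) : List ℕ → List (List ℕ) := List.rec (fun r => [r]) (fun x s ih r =>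
  List.rec (r :: s) (fun _ _ _ => [] :: ih (mrg r x)) x) s

def flush (s : List (List ℕ)) : List ℕ := List.rec [] (fun x _ ih => mrg x ih) s

/-- `f`-words with first letter contained in `I`, divided -/
def gI (n I : ℕ) (f : List ℕ) : List (List ℕ) := List.rec [] (fun c _ ih =>
  iF Nat.beq (Nat.land I (Nat.mod c 32)) (Nat.mod c 32) thN
    Nat.rec ih (fun r _ => push ih [r]) (dv n (Nat.xor I (Nat.mod c 32)) (Nat.div c 32)) elS ih) f

def hI (I : ℕ) (f : List ℕ) : List ℕ := List.rec [] (fun c _ ih =>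
  iF Nat.beq (Nat.mod c 32) I thN frc (Nat.div c 32) (fun d => d :: ih) elS ih) f

def isE (f : List ℕ) : Bool := List.rec true (fun _ _ _ => false) f
def isZ (f : List ℕ) : Bool := List.rec false (fun c r _ => iF Nat.beq c 0 thN isE r elS false) f

def l32 : List ℕ := [0, 1, 2, 3, 4, 5, 6, 7, 8, 9, 10, 11, 12, 13, 14, 15, 16, 17, 18, 19, 20, 21, 22, 23, 24, 25, 26,
  27, 28, 29, 30, 31]

def chk (n : ℕ) : List ℕ → List ℕ → Bool := Nat.rec (fun f h => iF isE f thN isE h elS iF isZ f thN isZ h elS false)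
  (fun n ih f h => iF isE f thN isE h elS 
    iF isZ f thN isZ h elS allL (fun I => ih (flush (gI n I f)) (hI I h)) l32) n

def msk (I : ℕ) (ws : List ℕ) : ℕ := List.rec 0 (fun w _ ih =>
  iF Nat.beq (Nat.mod w 32) I thN Nat.add 1 (Nat.mul 2 ih) elS Nat.mul 2 ih) ws

def mapF {α β : Type} (f : α → ℕ) (l : List α) : (List ℕ → β) → β := List.rec (fun k => k []) (fun a _ ih k =>
  frc (f a) fun b => ih fun r => k (b :: r)) l

/-- pairs `(2^(32 a), mask)` -/
def mskT {β : Type} (ws : List ℕ) (as : List ℕ) : (List (ℕ × ℕ) → β) → β := List.rec (fun k => k []) (fun a _ ih k =>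
  frc (Nat.pow 2 (Nat.mul 32 a)) fun p => frc (msk a ws) fun m => ih fun r => k ((p, m) :: r)) as

def mskTs {β : Type} (ν : List ℕ) : List ℕ → (List (List (ℕ × ℕ)) → β) → β := List.rec (fun _ k => k []) (fun a _ ih ws k =>
  mskT ws (bySize a) fun t => mapF (fun w => Nat.div w 32) ws fun ws' => ih ws' fun r => k (t :: r)) ν

/-- masks `MM_k`, shifts -/
def MMs : List (ℕ × ℕ × ℕ) := [
  (1, Nat.mul (Nat.div (Nat.sub (Nat.pow 2 1024) 1) 4294967295) 1431655765, 1),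
  (2, Nat.mul (Nat.div (Nat.sub (Nat.pow 2 1024) 1) 4294967295) 858993459, 2),
  (4, Nat.mul (Nat.div (Nat.sub (Nat.pow 2 1024) 1) 4294967295) 252645135, 4),
  (8, Nat.mul (Nat.div (Nat.sub (Nat.pow 2 1024) 1) 4294967295) 16711935, 8),
  (16, Nat.mul (Nat.div (Nat.sub (Nat.pow 2 1024) 1) 4294967295) 65535, 16)]

def wedge (L E : ℕ) : ℕ := List.rec 0 (fun p _ ih => iF Nat.beq (Nat.land L p.1) 0 thN ih elS
  Nat.xor (Nat.shiftLeft (Nat.land E p.2.1) p.2.2) ih) MMs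

def EE (V : ℕ) : ℕ := List.rec 1 (fun i _ E => frc E fun E =>
  Nat.lor E (Nat.shiftLeft (wedge (Nat.shiftRight V (Nat.mul 5 i)) E) (Nat.mul 32 (Nat.pow 2 i)))) [4, 3, 2, 1, 0]

def rowT (E : ℕ) (t : List (ℕ × ℕ)) : ℕ := List.rec 0 (fun p _ ih => iF Nat.beq (Nat.land E p.1) 0 thN ih elS Nat.lor p.2 ih) t

def rowK (E : ℕ) (N : ℕ) (ts : List (List (ℕ × ℕ))) : ℕ → ℕ := List.rec (fun _ => N) (fun t _ ih K => 
  frc (Nat.shiftRight E (Nat.mod K 32)) fun e => Nat.land (rowT e t) (ih (Nat.div K 32))) ts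

def row (E N : ℕ) (ts : List (List (ℕ × ℕ))) (f : List ℕ) : ℕ := List.rec 0 (fun K _ ih => Nat.xor (rowK E N ts K) ih) f

/-- insert a row into the echelon tree -/
def insR {β : Type} (r : ℕ) (D : Tr) : (ℕ → β) → (Tr → β) → β := Tr.rec (fun _ k => k (.lf r 0 []))
  (fun p _ _ kx _ => kx p)
  (fun m a b ga gb kx k => iF Nat.beq (Nat.land r m) 0 thN ga kx (fun a' => k (.n m a' b)) elS gb kx (fun b' => k (.n m a b'))) D

def redR {β : Type} (n : ℕ) (D : Tr) (k : Tr → β) : ℕ → β := Nat.rec (fun _ => k D) (fun _ ih r =>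
  insR r D (fun p => frc (Nat.xor r p) ih) k) n

def redRs {β : Type} (rs : List ℕ) : Tr → (Tr → β) → β := List.rec (fun D k => k D) (fun r _ ih D k =>
  redR 2000 D (fun D => ih D k) r) rs

def mkT {β : Type} (d : ℕ) : ℕ → (Tr → β) → β := Nat.rec (fun _ k => k .e) (fun d ih p k =>
  frc (Nat.pow 2 d) fun h => frc (Nat.shiftLeft (Nat.pred (Nat.pow 2 h)) (Nat.add p h)) fun m =>
  ih p fun a => ih (Nat.add p h) fun b => k (.n m a b)) d

def flat (D : Tr) : List ℕ → List ℕ := Tr.rec (fun l => l) (fun r _ _ l => r :: l) (fun _ _ _ ga gb l => ga (gb l)) D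

/-- check that the rows are in echelon form -/
def ech (n : ℕ) : List ℕ → ℕ → Bool := Nat.rec (fun _ _ => true) (fun _ ih l b =>
  List.rec false (fun r l _ => iF Nat.beq (Nat.div r b) 1 thN frc (Nat.mul 2 b) (ih l) elS false) l) n

def elim (n : ℕ) (rs : List ℕ) : Bool := mkT 10 0 fun D => redRs rs D fun D => ech n (flat D []) 1

def filt (p : ℕ → Bool) (f : List ℕ) : List ℕ := List.rec [] (fun c _ ih => iF p c thN c :: ih elS ih) f

def rows {β : Type} (N : ℕ) (ts : List (List (ℕ × ℕ))) (f : List ℕ) (Vs : List ℕ) (acc : List ℕ) : (List ℕ → β) → β :=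
  List.rec (fun k => k acc) (fun V _ ih k => frc (EE V) fun E => frc (row E N ts f) fun r => ih fun l => k (r :: l)) Vs

def rowsF {β : Type} (ν : List ℕ) (N : ℕ) (ts : List (List (ℕ × ℕ))) (fs : List (List ℕ × List ℕ)) : (List ℕ → β) → β :=
  List.rec (fun k => k []) (fun p _ ih k => ih fun acc => rows N ts (filt (wtEq ν) p.1) p.2 acc k) fs

def degC (n : ℕ) : ℕ → ℕ := Nat.rec (fun _ => 0) (fun _ ih c => Nat.add (pc c) (Nat.mul 2 (ih (Nat.div c 32)))) n

def okF (ν : List ℕ) (f : List ℕ) : Bool :=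
  iF allL (fun c => iF Nat.beq (degC 7 c) 67 thN iF Nat.blt c (Nat.pow 32 7) thN Bool.rec true false (ltC ν c) elS false elS false) f
  thN chk 7 f f elS false

def rev (l : List ℕ) : List ℕ → List ℕ := List.rec (fun a => a) (fun x _ ih a => ih (x :: a)) l

def lbB {β : Type} (D : Tr) (ν : List ℕ) (fs : List (List ℕ × List ℕ)) (kf : β) (k : ℕ → β) : β :=
  mapF (fun c => c) (rev (enum D ν) []) fun ws => frc (len ws) fun n => frc (Nat.pred (Nat.pow 2 n)) fun N =>
    mskTs ν ws fun ts => rowsF ν N ts fs fun rs => iF elim n rs thN k n elS kf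

def lbA (D : Tr) (gs : List (List ℕ × List (List ℕ × List ℕ))) : ℕ → Bool := List.rec (fun a => Nat.beq a 1487)
  (fun g _ ih a => lbB D g.1 g.2 false fun n => frc (Nat.add n a) ih) gs

def ckAll (D : Tr) (gs : List (List ℕ × List (List ℕ × List ℕ))) : Bool :=
  iF Nat.beq (lenS (wts 7 67) fun ν => len (enum D ν)) 1487 thN lbA D gs 0 elS false

def lbData : List (List ℕ × List (List ℕ × List ℕ)) := [
([5,5,5,4],[([524287],[10335135,21122830,7124702,3765496,13167038])]),
([5,5,5,2,1],[([1179647],[14522702,11743941,6267266,22702712,29170123,1330672,26517413,7414232,6556826,12325825,32694563,23302490,19646422,32548718,31132557,17815395,2059662,24495367,27411897,19182787,7270569,25409320,13334775,15291485,1849308,28212481,32962250,14785269,17271073,23728188,24459009,11990099,14503644,24007453,10351853,9907541,27829650,16192396,28019963,33004455])]),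
([5,5,3,3,1],[([1286143],[18360285,23219527,22489032,27987378,18781936,27718785,28783972,4545890,27005941,4991270,18727299,14765578,18595266,33287044,4983026,27750581,16656372,32161942,8452541,25115494,26168122,30484313,33513789,20032374,23650935,32628290,27383373,5847747,27254443,4511720,32245466,5595199,20426602,14399739,33183969,2235967,17341546,31539051,29012456,12015917,31503269,7125317,28047632,17200846,8771463,17624470,13162199,4777023,21951039,5197931,20615106,17038645,30647103,11443867,26578719,21298403,5999240,27512867,16855142,24272987,29452871,25104456,29851014,18848339,31348871,16909751,4524761,14152151,9107977,8235607,17748341,31779291,33388428,5090899,19560717,16121761,32495941,13964339,21537008,6007592,8560140,27495947,14388481,27857559,9287728,28441815,2254309,7218449,11946260,22906629,23995917,27661831,6949257,26744675,17908005,27172593,1870996,6628505,28232758,12257514,4539383,17452121,10738142,25476263,22197852,24071959,14968913,27868676,8013481,33077108,1857914,15083901,20071467,28230356,23970361,27013027,25998152,28809983,7389980,18354089,33408983,11352979,9894479,11973460,9981191,9778354,28984730,5218134,9890591,3287713,7728856,4484440,20215519,24984254,20737194,19800162,13558182,16920161,12360824,1830474,16518000,26833427,1262250,2686440,22395482,2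8185976,13811937,18539426,32575881,3469465,9629806,19970565,2218585,32566818,22551460,16420013,15440372,30383663,6656057,11023075,11510830,1584109,28915782,18924967,28784273,24423311,31175733,3611742,20862225,16651322,19146541,15886764,10296162,17045812,32821480,16731130,9528522,12081287,20788747,7684063,22910098,13565776,10607877,21768316,12729008,8513838,3120072,25382435,32889453,28900882,23563697,12821723,17232754,14532548,7026127,24086018,27926381,29289079,14133899,32182008,24521122,27849815,29147544,16877372,21347000])]),
([5,3,4,3,1],[([8617983,10518527,1028095,1043455,1534975,2734079,2924543,9019391,2356223,2749439,2546687,2939903,4582399,8641535,8645631,9026559,9034751,2582527,2963455,3026943,9121791,17248255,3240959,3431423,9526271,6383615,18954239,6574079,19144703,12668927,25239551,2860031,3050495,9145343,1032031,1043935,1046911,2355103,2736031,2357087,2749919,2547551,2551519,2932447,2940383,8642399,8646367,9027295,9035231,2358079,2750911,2554495,2947327,8649343,9042175,2834239,2846143,2848127,3030655,3038591,3042559,9125503,9133439,9137407],[16721347,32852718,12259938,26716625,10644267,25911250,27168429,25077651,28851538,1997655,18175781,31256945,18811351,2420627,22606925,6600481,10671865,23513707,24714857,8827538,31067272,3268456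7,9682777,26322354,20057858,11616022,13441531,9682330,20870228,24425674,21506259,21676635,31307524,6159933,3228665,17881689,22005138,31670563,21935355,30480067,19232276,12441207,9021951,15822060,29170030,13405328,16617026,29044264,15544847,25620812,28155208,8800697,12872358,8821322,4308558,13204796,7952456,25499606,17934320,10643817,32061577,5730026,24214006,20865731,26689954,5892046,17788964,26004420,30680938,31309253])]),
([5,3,2,2,2],[([3247359],[32564611,32014245,5096012,23303855,23551597,18755433,19629903,25906003,32077572,3906357,32081199,11588455,7228837,2374359,1515353,11122529,2731690,29966475,10013906,14394173,17017414,1867140,18211325,27787117,3958301,27192556,29044051,22330084,17178709,8598941,23109198,9472845,27212036,22489281,27079169,6465323,12104942,32246287,23432954,23158570,17024466,14225934,29831457,21422594,6583665,22097562,12406212,4240079,15445887,13462703,5067988,14550984,21194493,7900909,21480695,23507019,23718964,13197999,28460071,21358289,16102915,25055919,27959774,12460018,21454363,5529305,17683173,31597415,17417510,19635633,15547628,26813207,3725514,25802634,2680334,13576496,4183585,22940208,19514606,30926572,5980206,12766852,33409635,14357384,12938324,24085580,27976636,22881997,27970794,13410159,2723198,24550891,22702692,19011995,11175763,19346232,2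0896821,25942672,29832047,33274729,31574245,3630060,9526924,9655021,15534128,23445633,31348208,15807133,6079135,9331790,8615874,13541135,27668426,2308474,13988840,29068104,11308188,11581532,17640527,4366941,32497839,31712110,12293535,1201899,12254277,32617234,26319246,5594763,24700141,25654225,8503972,16490844,19757158,20028268,31942645,29357001,32275757,2340823,21540098,25315265,16481755,14447042,17733482,17520616,8046431,26364904,23715356,1482302,10415482,2396561,11231499,25134439,17637231,23532002,24974662,28578896,20885177,23862533,9318309,14155081,23447646,26719923,23149137,26878650,15982466,4804473,4965784,1748531,29593389,3898098,14046203,22842648,14613222,16543625,7638833,26156649,28310132,22145765,32280434,4950305,7775078,3414359,4376551,22898085,9689424,33480268,1576196,30684748,6049347,31709321,30961448,19320917,5797622,15897159,9834443,11336061,1628645,31022495,24965656,27239699,28904382,9698812,25566693,9685541,14946554,25203346,7468393,7312056,17516831,20542757,16838725,21611390,11695515,11063987,32742123,10568411,17513799,24725208,26508677,11200154,25047302,22418638,28439831,13293864,3026511,3589530,21121363,5917850,8722979,18248532,32643922,8424633,22352402,31164527,19427201,29613701,14675763,6255999,22069977,15273706,24343683,28557619,13530724,19287124,29507515,3795409,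6844178,26711468,25071724,1290877,11779511,27998469,32828759,26133201,15846029,29128784,28308988,31919188,26908195,23245629,15636099,23746013,27554284,30128673,28528976,32638396,5475731,18172336,28113231,4788066,16725757,23849098,26725534,11222283,24825848,23892257,20068591,11801157,10306238,27751928,20662345,17992558,31979400,31781343,15132610,12959274,26978503,20385854,18028296,22556156,32138423,20190510,1985067,8723256,24021179,18768193,27167463,29486562,26253262,22960674,8644354,28728074,5764780,19571569,10084043,6281997,3717797,22195123,19440825,21088720,31954051,9955426,22840610,8509199,6769579,8598611,17740234,22988419,20846852,24915037,7199848,28095397,31406756,13201897,29273475,19882231,12163586,4421187,19561143,2350002,8784529,6912808,21556697,10615507,31749933,23833780,22480778,13946958,6885725,4460293,2675944,3241318,9500287,1879450,11575878,15085226,4910114,13077296,7000443,12156181,29511483,16636526,29903736,1608441,7815102,32324916,18941727,11491884,31095359,22229304,9668891,28093087,22379239,17943704,6123756,18591020,17159224,19391949,20950065,8080505,28537143,20245855,2677258,31267633,28535597,32499280,14419581,1924725,29635895,9607633,14626363,14754351,5927070,26090969,2256566,1221222,3970825,7686761,25261804,3730561,19186355,12513956,26807512,19261609,3299225,13576453,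20458062,16700452,31453131,7196626,20326255,5662183,21621886,17485809,16571554,4718380,9057062,23974788,28545502,8376825,28014488,8508871,17381162,23421864,4641624,28567638,21125921,13072486,28021993,14315822,21128009,32038806,17472340,28728309,18157180,25039146,9631214,20197946,12741241,14450174,2374270,20079246,4483388,23455800,23892091,13285097,9801247,33000521,16180905,28064065,23832868,16397224,17041026,1137919,17573455,27982275,4241009,15436676,15463029,21192490,22422897,29953430,32626404,20638584,26212995,13438279,1807706,1747034,29537738,30921109]),([1929023,2944831,9039487,17165951,17427839,9039679,17166143,17624447,9039711,2977599,9268863,9989759,18116223,18378111,9989983,25227103,11038335,19164799,19426687,25718143,19165023,25259871,1958751,9291391,17671807,17679743,17672031,9292415,17672831,17680767,17686911,3007327,9292639,10013535,18139999,18393951,10045279,18171743,18425695,10052223,18178687,18440575,10242687,18623103,18631039,3957599,10046303,18172767,18426719,18178911,18623327,11061087,19187551,19441503,11068031,19194495,19456383,25479807,25733759,25741695,11062111,19188575,19442527,11068255,25289567,25733983,11290239,19670655,19678591,25511551,25765503,25773439,11093855,19220319,19474271,11290463,25511775,25956191,11100799,19227263,19489151,11100991,19227455,11291263,19671679,1967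9615,11291455,19671871,19685759,25512575,25766527,25774463,25512767,25766719,25780607,25971071],[5722864,24686146,30360036,5046033,27588074,33477839,28091166,5756109,22758156,24585071,16688954,7771869,30726721,31797985,19379470,29466253,29963458,22856054,8425433,23705999,27159766,21140343,28814503,22154081,20005679,28454200,14800262,24799966,5339982,19213724,22997342,15834193,32280426,32034747,8161967,3397708,26422679,26753702,11735854,28160548,4005297,28269675,21833724,24438111,1767404,13432774,17283756,19003451,31054233,5486807,16265269,21734550,16903973,19809574,21408739])]),
([5,1,1,1,1,1],[([34636863],[2954153,15266745,30993461,21836712,7308373,26253687,21210660,9270836,26502099,2983624,22922963,14422290,10325054,32289233,28369421,9166958,20382960,2369425,11772666,26947938,29980378,22614319,23398863,29357768,13964689,17037299,26653586,5093894,1404837,15408545,14577480])]),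
([3,4,4,3,1],[([17266535,9140071,5076839,3045223,17234791,9108327,5045095,1997671,17264551,9138087,5074855,3043239,17169319,9042855,2948007,1932199,17231815,9105351,5042119,1994695,17168327,9041863,2947015,1931207,17266411,9139947,5076715,3045099,17234667,9108203,5044971,1997547,17260459,9133995,5070763,3039147,17038251,4848555,2816939,1801131,17227723,9101259,5038027,1990603,17037259,4847563,2815947,1800139,17264365,9137901,5074669,3043053,17169133,9042669,2947821,1932013,17260397,9133933,5070701,3039085,17038189,4848493,2816877,1801069,17162189,9035725,2940877,1925069,17035213,4845517,2813901,1798093,17231598,9105134,5041902,1994478,17168110,9041646,2946798,1930990,17227630,9101166,5037934,1990510,17037166,4847470,2815854,1800046,17162158,9035694,2940846,1925038,17035182,4845486,2813870,1798062,17266163,9139699,5076467,3044851,17234419,9107955,5044723,1997299,17252275,9125811,5062579,3030963,8649651,4586419,2554803,1538995,17219539,9093075,5029843,1982419,8648659,4585427,2553811,1538003,17264117,9137653,5074421,3042805,17168885,9042421,2947573,1931765,17252213,9125749,5062517,3030901,8649589,4586357,2554741,1538933,17154005,9027541,2932693,1916885,8646613,4583381,2551765,1535957,17231350,9104886,5041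654,1994230,17167862,9041398,2946550,1930742,17219446,9092982,5029750,1982326,8648566,4585334,2553718,1537910,17153974,9027510,2932662,1916854,8646582,4583350,2551734,1535926,17260025,9133561,5070329,3038713,17037817,4848121,2816505,1800697,17252089,9125625,5062393,3030777,8649465,4586233,2554617,1538809,17022937,4833241,2801625,1785817,8642521,4579289,2547673,1531865,17227258,9100794,5037562,1990138,17036794,4847098,2815482,1799674,17219322,9092858,5029626,1982202,8648442,4585210,2553594,1537786,17022906,4833210,2801594,1785786,8642490,4579258,2547642,1531834,17161724,9035260,2940412,1924604,17034748,4845052,2813436,1797628,17153788,9027324,2932476,1916668,8646396,4583164,2551548,1535740,17022844,4833148,2801532,1785724,8642428,4579196,2547580,1531772,1040252,1032060,1044220,1031932,1043964,1039868,1040314,1032122,1046266,1031930,1046010,1039866,1044406,1032118,1046390,1032054,1046006,1043958,1044398,1040302,1046382,1040238,1046254,1044206,1040345,1032153,1047289,1031929,1047033,1039865,1044437,1032149,1047413,1032053,1047029,1043957,1044429,1040333,1047405,1040237,1047277,1044205,1046483,1032147,1047475,1032115,1047027,1046003,1046475,1040331,1047467,1040299,1047275,1046251,1046471,1044423,1047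463,1044391,1047399,1046375,2686975,9011199,9076735,3178495,17858559,18907135,12615679,33587199,67141631,134250495,268468223,536903679,1031167,1304575,1431551,1685503,1307647,1764351,1891327,1504255,1897471,1908735,1529855,1783807,1796095,1914879,1927167,1784831,1534975,1915903,2353151,2942975,4575231,17018879,8757247,8769535,17412095,17151999,17414143,9089023,17215487,9215999,5036031,8837119,17225727,2354175,2481151,2735103,2356223,4451327,17021951,17161215,4453375,4584447,8778751,17429503,4643839,4897791,5037055,8838143,17226751,17480703,8842239,17492991,9223167,17619967,2963455,2971647,2975743,3041279,8855551,9117695,17244159,8867839,17637375,4679679,5072895,8869887,5132287,9314303,9326591,17707007,5138431,9328639,17709055,3206143,9497599,17886207,5305343,9499647,17888255,3237887,5335039,9525247,17905663,9588735,17969151,9707519,9969663,5519359,5789695,9582591,3240959,3304447,3431423,3685375,5338111,9532415,5401599,9595903,9722879,9976831,18111487,18365439,21026815,18936831,12639231,21019647,21031935,6383615,10573823,18954239,10577919,18966527,10637311,19017727,10756095,11018239,6449151,10643455,10770431,11024383,19159039,19412991,12670975,21051391,21063679,12734463,21114879,12853247,21241855,12865535,13119487,21254143,21508095,25436159,2569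8303,13136895,21263359,33649663,33713151,33840127,34094079,67171327,134278143,268491775,536919039,67266559,67393535,67647487,134309887,268523519,536950783,134500351,134754303,268587007,537014271,268967935,537141247,1936383,1557503,1811455,1938431,1942527,1950719,2001919,2003967,2008063,2016255,2033663,2034687,2036735,2040831,2049023,2983935,5081087,8882175,9144319,2991103,2999295,3050495,8883199,17271807,5084159,5088255,5096447,8885247,17273855,9151487,17286143,3458047,3711999,9552895,17933311,9997311,18123775,5415935,5424127,5805055,5555199,5809151,17994751,9618431,17998847,9999359,18125823,5638143,3490815,3744767,5587967,5841919,9769983,18158591,9833471,18222079,9835519,18486271,12748799,10601471,18981887,10667007,19047423,10785791,11047935,12880895,13143039,12882943,21533695,11077631,19204095,10881023,19269631,12912639,13174783,12978175,21628927,12993535,21636095,13374463,21763071,25564159,25826303,1031551,1039743,1043839,1044095,1044287,1046143,1046335,1031647,1039839,1032031,1040223,1044319,1032095,1040287,1044383,1046367,1046431,1046783,1046911,1047231,1308575,1490655,1498591,1752543,1490847,1499039,1761183,1504991,1766879,1767135,1505119,1767263,1897951,1898335,1505727,1767871,1768127,1506111,1768255,1898943,1899327,1440479,1702367,1898975,1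899231,1899423,1535615,1797503,1916543,1924479,1928447,1531711,1785663,1535679,1797567,1916607,1924543,1916735,1924927,1537855,1799999,1930687,1931071,1981823,1990015,1993983,1982143,1990079,1990335,1994175,1994431,1996031,1523423,1531359,1785311,1531743,1785695,1535711,1797599,1916639,1924575,1916831,1925023,1929119,1537759,1799647,1930719,1930975,1931103,1931167,1994207,1994463,1994591,1982367,1990559,1996639,1538687,1800575,1931519,1538751,1800639,1538879,1801023,1931711,1997055,1997439,1997247,1997503,1997631,1997727,2487999,2749887,2551423,2813311,2932351,2940287,2944255,2553535,2815423,2553663,2815807,2946495,2946879,4570751,4578687,4832639,4583039,4844927,8633983,8641919,17022335,8646271,17034623,8772863,9026815,17153279,8765055,8772991,9026943,9027199,17153407,17153663,17415551,9039103,17165567,4452159,4570815,4578751,4832703,8646463,17035071,8765119,8773055,9027007,9035199,17153471,17161663,17415615,8648063,8648319,4454207,9041343,17168063,4636287,4644223,4898175,5041407,8830591,8838527,8838783,9092479,9092735,9100671,17218943,9104639,17231103,9231615,17612031,4636479,4644671,4906815,4648383,4648639,4910783,5029567,5037503,5037759,9092799,9100735,9100991,17227455,17481151,17481407,17489343,4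650367,8844543,17495295,2357151,2539231,2547167,2801119,2932575,2940767,2932639,2940831,2944927,2946911,2553759,2815903,2946975,4452191,4570847,4578783,4832735,4579167,4833119,8634079,8642015,17022431,8642399,17022815,8646495,17035103,4579231,4833183,4583327,4845471,8642463,17022879,8646559,17035167,4585311,4847455,8648543,17037151,4585375,4847519,4644703,4898655,4648799,4910943,5042015,8838879,9092831,17227231,17481183,4648863,4911007,5029791,5037983,4650847,4912991,5044063,9107295,17233759,2554495,2816383,2947327,2554687,2816831,2947775,4586111,4847999,8649087,17037695,9042175,17168639,4586303,4848447,8649151,8649407,8649535,17038143,9042367,17169087,4651647,4913535,5044479,5044863,9107839,17234559,5044671,5044927,5045055,9108287,17234751,5045151,9108383,17234847,2586431,2848575,2979519,2979647,3030399,3030655,3043135,3044991,3045055,3045183,5062271,5070207,8871167,9125119,17251583,8863359,8871295,8871551,9125247,17251711,17251967,17259903,9264383,17644799,4681535,4943679,5062079,5070271,5074751,8863423,8871359,9125311,9133503,17251775,17259967,17513919,5076607,9139583,17266303,5076671,5076799,9140031,17266495,5127807,5135743,9330303,17710463,5140159,9330367,17710527,5142143,5140383,9330591,17711007,9336543,1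7724895,5143359,9337535,17725887,5305823,5306207,9500127,17888735,9500511,17889119,5307199,9501119,17889727,9501503,17890111,9501407,17889759,9501599,17890207,3432255,3686207,9527103,17907519,5338943,9532863,17921471,9533247,17921855,5521023,5528959,5782911,9584255,9592191,17972607,9723135,9977087,18103551,9715327,9723263,9977215,9985407,18103679,18111871,18365823,5533375,5795263,9584319,9592255,17972671,9596607,17984959,9715391,9723327,9977279,9977535,18103743,18103999,18365887,5404287,5534975,5797119,17986815,3432287,3686239,3438303,3700191,3307423,5336991,9527199,17907615,9531295,17919903,5338975,9533151,17921503,9533279,17921887,5339039,9533343,17921951,5402463,5533407,5795295,9596639,17984991,9596767,17985375,9977567,9985503,18104031,18111967,5402527,9592735,17973151,5404511,9598431,17987295,9991647,18118367,3439295,3701183,9533887,17922495,9599359,9599615,9599679,17988031,9992639,18119359,6354751,10548671,18937279,10549055,18937663,12631743,12639679,21020095,12645631,10542943,18923359,6352799,10543007,18923423,10547103,18935711,6354783,10549087,18937695,10549151,18937759,12644191,21032799,12640159,21020575,12645855,21034719,25228767,25229023,10549695,10549951,12646783,12647039,12647103,21035455,25229759,25230015,6387519,10581439,10581695,10581823,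18970431,6569599,6577535,6831487,10632831,10640767,19021183,10771711,11025663,19152127,10763903,10771839,11025791,11033983,19152255,19160447,19414399,6451007,6569663,6577599,6831551,10645311,19033919,10763967,10771903,11025855,11034047,19152319,19160511,19414463,10646911,10647167,10646975,10647231,11040191,19166911,12664511,12672447,21052863,12676927,21065535,12678527,12678783,12678591,12678847,25261503,25261759,12868863,13122815,21249279,12861055,12868991,12869247,13122943,13123199,13131135,21249407,25312895,25320831,25451775,25705727,12742079,12742335,12861119,12869055,12869311,13123007,21249471,21249727,21257663,25312959,25320895,12744319,21132927,12744543,21133151,13137375,21264095,25327071,25327327,2004447,2004831,2008543,2016735,2008927,2017119,1553087,1561023,1814975,2005823,2009535,2017727,2009919,2018111,2011391,1559391,1813343,1944479,1952671,1561439,1815391,1565407,1827295,1946335,1954271,1946463,1954655,1561503,1815455,2009823,2017759,2009951,2018143,2010015,2018207,2011615,2020063,2023903,2024159,2037567,2041279,2049471,2041663,2049855,2035615,2037599,2041759,2049951,2042303,2042559,2044287,2044543,2044607,2052543,2056639,2056895,2606911,2860863,3053375,3057087,3065279,3057471,3065663,9146175,17272639,4695679,4703615,4957567,8885887,9147775,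17274239,8897791,9151743,17278207,8889983,8897919,9151871,9160063,17278335,17286527,17540479,4695743,4703679,4957631,5088959,5096895,8890047,8897983,8898239,9151935,17278399,17278655,17286591,9279167,17667519,5150335,5162239,9344255,17732863,2992031,3000223,3051423,3053407,3057375,3065311,3057503,3065695,3053471,3057567,3065759,9146207,17272671,4704095,4958047,5088991,5096927,5089119,5097311,9152223,9160159,17278687,17286623,4704159,4958111,5085087,5148511,5148575,5150559,5154271,5162719,9357023,17737183,2601663,2609599,2863551,2609983,2863935,2613951,2875839,2994879,3002815,2995007,3003199,3058111,3066303,3058495,3066687,3060095,3060351,3060159,3060415,3072447,3072703,4696703,4704639,4958591,8886911,9148799,17275263,8898815,9152767,17279231,8891007,8898943,9152895,9161087,17279359,17287551,17541503,4705087,4959039,5090111,5098303,8886975,9148863,17275327,8891071,8899007,8899263,9152959,9153215,9161151,17279423,9280191,17668543,5091967,5099903,8900863,9154815,17281279,8893055,8900991,8901247,9154943,17281407,17281663,17289599,9294079,17674495,4711103,4972991,5091775,5092031,8893119,8901055,8901311,9155007,9155263,9163199,17281471,5155199,5163391,9345663,17734015,9357567,17737983,5155263,5155519,9358015,17738175,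5157503,5165695,5157727,5165919,5169631,5169887,9360095,17740255,3086143,3089855,3090111,5181247,5186943,5195135,9377407,17765759,9389311,17769727,5187263,5195199,9389759,17769919,5412703,5416671,5543647,5547743,5555679,5809631,5556063,5810015,9606879,9610975,9618911,17999327,9619295,17999711,9737951,9999839,18126303,10000223,18126687,9742047,9749983,10003935,10012127,18130399,18138591,18392543,5548735,5556671,5810623,5557055,5811007,9611967,9619903,18000319,9620287,18000703,9738943,10000831,18127295,10001215,18127679,9743039,9750975,10004927,10013119,18131391,18139583,18393535,5427583,5431551,5558527,9621759,3459999,3713951,3461983,3715935,9554847,17935263,9556831,17937247,5557087,5811039,9620319,18000735,5557151,5811103,9620383,18000799,10001311,18127775,5550815,5558751,5559007,5812703,5812959,5820895,5563103,5824991,9614047,9621983,9622239,18002399,18002655,18010591,9626335,18014687,9745119,9753055,10007007,10007263,18133471,18133727,18395615,5580479,5588415,5842367,5588799,5842751,9643711,9651647,18032063,9652031,18032447,9770687,10032575,18159039,10032959,18159423,9774783,9782719,10036671,10044863,18163135,18171327,18425279,5903743,5907711,6034687,10097919,3491743,3745695,3557215,3811167,10031007,18157471,5588831,5842783,10032991,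18159455,5588895,5842847,9652127,18032543,10033055,18159519,10096479,18222943,5646047,5653983,5654239,5907935,5908191,5916127,6039263,6047199,9836255,10098143,10098399,18224607,18224863,18486751,9840351,9848287,9848543,10102239,18228703,18228959,18236895,10229471,18617823,3494719,3748671,3558207,3812159,3551935,3559871,3813823,5581503,5589439,5843391,5589823,5843775,9644735,9652671,18033087,9771711,10033599,18160063,9775807,9783743,10037695,10045887,18164159,18172351,18426303,5583487,5591423,5845375,9646719,9654655,18035071,9785599,10039551,18166015,9777791,9785727,10039679,10047871,18166143,18174335,18428287,5583551,5591487,5845439,5595839,5857727,9659071,18047423,9777855,9785791,10039743,10039999,18166207,18166463,18428351,5646975,5654911,5908863,9837183,10099071,18225535,9849087,10103039,18229503,9841279,9849215,10103167,10111359,18229631,18237823,18491775,5647039,5654975,5908927,6040255,6048191,9841343,9849279,9849535,10103231,18229695,18229951,18237887,10230463,18618815,5657215,5911167,5919103,9851135,10105087,10113279,18231551,18239743,18493695,5657439,5911391,5661407,5923295,6042335,6050271,9843423,9851359,9851615,10105311,10105567,10113503,18231775,6596287,6604223,6858175,6604607,6858559,10659519,10667455,19047871,10667839,19048255,10786495,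11048383,19174847,11048767,19175231,10790591,10798527,11052479,11060671,19178943,19187135,19441087,21140863,21144831,21271807,25335039,10602399,18982815,11046815,19173279,10667871,19048287,11048799,19175263,6604703,6858655,10667935,19048351,11048863,19175327,12699487,21079903,13143903,21270367,12756703,12764639,12764895,21145055,21145311,21153247,12883679,13145567,13145823,21272031,21272287,21534175,12887775,12895711,12895967,13149663,13149919,13157855,21276127,25339615,25347551,25466591,25728479,10605375,18985791,6597311,6605247,6859199,10660543,10668479,19048895,10668863,19049279,10787519,11049407,19175871,10791615,10799551,11053503,11061695,19179967,19188159,19442111,6599295,6607231,6861183,10662527,10670463,19050879,10801407,11055359,19181823,10793599,10801535,11055487,11063679,19181951,19190143,19444095,6611647,6873535,10662591,10670527,19050943,10674879,19063231,10793663,10801599,11055551,11055807,19182015,19182271,19444159,12700479,21080895,12694207,12702143,21082559,12757631,12765567,21145983,12884607,13146495,21272959,12896511,13150463,21276927,12888703,12896639,13150591,13158783,21277055,21285247,21539199,12757695,12765631,21146047,12888767,12896703,12896959,13150655,13150911,13158847,21277119,25340607,25348543,25467583,25729471,12767871,21148287,21156223,12898559,13152511,13160703,21278975,21287167,21541119,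12768095,21148511,12772063,21160415,12890847,12898783,12899039,13152735,21279199,21279455,21287391,25342687,25350623,6629055,6636991,6890943,10692287,10700223,19080639,10819263,11081151,19207615,11081535,19207999,10823359,10831295,11085247,11093439,19211711,19219903,19473855,11145023,19271487,6694527,6702463,6956415,10884735,11146623,19273087,10896639,11150591,19277055,10888831,10896767,11150719,11158911,19277183,19285375,19539327,7087807,7095743,10884799,11146687,19273151,10888895,10896831,10897087,11150783,19277247,19277503,19285439,11278015,19666367,13176639,21303103,12789375,12797311,21177727,12916351,13178239,21304703,12928255,13182207,21308671,12920447,12928383,13182335,13190527,21308799,21316991,21570943,12916415,13178303,21304767,12920511,12928447,12928703,13182399,13182655,13190591,21308863,25372351,25380287,25499327,25761215,12979903,13241791,21368255,13244031,21370495,21632383,12993791,13247743,13255935,21374207,21382399,21636351,13244255,21370719,12986079,12994015,13247967,13248223,21374431,21374687,21636575,13375199,21763551,25564895,25826783,12989055,12996991,13250943,13259135,21377407,21385599,21639551,13263103,21389567,13390079,21770495,25579775,25833727,1047615,1047647,1047711,1047839,1048095,1539615,1801503,1932447,1997919,2555423,2817311,2948255,4587039,4848927,8650271,17038623,9043103,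17169567,5045343,9108575,17235039,3046463,5078079,9141311,17267775],[17043521])]),
([3,2,1,1,1,1],[([34636903],[20901112,31623383,28236422,30948091,17785186,21775972,8273611,3421693,8366150,29107097,5355428,26747814,20718268,4251320,4437266,29239491,7028189,5565218,10524393,31573915,23174098,6606164,32432516,12858846,10025691,12119523,13921959,5568561,4888944,8852059,11135188,20237013,19997735,16131131,6199961,16147009,8596035,25158946,12000543,26432111,14053510,12287112,15194193,1567901,23748426,20928336,32050518,31609745,29954413,15530660,9927542,31735787,12167692,30805894,4972620,9250164,24197276,24163513,1629140,2716507,17902320,13619342,24849019,21842809,14151826,16561266,11213397,21152690,26441212,13885576,5664688,14581252,4737966,20817236,32749379,16379897,13548924,3776898,29118500,11357462,16504150,17286534,29104671,16871990,26680866,26001265,25489246,10257559,12194746,18767474,25828439,9860038,11410969,21724378,26763885,13705946,32095367,4759971,17761705,28072318,28650612,2645321,29095992,33420778,5369483,14799800,21814308,23016905,6057687,1404645,33100386,15823783,4480418,3718798,13941523,12760711,2415146,19802631,7980801,12549724,13758736,3861257,1210043,11387478,31913717,32155229,11798348,21551895,19996349,18919973,20421559,22201576,3621138,10940159,30751835,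14401592,32771957,16556099,9780935,16091859,32630162,23766555,32916245,16653249,31714845,10317599,9609934,4808062,4089815,22147899,32240136,14880304,1341388,4578174,8242987,8982135,9587461,30031309,25514745,9474008,17901219,11278370,20588043,9959699,17779403,15580555,11736157,19824116,4445278,1222351,8469908,18563258,23009377,6414913,26118188,27096246,31986360,16169178,30592089,12934332,13148830,2216413,23307629,26138826,14523032,19532457,21756511,26196923,16699434,32645839,18050431,19657939,18166578,27501002,11175357,14406131,32839252,13598213,23529983,4139778,4105602,21667352,31952040,9814433,5024105,6143341,2255795,20884447,7151751,18639858,9390893,24908717,13372464,29476129,4507463,10555204,16423007,16427570,30548711,31607299,18619047,20833202,7906507,32719026,24721324,21978614,2860292,22412790,13081266,3609579,5060043,31945210,26655875,3894923,32638310,16490181,4689742,11699482,12688235,24250543,21739570,21184281,17364123,19885255,33321939,24835649,6057774,6563192,1323826,16139415,11694310,14327329,15622054,15498724,3347002,5189973,21923182,2388755,12940517,29155998,29539403,31021737,25232874,22609437,15828690,26351975,9767717,8051352,24471180,33339621,1125151,6745193,19284405,32668398,15704714,33340356,24089679,15704749,26032936,20423938,14450147,22910658,16690579,13331810,8570810,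1722724,32602314,21493418,7842450,30913782,2529036,14804603,18107081,15067347,10459505,25917609,8840950,27495765,6705985,26715405,9597181,29713452,2411732,14112255,25818690,10533725,25812149,27407283,21993539,32036583,4370281,10780304,2212206,4608034,22679326,25628464,24795370,18697369,27731862,20535370,7754333,14391604,5479276,20777231,32981881,5744365,21158346,4832946,14581392,26668247,14410194,3966228,5755482,1625018,31416889,15881620,27321993,1755275,16173044,29587935,15575631,27571910,25202067,26348425,12302726,11803472,8329525,27321072,28192766,16588523,13450541,11716318,3312495,25286910,22914440,15775485,26855982,13055836,23173041,13391730,31000549,23246724,2051238,26799314,13981309,32155564,22798951,9535236,9609830,28955044,31178803,2417027,1268084,32274111,11791097,17337257,3084951,30069158,11474229,22520267,12682896,5977166,21914179,6951893,12974299,3654231,33010790,12549949,8355504,29755026,26756275,21233495,13859214,18988205,27859236,21472517,24428810,9420361,29843691,32432537,6282535,14153767,20248358,21688195,11077817,2557115,31953958,6353907,15703085,28182708,3382167,3744713,5098812,12337732,20660542,3519894,19292922,24703317,29986174,31007041,32108273,10877551,29893493,22833800,33147417,8249523,18235699,15636321,22941962,11495723,2422448,16464723,23902517,21558203,23382927,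9931095,33083273,7980501,22353816,24160125,6036825,17339863,2630997,7334547,32692166,32081718,9367068,23054091,13177357,25866167,29333547,27705326,30714235,25375409,4973353,26203234,27991363,32617864,4672616,15765114,4138456,1205102,30111847,29706658,16570360,6200958,2871557,12513863,23555393,3723982,21592558,7090801,26990909,23228003,11601561,17786052,23930307,33152658,19826477,27839092,16585413,15231699,1416344,3921747,29702835,21099385,23555615,8837938,28063308,1452674,23277993,21796707,1334383,14854920,2148858,24188214,25316793,10020783,22011398,31655248,6886939,13243431,4867339,17989029,8046108,18531048,11998067,23141830,3708543,3454557,21207593,9548488,5778578,21351112,11230296,3218738,2220466,14150460,2542792,33125782,7021412,4485346,12809986,27208910,10281419,15323843,3443374,4475623,8624208,15568092,21444319,9725511,31928113,32332272,19845948,24556331,17589885,20615039,15626184,4009615,14013693,21662660,14591650,18709123,27006026,23023092,24380592,17805086,4947705,3566877,29835014,26684660,24025354,28572852,3359996,29783215,1945196,25898687,30202148,23267966,30774388,14178289,22137791,27703935,24582924,27553762,28194922,23670199,27805177,10943938,2678712,33158583,12403357,13194065,7704765,2793444,2854698,1365419,17336478,29561518,10268071,31531543,1603176,7782667,13266101,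33453686,15250275,3645985,23271369,16476482,30593648,11853819,20638696,18782580,21467843,23319231,16014106,18032298,31526283,7931281,14966177,26550736,8489581,8706118,33178314,7609116,2859300,33135482,6086078,18915537,1232227,3552793,3847977,25630674,10941203,7915838,9167421,24309294,32436395,30228045])])]

theorem ckA : allL (fun g => allL (fun p : List ℕ × List ℕ => okF g.1 p.1) g.2) lbData = true := by decide +kernel
theorem ckB : (build rulesData Tr.e fun D => ckAll D lbData) = true := by decide +kernel

lemma brec {β : Sort*} (x y : β) (b : Bool) : (@Bool.rec (fun _ => β) y x b) = if b = true then x else y := by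
  cases b <;> rfl

lemma bbeq {β : Sort*} (x y : β) (a b : ℕ) : (@Bool.rec (fun _ => β) y x (Nat.beq a b)) = if a = b then x else y := by
  rw [brec]; simp only [Nat.beq_eq]

lemma bble {β : Sort*} (x y : β) (a b : ℕ) : (@Bool.rec (fun _ => β) y x (Nat.ble a b)) = if a ≤ b then x else y := by
  rw [brec]; simp only [Nat.ble_eq]

lemma bblt {β : Sort*} (x y : β) (a b : ℕ) : (@Bool.rec (fun _ => β) y x (Nat.blt a b)) = if a < b then x else y := by
  rw [brec]; simp only [Nat.blt_eq]

lemma frc_eq {β : Type} (n : ℕ) (f : ℕ → β) : frc n f = f n := by cases n <;> rfl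

def bs (I : ℕ) : Finset (Fin 5) := Finset.univ.filter fun i => I.testBit i = true

lemma mem_bs {I : ℕ} {i : Fin 5} : i ∈ bs I ↔ I.testBit i = true := by simp [bs]

lemma bs_mod (I : ℕ) : bs (I % 32) = bs I := by
  ext i; rw [mem_bs, mem_bs, show 32 = 2 ^ 5 by rfl, Nat.testBit_mod_two_pow]; simp

lemma bs_zero : bs 0 = ∅ := by ext i; simp [mem_bs]

lemma pc_mod (I : ℕ) : pc (I % 32) = pc I := by
  simp only [pc]; congr 3; exact Nat.mod_mod _ _

lemma pc_eq (I : ℕ) : pc I = (bs I).card := by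
  rw [← pc_mod, ← bs_mod]
  have : ∀ J < 32, pc J = (bs J).card := by decide +kernel
  exact this _ (Nat.mod_lt _ (by norm_num))

lemma pc_le (I : ℕ) : pc I ≤ 5 := by rw [pc_eq]; simpa using Finset.card_le_univ (bs I)

lemma bs_xor (I J : ℕ) : bs (I ^^^ J) = symmDiff (bs I) (bs J) := by
  ext i; simp only [mem_bs, Nat.testBit_xor, Finset.mem_symmDiff]
  cases I.testBit i <;> cases J.testBit i <;> simp

lemma bs_and (I J : ℕ) : bs (I &&& J) = bs I ∩ bs J := by
  ext i; simp [mem_bs]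

lemma bs_or (I J : ℕ) : bs (I ||| J) = bs I ∪ bs J := by
  ext i; simp [mem_bs]

def mon (c : ℕ) : R5 := if h : c = 0 then 1 else xs (bs c) * mon (c / 32) ^ 2
termination_by c
decreasing_by omega

lemma mon_zero : mon 0 = 1 := by rw [mon]; simp

lemma xs_empty : xs ∅ = 1 := by simp [xs]

lemma mon_rec (c : ℕ) : mon c = xs (bs c) * mon (c / 32) ^ 2 := by
  by_cases h : c = 0
  · subst h; simp [mon_zero, bs_zero, xs_empty]
  · rw [mon, dif_neg h]

lemma mon_cons {o : ℕ} (ho : o < 32) (a : ℕ) : mon (o + 32 * a) = xs (bs o) * mon a ^ 2 := by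
  rw [mon_rec, ← bs_mod, show (o + 32 * a) % 32 = o by omega, show (o + 32 * a) / 32 = a by omega]

lemma mon_32 (a : ℕ) : mon (32 * a) = mon a ^ 2 := by
  have := mon_cons (show 0 < 32 by norm_num) a
  rwa [zero_add, bs_zero, xs_empty, one_mul] at this

lemma mon_letter {S : ℕ} (h : S < 32) : mon S = xs (bs S) := by
  have := mon_cons h 0
  rwa [mul_zero, add_zero, mon_zero, one_pow, mul_one] at this

lemma and_div32 (a b : ℕ) : (a &&& b) / 32 = (a / 32) &&& (b / 32) := by
  have := Nat.and_div_two_pow (a := a) (b := b) (n := 5); exact this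

lemma xor_div32 (a b : ℕ) : (a ^^^ b) / 32 = (a / 32) ^^^ (b / 32) := by
  have := Nat.xor_div_two_pow (a := a) (b := b) (n := 5); exact this

lemma mon_mul (S : ℕ) : ∀ c, mon S * mon c = mon (32 * (S &&& c)) * mon (S ^^^ c) := by
  induction S using Nat.strong_induction_on with
  | _ S ih =>
    intro c
    by_cases h : S = 0
    · subst h; simp [mon_zero]
    · have := ih (S / 32) (by omega) (c / 32)
      rw [mon_32, mon_rec S, mon_rec c, mon_rec (S &&& c), mon_rec (S ^^^ c), bs_and, bs_xor, and_div32, xor_div32]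
      rw [mon_32] at this
      have h2 := xs_mul (bs S) (bs c)
      calc _ = (xs (bs S) * xs (bs c)) * (mon (S / 32) * mon (c / 32)) ^ 2 := by ring
        _ = _ := by rw [h2, this]; ring

lemma mulx_zero (n c : ℕ) : mulx n 0 c = c := by cases n <;> rfl

lemma mulx_succ (n S c : ℕ) : mulx (n + 1) S c = if S = 0 then c else mulx n (32 * (S &&& c)) (S ^^^ c) := by
  change (@Bool.rec (fun _ => _) _ _ _) = _
  rw [bbeq]; rfl

lemma mulx_sound (m : ℕ) : ∀ n k S c, m < n → 32 ^ k ∣ S → S < 32 ^ (k + 1) → c < 32 ^ (k + m) →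
    mon (mulx n S c) = mon S * mon c := by
  induction m with
  | zero =>
    intro n k S c hn h1 h2 h3
    obtain ⟨n, rfl⟩ := Nat.exists_eq_succ_of_ne_zero (show n ≠ 0 by omega)
    rw [mulx_succ]; split_ifs with h
    · rw [h, mon_zero, one_mul]
    · have : S &&& c = 0 := by
        have h4 : (S &&& c) % 2 ^ (5 * k) = 0 := by
          rw [Nat.and_mod_two_pow, pow_mul, show 2 ^ 5 = 32 by rfl]
          rw [(Nat.dvd_iff_mod_eq_zero).1 h1]; simp
        rw [Nat.mod_eq_of_lt] at h4
        · exact h4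
        · rw [pow_mul]; exact lt_of_le_of_lt Nat.and_le_right h3
      rw [this, mul_zero, mulx_zero, mon_mul, this, mul_zero, mon_zero, one_mul]
  | succ m ih =>
    intro n k S c hn h1 h2 h3
    obtain ⟨n, rfl⟩ := Nat.exists_eq_succ_of_ne_zero (show n ≠ 0 by omega)
    rw [mulx_succ]; split_ifs with h
    · rw [h, mon_zero, one_mul]
    · rw [ih n (k + 1), mon_mul S c]
      · omega
      · rw [pow_succ, mul_comm]
        refine Nat.mul_dvd_mul_left _ ?_
        have h4 : (S &&& c) % 2 ^ (5 * k) = 0 := by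
          rw [Nat.and_mod_two_pow, pow_mul, show 2 ^ 5 = 32 by rfl]
          rw [(Nat.dvd_iff_mod_eq_zero).1 h1]; simp
        rw [pow_mul] at h4
        exact Nat.dvd_of_mod_eq_zero h4
      · have : S &&& c ≤ S := Nat.and_le_left
        rw [pow_succ 32 (k + 1)]; omega
      · rw [show 32 = 2 ^ 5 by rfl, ← pow_mul] at h2 h3 ⊢
        refine Nat.xor_lt_two_pow (lt_of_lt_of_le h2 (Nat.pow_le_pow_right (by norm_num) (by omega))) ?_
        convert h3 using 3; omega

lemma mulx_mon {C w : ℕ} (hC : C < 32) (hw : w < 32 ^ 7) : mon (mulx 9 C w) = xs (bs C) * mon w := by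
  rw [mulx_sound 7 9 0 C w (by norm_num) (by simp) (by simpa using hC) (by simpa using hw), mon_letter hC]

/-- sum of a list of words -/
def SS (l : List ℕ) : R5 := (l.map mon).sum

lemma SS_nil : SS [] = 0 := rfl
lemma SS_cons (a : ℕ) (l : List ℕ) : SS (a :: l) = mon a + SS l := by simp [SS]

lemma add_self2 (u : R5) : u + u = 0 := CharTwo.add_self_eq_zero u

lemma SS_insX (x : ℕ) (l : List ℕ) : SS (insX x l) = mon x + SS l := by
  induction l with
  | nil => rfl
  | cons y r ih =>
    change SS (@Bool.rec (fun _ => _) (@Bool.rec (fun _ => _) (y :: insX x r) _ _) _ _) = _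
    rw [bbeq, brec]
    split_ifs with h h2
    · rw [SS_cons, h, ← add_assoc, add_self2, zero_add]
    · rw [SS_cons]
    · rw [SS_cons, SS_cons, ih]; ring

lemma SS_mrg (a : List ℕ) : ∀ b, SS (mrg a b) = SS a + SS b := by
  induction a with
  | nil => intro b; rw [SS_nil, zero_add]; rfl
  | cons x a ih =>
    intro b
    induction b with
    | nil => rw [SS_nil, add_zero]; rfl
    | cons y b ihb =>
      change SS (@Bool.rec (fun _ => _) (@Bool.rec (fun _ => _) (y :: mrg (x :: a) b) (x :: mrg a (y :: b)) _) (mrg a b) _) = _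
      rw [bbeq, brec]
      split_ifs with h h2
      · rw [ih, SS_cons, SS_cons, h]
        linear_combination - add_self2 (mon y)
      · rw [SS_cons, ih, SS_cons x a, add_assoc]
      · rw [SS_cons, ihb, SS_cons y b]; ring

lemma SS_sq (o : ℕ) (ho : o < 32) (l acc : List ℕ) : SS (mapA o l acc) = xs (bs o) * SS l ^ 2 + SS acc := by
  induction l with
  | nil => simp [SS_nil, mapA]
  | cons a l ih =>
    change SS ((o + 32 * a) :: mapA o l acc) = _
    rw [SS_cons, SS_cons, ih, mon_cons ho, sq_add2]; ring

lemma ltC_nil (c : ℕ) : ltC [] c = false := rfl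
lemma ltC_cons (a : ℕ) (ν : List ℕ) (c : ℕ) : ltC (a :: ν) c = true ↔ pc c < a ∨ (pc c = a ∧ ltC ν (c / 32) = true) := by
  change (@Bool.rec (fun _ => _) (Nat.blt (pc c) a) (ltC ν (c / 32)) _) = true ↔ _
  rw [bbeq]
  split_ifs with h
  · simp [h]
  · rw [Nat.blt_eq]; simp [h]

lemma wtEq_nil (c : ℕ) : wtEq [] c = true ↔ c = 0 := iff_of_eq Nat.beq_eq
lemma wtEq_cons (a : ℕ) (ν : List ℕ) (c : ℕ) : wtEq (a :: ν) c = true ↔ pc c = a ∧ wtEq ν (c / 32) = true := by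
  change (@Bool.rec (fun _ => _) false (wtEq ν (c / 32)) _) = true ↔ _
  rw [bbeq]
  split_ifs with h <;> simp [h]

/-- words span -/
lemma mon_span : Submodule.span (ZMod 2) (Set.range mon) = ⊤ := by
  have hx : ∀ i : Fin 5, ∀ u ∈ Submodule.span (ZMod 2) (Set.range mon), u * X i ∈ Submodule.span (ZMod 2) (Set.range mon) := by
    intro i u hu
    induction hu using Submodule.span_induction with
    | mem x hx =>
      obtain ⟨c, rfl⟩ := hx
      have h1 : mon (2 ^ i.1) = X i := by
        rw [mon_letter]
        · have : bs (2 ^ i.1) = {i} := by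
            ext j; rw [mem_bs, Nat.testBit_two_pow]; simp [Fin.ext_iff, eq_comm]
          rw [this]; simp [xs]
        · fin_cases i <;> norm_num
      obtain ⟨m, hm⟩ : ∃ m, c < 32 ^ (0 + m) := ⟨c, by rw [zero_add]; exact Nat.lt_pow_self (by norm_num)⟩
      have := mulx_sound m (m + 1) 0 (2 ^ i.1) c (by omega) (by simp) (by fin_cases i <;> norm_num) hm
      rw [h1, mul_comm] at this
      rw [← this]; exact Submodule.subset_span ⟨_, rfl⟩
    | zero => simp
    | add x y _ _ hx hy => rw [add_mul]; exact add_mem hx hy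
    | smul a x _ hx => rw [smul_mul_assoc]; exact Submodule.smul_mem _ _ hx
  rw [eq_top_iff]
  intro u _
  induction u using MvPolynomial.induction_on with
  | C a =>
    have : (C a : R5) = a • mon 0 := by rw [mon_zero, MvPolynomial.smul_eq_C_mul, mul_one]
    rw [this]; exact Submodule.smul_mem _ _ (Submodule.subset_span ⟨_, rfl⟩)
  | add p q hp hq => exact add_mem (hp trivial) (hq trivial)
  | mul_X p i hp => exact hx i p (hp trivial)

def szf : List ℕ := sizeList.flatMap Prod.snd

lemma szf_univ : (Finset.univ : Finset (Finset (Fin 5))).val = Multiset.map bs (szf : Multiset ℕ) := by decide +kernel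

lemma szf_sum (F : Finset (Fin 5) → R5) : ∑ t, F t = (szf.map fun S => F (bs S)).sum := by
  rw [Finset.sum, szf_univ, Multiset.map_map, Multiset.map_coe, Multiset.sum_coe]; rfl

lemma bs_surj (s : Finset (Fin 5)) : ∃ o < 32, bs o = s := by
  have : s ∈ (Finset.univ : Finset (Finset (Fin 5))).val := Finset.mem_univ s
  rw [szf_univ] at this
  obtain ⟨o, ho, h⟩ := Multiset.mem_map.1 this
  refine ⟨o, ?_, h⟩
  have h2 : ∀ o ∈ szf, o < 32 := by decide +kernel
  exact h2 o ho

def Low (ν : List ℕ) : Submodule (ZMod 2) R5 := Submodule.span (ZMod 2) {u | ∃ c, ltC ν c = true ∧ u = mon c}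

lemma sqsm (a : ZMod 2) (p u : R5) : p * (a • u) ^ 2 = a • (p * u ^ 2) := by
  rw [_root_.smul_pow, z2sq, mul_smul_comm]

lemma mul_sq_add (p u v : R5) : p * (u + v) ^ 2 = p * u ^ 2 + p * v ^ 2 := by rw [sq_add2, mul_add]

lemma low_sq (s : Finset (Fin 5)) {μ : List ℕ} {u : R5} (hu : u ∈ Low μ) : xs s * u ^ 2 ∈ Low (s.card :: μ) := by
  obtain ⟨o, ho, rfl⟩ := bs_surj s
  induction hu using Submodule.span_induction with
  | mem x hx =>
    obtain ⟨c, hc, rfl⟩ := hx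
    refine Submodule.subset_span ⟨o + 32 * c, ?_, (mon_cons ho c).symm⟩
    rw [ltC_cons, ← pc_mod, show (o + 32 * c) % 32 = o by omega, show (o + 32 * c) / 32 = c by omega]
    exact Or.inr ⟨pc_eq o, hc⟩
  | zero => simp
  | add x y _ _ hx hy => rw [mul_sq_add]; exact add_mem hx hy
  | smul a x _ hx => rw [sqsm]; exact Submodule.smul_mem _ _ hx

lemma low_lt {s : Finset (Fin 5)} {a : ℕ} (h : s.card < a) (μ : List ℕ) (u : R5) : xs s * u ^ 2 ∈ Low (a :: μ) := by
  obtain ⟨o, ho, rfl⟩ := bs_surj s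
  have hu : u ∈ Submodule.span (ZMod 2) (Set.range mon) := by rw [mon_span]; trivial
  induction hu using Submodule.span_induction with
  | mem x hx =>
    obtain ⟨c, rfl⟩ := hx
    refine Submodule.subset_span ⟨o + 32 * c, ?_, (mon_cons ho c).symm⟩
    rw [ltC_cons, ← pc_mod, show (o + 32 * c) % 32 = o by omega, show (o + 32 * c) / 32 = c by omega]
    exact Or.inl (by rwa [pc_eq])
  | zero => simp
  | add x y _ _ hx hy => rw [mul_sq_add]; exact add_mem hx hy
  | smul a x _ hx => rw [sqsm]; exact Submodule.smul_mem _ _ hx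

lemma low_pow {ν : List ℕ} : ∀ {u : R5}, u ∈ Low ν → ∀ (g : R5) (μ : List ℕ), u * g ^ 2 ^ ν.length ∈ Low (ν ++ μ) := by
  induction ν with
  | nil =>
    intro u hu g μ
    have : u = 0 := by
      have h : Low [] = ⊥ := by
        rw [Low, Submodule.span_eq_bot]; rintro x ⟨c, hc, rfl⟩; simp [ltC_nil] at hc
      rwa [h] at hu
    rw [this]; simp
  | cons a ν ih =>
    intro u hu g μ
    induction hu using Submodule.span_induction with
    | mem x hx =>
      obtain ⟨c, hc, rfl⟩ := hx
      have : mon c * g ^ 2 ^ (a :: ν).length = xs (bs c) * (mon (c / 32) * g ^ 2 ^ ν.length) ^ 2 := by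
        rw [mon_rec c, List.length_cons, pow_succ 2, pow_mul]; ring
      rw [this]
      rcases (ltC_cons _ _ _).1 hc with h | ⟨h, h2⟩
      · exact low_lt (by rwa [← pc_eq]) _ _
      · have := low_sq (bs c) (ih (u := mon (c / 32)) (Submodule.subset_span ⟨_, h2, rfl⟩) g μ)
        rwa [← pc_eq, h] at this
    | zero => simp
    | add x y _ _ hx hy => rw [add_mul]; exact add_mem hx hy
    | smul a x _ hx => rw [smul_mul_assoc]; exact Submodule.smul_mem _ _ hx

def NS (b : ℕ) : Submodule (ZMod 2) R5 := Submodule.span (ZMod 2) {u | ∃ q f, 0 < q ∧ q < b ∧ u = stq q f}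

def NN (ν : List ℕ) : Submodule (ZMod 2) R5 := NS (2 ^ ν.length) ⊔ Low ν

lemma stq_lift (s : Finset (Fin 5)) (q : ℕ) (f : R5) (μ : List ℕ) :
    stq (2 * q) (xs s * f ^ 2) - xs s * stq q f ^ 2 ∈ Low (s.card :: μ) := by
  rw [stq_xs, ← Finset.add_sum_erase _ _ (Finset.empty_mem_powerset _), if_pos (by simp), xs_empty, one_mul, Finset.card_empty, Nat.sub_zero, Nat.mul_div_cancel_left _ (by norm_num),
        Finset.sdiff_empty, add_sub_cancel_left]
  refine Submodule.sum_mem _ fun t ht => ?_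
  split_ifs
  · refine low_lt ?_ _ _
    rw [Finset.mem_erase, Finset.mem_powerset] at ht
    rw [Finset.card_sdiff_of_subset ht.2]
    have h1 := Finset.card_pos.2 (Finset.nonempty_iff_ne_empty.2 ht.1)
    have h2 := Finset.card_le_card ht.2
    omega
  · exact zero_mem _

lemma NN_sq (s : Finset (Fin 5)) {μ : List ℕ} {u : R5} (hu : u ∈ NN μ) : xs s * u ^ 2 ∈ NN (s.card :: μ) := by
  obtain ⟨y, hy, z, hz, rfl⟩ := Submodule.mem_sup.1 hu
  rw [mul_sq_add]
  refine add_mem ?_ (Submodule.mem_sup_right (low_sq s hz))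
  induction hy using Submodule.span_induction with
  | mem x hx =>
    obtain ⟨q, f, h1, h2, rfl⟩ := hx
    refine (Submodule.sub_mem_iff_right _ ?_).1 (Submodule.mem_sup_right (stq_lift s q f μ))
    refine Submodule.mem_sup_left (Submodule.subset_span ⟨2 * q, _, by omega, ?_, rfl⟩)
    rw [List.length_cons, pow_succ]; omega
  | zero => simp
  | add x y _ _ hx hy =>
    rw [mul_sq_add]
    exact add_mem (hx (Submodule.mem_sup.2 ⟨x, ‹_›, z, hz, rfl⟩)) (hy (Submodule.mem_sup.2 ⟨y, ‹_›, z, hz, rfl⟩))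
  | smul a x _ hx => 
    rw [sqsm]
    exact Submodule.smul_mem _ _ (hx (Submodule.mem_sup.2 ⟨x, ‹_›, z, hz, rfl⟩))

lemma KK_sq (s : Finset (Fin 5)) {μ : List ℕ} {u : R5} (hu : u ∈ HH ⊔ Low μ) : xs s * u ^ 2 ∈ HH ⊔ Low (s.card :: μ) := by
  obtain ⟨y, hy, z, hz, rfl⟩ := Submodule.mem_sup.1 hu
  clear hu
  rw [mul_sq_add]
  refine add_mem ?_ (Submodule.mem_sup_right (low_sq s hz))
  induction hy using Submodule.span_induction with
  | mem x hx =>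
    obtain ⟨q, f, h1, rfl⟩ := hx
    refine (Submodule.sub_mem_iff_right _ ?_).1 (Submodule.mem_sup_right (stq_lift s q f μ))
    exact Submodule.mem_sup_left (stq_mem (by omega) _)
  | zero => simp
  | add x y _ _ hx hy => rw [mul_sq_add]; exact add_mem hx hy
  | smul a x _ hx => rw [sqsm]; exact Submodule.smul_mem _ _ hx

lemma NN_HH (ν : List ℕ) : NN ν ≤ HH ⊔ Low ν := by
  refine sup_le_sup_right (Submodule.span_mono ?_) _
  rintro _ ⟨q, f, h, _, rfl⟩; exact ⟨q, f, h, rfl⟩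

lemma coeff_pp (F : Polynomial R5) (L : ℕ) : ∀ j, 0 < j → j < 2 ^ L → (F ^ 2 ^ L).coeff j = 0 := by
  induction L with
  | zero => intro j h1 h2; simp at h2; omega
  | succ L ih =>
    intro j h1 h2
    rw [pow_succ, pow_mul]
    by_cases h : j % 2 = 1
    · exact sqP_odd _ _ h
    · rw [show j = 2 * (j / 2) by omega, sqP_even, ih, zero_pow (by norm_num)]
      · omega
      · rw [pow_succ] at h2; omega

lemma stq_mulpow (L q : ℕ) (hq : q < 2 ^ L) (f g : R5) : stq q (f * g ^ 2 ^ L) = stq q f * g ^ 2 ^ L := by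
  simp only [stq_def, map_mul, map_pow]
  rw [Polynomial.coeff_mul, Finset.sum_eq_single (q, 0)]
  · have h := stq_zero (g ^ 2 ^ L)
    rw [stq_def, map_pow] at h
    rw [h]
  · rintro ⟨i, j⟩ h1 h2
    rw [Finset.HasAntidiagonal.mem_antidiagonal] at h1
    simp only at h1
    rw [coeff_pp _ _ _ _ (by omega), mul_zero]
    by_contra h
    apply h2
    have : j = 0 := by omega
    subst this; simp at h1; simp [h1]
  · simp

lemma NN_pow {ν : List ℕ} {u : R5} (hu : u ∈ NN ν) (g : R5) (μ : List ℕ) : u * g ^ 2 ^ ν.length ∈ NN (ν ++ μ) := by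
  obtain ⟨y, hy, z, hz, rfl⟩ := Submodule.mem_sup.1 hu
  clear hu
  rw [add_mul]
  refine add_mem (Submodule.mem_sup_left ?_) (Submodule.mem_sup_right (low_pow hz g μ))
  induction hy using Submodule.span_induction with
  | mem x hx =>
    obtain ⟨q, f, h1, h2, rfl⟩ := hx
    refine Submodule.subset_span ⟨q, _, h1, lt_of_lt_of_le h2 ?_, (stq_mulpow _ q h2 f g).symm⟩
    exact Nat.pow_le_pow_right (by norm_num) (by simp)
  | zero => simp
  | add x y _ _ hx hy => rw [add_mul]; exact add_mem hx hy
  | smul a x _ hx => rw [smul_mul_assoc]; exact Submodule.smul_mem _ _ hx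

/-- summand of `x_C Sq^q (mon w)` -/
def sumd (w q C S : ℕ) : R5 := if bs S ⊆ bs w ∧ (bs S).card ≤ q ∧ (q - (bs S).card) % 2 = 0 then
  xs (bs C) * (xs (bs w \ bs S) * (xs (bs S) * stq ((q - (bs S).card) / 2) (mon (w / 32))) ^ 2) else 0

lemma sumd_sum (w q C : ℕ) : xs (bs C) * stq q (mon w) = (szf.map (sumd w q C)).sum := by
  have h : (bs w).powerset = Finset.univ.filter fun t => t ⊆ bs w := by ext t; simp
  refine Eq.trans ?_ (szf_sum fun t : Finset (Fin 5) => if t ⊆ bs w ∧ t.card ≤ q ∧ (q - t.card) % 2 = 0 then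
    xs (bs C) * (xs (bs w \ t) * (xs t * stq ((q - t.card) / 2) (mon (w / 32))) ^ 2) else 0)
  rw [mon_rec w, stq_xs, Finset.mul_sum, h, Finset.sum_filter]
  refine Finset.sum_congr rfl fun t _ => ?_
  by_cases h1 : t ⊆ bs w <;> simp [h1, mul_ite]

lemma bs_inj {I J : ℕ} (hI : I < 32) (hJ : J < 32) (h : bs I = bs J) : I = J := by
  have : ∀ I < 32, ∀ J < 32, bs I = bs J → I = J := by decide +kernel
  exact this I hI J hJ h

lemma bs_sub {S w : ℕ} (hS : S < 32) : S &&& (w % 32) = S ↔ bs S ⊆ bs w := by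
  rw [← Finset.inter_eq_left]
  constructor
  · intro h
    have := bs_and S (w % 32)
    rw [h, bs_mod] at this; exact this.symm
  · intro h
    refine bs_inj (lt_of_le_of_lt Nat.and_le_left hS) hS ?_
    rw [bs_and, bs_mod, h]

def stepS (f : List ℕ → ℕ → ℕ → ℕ → List ℕ) (ν : List ℕ) (w q C p S : ℕ) (acc2 : List ℕ) : List ℕ :=
          iF Nat.beq (Nat.land S (Nat.mod w 32)) S thN
            frc (Nat.xor (Nat.xor (Nat.mod w 32) S) C) fun o =>
            frc (Nat.lor S (Nat.land (Nat.mod w 32) C)) fun C' =>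
            frc (Nat.div (Nat.sub q p) 2) fun q' =>
            frc (Nat.div w 32) fun w' =>
            List.rec (mapA o (f [] w' q' C') acc2)
              (fun a μ _ => iF Nat.ble a (pc o) thN 
                iF Nat.beq a (pc o) thN mapA o (f μ w' q' C') acc2 elS mapA o (f [] w' q' C') acc2
                elS acc2) ν
          elS acc2

lemma sqG_succ (n : ℕ) (ν : List ℕ) (w q C : ℕ) : sqG (n + 1) ν w q C = iF Nat.beq q 0 thN (iF ltC ν (mulx 9 C w) thN [] elS [mulx 9 C w]) elS
  iF Nat.beq w 0 thN [] elS
  List.rec [] (fun p _ acc =>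
    iF Nat.ble p.1 q thN 
      iF Nat.beq (Nat.mod (Nat.sub q p.1) 2) 0 thN
        List.rec acc (fun S _ acc2 => stepS (sqG n) ν w q C p.1 S acc2) p.2
      elS acc
    elS acc) sizeList := rfl

lemma low_nil {u : R5} (h : u ∈ Low []) : u = 0 := by
  have h' : Low [] = ⊥ := by
    rw [Low, Submodule.span_eq_bot]; rintro x ⟨c, hc, rfl⟩; simp [ltC_nil] at hc
  rwa [h'] at h

lemma xs_disj {s t : Finset (Fin 5)} (h : Disjoint s t) : xs s * xs t = xs (s ∪ t) := by
  rw [xs, xs, xs, Finset.prod_union h]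

lemma stepS_sound (f : List ℕ → ℕ → ℕ → ℕ → List ℕ) (ν : List ℕ) (w q C S : ℕ) (acc : List ℕ)
    (hC : C < 32) (hS : S < 32) (h1 : (bs S).card ≤ q) (h2 : (q - (bs S).card) % 2 = 0)
    (hf : ∀ μ q' C', C' < 32 → xs (bs C') * stq q' (mon (w / 32)) + SS (f μ (w / 32) q' C') ∈ Low μ) :
    sumd w q C S + SS (stepS f ν w q C (bs S).card S acc) + SS acc ∈ Low ν := by
  have e0 : stepS f ν w q C (bs S).card S acc = if S &&& (w % 32) = S then
      List.rec (mapA ((w % 32) ^^^ S ^^^ C) (f [] (w / 32) ((q - (bs S).card) / 2) (S ||| ((w % 32) &&& C))) acc)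
              (fun a μ _ => if a ≤ pc ((w % 32) ^^^ S ^^^ C) then
                if a = pc ((w % 32) ^^^ S ^^^ C) then mapA ((w % 32) ^^^ S ^^^ C) (f μ (w / 32) ((q - (bs S).card) / 2) (S ||| ((w % 32) &&& C))) acc
                 else mapA ((w % 32) ^^^ S ^^^ C) (f [] (w / 32) ((q - (bs S).card) / 2) (S ||| ((w % 32) &&& C))) acc
                else acc) ν else acc := by
    simp only [stepS, frc_eq, bbeq, bble]; rfl
  rw [e0]
  by_cases hs : bs S ⊆ bs w
  · rw [if_pos ((bs_sub hS).2 hs), sumd, if_pos ⟨hs, h1, h2⟩]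
    have hw : w % 32 < 2 ^ 5 := Nat.mod_lt _ (by norm_num)
    have ho : (w % 32) ^^^ S ^^^ C < 32 := Nat.xor_lt_two_pow (n := 5) (Nat.xor_lt_two_pow hw hS) hC
    have hC' : S ||| ((w % 32) &&& C) < 32 := Nat.or_lt_two_pow (n := 5) hS (lt_of_le_of_lt Nat.and_le_right hC)
    have hbo : bs ((w % 32) ^^^ S ^^^ C) = symmDiff (bs C) (bs w \ bs S) := by
      rw [bs_xor, bs_xor, bs_mod, symmDiff_comm]; congr 1
      rw [symmDiff_of_ge hs]
    have hbC : bs (S ||| ((w % 32) &&& C)) = (bs C ∩ (bs w \ bs S)) ∪ bs S := by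
      rw [bs_or, bs_and, bs_mod]; ext i; simp only [Finset.mem_union, Finset.mem_inter, Finset.mem_sdiff]; tauto
    generalize (w % 32) ^^^ S ^^^ C = o at *
    generalize S ||| ((w % 32) &&& C) = C' at *
    generalize (q - (bs S).card) / 2 = q' at *
    have key : xs (bs C) * (xs (bs w \ bs S) * (xs (bs S) * stq q' (mon (w / 32))) ^ 2) =
        xs (bs o) * (xs (bs C') * stq q' (mon (w / 32))) ^ 2 := by
      rw [← mul_assoc, xs_mul, ← hbo, mul_assoc, ← mul_pow, ← mul_assoc (xs _) (xs (bs S)), xs_disj, ← hbC]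
      rw [Finset.disjoint_left]; intro i; simp only [Finset.mem_inter, Finset.mem_sdiff]; tauto
    rw [key]
    have red : ∀ l, xs (bs o) * (xs (bs C') * stq q' (mon (w / 32))) ^ 2 + SS (mapA o l acc) + SS acc =
        xs (bs o) * (xs (bs C') * stq q' (mon (w / 32)) + SS l) ^ 2 := by
      intro l
      rw [SS_sq o ho, mul_sq_add]
      linear_combination add_self2 (SS acc)
    have h0 : xs (bs C') * stq q' (mon (w / 32)) + SS (f [] (w / 32) q' C') = 0 := low_nil (hf [] q' C' hC')
    cases ν with
    | nil => 
      change _ + SS (mapA o (f [] (w / 32) q' C') acc) + _ ∈ _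
      rw [red, h0]; simp
    | cons a μ =>
      change _ + SS (if a ≤ pc o then if a = pc o then mapA o (f μ (w / 32) q' C') acc else mapA o (f [] (w / 32) q' C') acc else acc) + _ ∈ _
      split_ifs with h3 h4
      · rw [red]
        have := low_sq (bs o) (hf μ q' C' hC')
        rwa [← pc_eq, ← h4] at this
      · rw [red, h0]; simp
      · rw [add_assoc, add_self2, add_zero]
        exact low_lt (by rw [← pc_eq]; omega) _ _
  · rw [if_neg (by rwa [bs_sub hS]), sumd, if_neg (by tauto), zero_add, add_self2]; exact zero_mem _

lemma size_ok : ∀ p ∈ sizeList, ∀ S ∈ p.2, S < 32 ∧ (bs S).card = p.1 := by decide +kernel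

lemma sqG_sound (n : ℕ) : ∀ ν w q C, w < 32 ^ n → n ≤ 7 → C < 32 → xs (bs C) * stq q (mon w) + SS (sqG (n + 1) ν w q C) ∈ Low ν := by
  induction n with
  | zero =>
    intro ν w q C hw _ hC
    have hw0 : w = 0 := by simpa using hw
    subst hw0
    rw [sqG_succ]; simp only [bbeq, if_true]
    split_ifs with h
    · subst h
      rw [stq_zero]
      rw [brec]; split_ifs with h
      · rw [SS_nil, add_zero, ← mulx_mon hC (by norm_num)]
        exact Submodule.subset_span ⟨_, h, rfl⟩
      · rw [SS_cons, SS_nil, add_zero, mulx_mon hC (by norm_num), add_self2]; exact zero_mem _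
    · have h1 : stq q (mon 0) = 0 := by
        rw [mon_zero, stq_def, map_one, Polynomial.coeff_one, if_neg h]
      rw [h1, SS_nil]; simp
  | succ n ih =>
    intro ν w q C hw hn hC
    rw [sqG_succ]; simp only [bbeq, bble]
    have hw7 : w < 32 ^ 7 := lt_of_lt_of_le hw (Nat.pow_le_pow_right (by norm_num) hn)
    split_ifs with h h'
    · subst h
      rw [stq_zero]
      rw [brec]; split_ifs with h
      · rw [SS_nil, add_zero, ← mulx_mon hC hw7]
        exact Submodule.subset_span ⟨_, h, rfl⟩
      · rw [SS_cons, SS_nil, add_zero, mulx_mon hC hw7, add_self2]; exact zero_mem _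
    · subst h'
      have h1 : stq q (mon 0) = 0 := by
        rw [mon_zero, stq_def, map_one, Polynomial.coeff_one, if_neg h]
      rw [h1, SS_nil]; simp
    · rw [sumd_sum, szf]
      have hf : ∀ μ q' C', C' < 32 → xs (bs C') * stq q' (mon (w / 32)) + SS (sqG (n + 1) μ (w / 32) q' C') ∈ Low μ :=
        fun μ q' C' h => ih μ _ q' C' (by rw [pow_succ] at hw; omega) (by omega) h
      have hok := size_ok
      generalize sizeList = sl at *
      induction sl with
      | nil => simp [SS_nil]
      | cons p sl ihl =>
        have ih2 := ihl fun p hp => hok p (List.mem_cons_of_mem _ hp)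
        have hp := hok p List.mem_cons_self
        simp only [List.flatMap_cons, List.map_append, List.sum_append]
        generalize List.rec (motive := fun _ => List ℕ) [] _ sl = acc at *
        have hz : (∀ S ∈ p.2, sumd w q C S = 0) → (p.2.map (sumd w q C)).sum = 0 := fun h =>
          List.sum_eq_zero (by simpa using h)
        split_ifs with h3 h4
        · have : ∀ l : List ℕ, (∀ S ∈ l, S < 32 ∧ (bs S).card = p.1) → 
              (l.map (sumd w q C)).sum + SS (List.rec (motive := fun _ => List ℕ) acc (fun S _ acc2 => stepS (sqG (n + 1)) ν w q C p.1 S acc2) l) + SS acc ∈ Low ν := by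
            intro l hl
            induction l with
            | nil => simp [add_self2]
            | cons S l ihh =>
              have h5 := ihh fun S hS => hl S (List.mem_cons_of_mem _ hS)
              obtain ⟨h6, h7⟩ := hl S List.mem_cons_self
              have h8 := stepS_sound (sqG (n + 1)) ν w q C S (List.rec (motive := fun _ => List ℕ) acc (fun S _ acc2 => stepS (sqG (n + 1)) ν w q C p.1 S acc2) l)
                hC h6 (by rw [h7]; exact h3) (by rw [h7]; exact h4) hf
              rw [h7] at h8
              convert add_mem h8 h5 using 1
              simp only [List.map_cons, List.sum_cons]
              linear_combination - add_self2 (SS (List.rec (motive := fun _ => List ℕ) acc (fun S _ acc2 => stepS (sqG (n + 1)) ν w q C p.1 S acc2) l))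
          convert add_mem (this p.2 hp) ih2 using 1
          linear_combination - add_self2 (SS acc)
        · rw [hz, zero_add]
          · exact ih2
          · intro S hS; rw [sumd, if_neg]; rw [(hp S hS).2]; exact fun hh => h4 hh.2.2
        · rw [hz, zero_add]
          · exact ih2
          · intro S hS; rw [sumd, if_neg]; rw [(hp S hS).2]; exact fun hh => h3 hh.2.1

/-- a valid rewriting of `d` -/
def TT (μ : List ℕ) (d : ℕ) (t : List ℕ) : Prop :=
  mon d + SS (t.map fun a => d - a) ∈ NN μ ∧ ∀ a ∈ t, 0 < a ∧ a ≤ d ∧ wtEq μ (d - a) = true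

def GoodL (M k : ℕ) (t : List ℕ) : Prop := ∃ ν : List ℕ, (∀ a ∈ ν, 0 < a) ∧ M = 32 ^ ν.length ∧ wtEq ν k = true ∧ TT ν k t

def GoodT : Tr → Prop
  | .e => True
  | .lf M k t => GoodL M k t
  | .n _ a b => GoodT a ∧ GoodT b

lemma get_lf (M k : ℕ) (t : List ℕ) (c : ℕ) : (Tr.lf M k t).get c = if c % M = k then some t else none := by
  change (@Bool.rec (fun _ => _) _ _ _) = _
  rw [bbeq]; rfl

lemma get_n (m : ℕ) (a b : Tr) (c : ℕ) : (Tr.n m a b).get c = if c &&& m = 0 then a.get c else b.get c := by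
  change (@Bool.rec (fun _ => _) _ _ _) = _
  rw [bbeq]; rfl

lemma get_GT {D : Tr} (hD : GoodT D) {c : ℕ} {t : List ℕ} (h : D.get c = some t) : ∃ M k, GoodL M k t ∧ c % M = k := by
  induction D with
  | e => exact absurd h (by intro h; cases h)
  | lf M k t' =>
    rw [get_lf] at h
    split_ifs at h with h1
    cases h; exact ⟨M, k, hD, h1⟩
  | n m a b iha ihb =>
    rw [get_n] at h
    split_ifs at h
    · exact iha hD.1 h
    · exact ihb hD.2 h

lemma wt_pre {ν : List ℕ} (hν : ∀ a ∈ ν, 0 < a) : ∀ {μ d}, wtEq μ d = true → wtEq ν (d % 32 ^ ν.length) = true →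
    ∃ ρ, μ = ν ++ ρ ∧ wtEq ρ (d / 32 ^ ν.length) = true := by
  induction ν with
  | nil => intro μ d h1 _; exact ⟨μ, rfl, by simpa using h1⟩
  | cons a ν ih =>
    intro μ d h1 h2
    rw [wtEq_cons, List.length_cons, pow_succ, ← pc_mod, mul_comm, Nat.mod_mul_right_mod, pc_mod, Nat.mod_mul_right_div_self] at h2
    cases μ with
    | nil =>
      rw [wtEq_nil] at h1
      have := hν a List.mem_cons_self
      rw [h1] at h2
      exact absurd h2.1 (by rw [show pc 0 = 0 by rfl]; omega)
    | cons b μ =>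
      rw [wtEq_cons] at h1
      obtain ⟨ρ, h3, h4⟩ := ih (fun x hx => hν x (List.mem_cons_of_mem _ hx)) h1.2 h2.2
      refine ⟨ρ, ?_, ?_⟩
      · rw [← h1.1, h2.1, h3]; rfl
      · rw [List.length_cons, pow_succ, mul_comm, ← Nat.div_div_eq_div_mul]; exact h4

lemma mon_app (L : ℕ) : ∀ k g, k < 32 ^ L → mon (k + 32 ^ L * g) = mon k * mon g ^ 2 ^ L := by
  induction L with
  | zero => intro k g h; simp at h; subst h; simp [mon_zero]
  | succ L ih =>
    intro k g h
    rw [mon_rec, mon_rec k, ← bs_mod, pow_succ]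
    have h1 : (k + 32 ^ L * 32 * g) / 32 = k / 32 + 32 ^ L * g := by
      rw [mul_right_comm, mul_comm _ 32, Nat.add_mul_div_left _ _ (by norm_num)]
    have h2 : (k + 32 ^ L * 32 * g) % 32 = k % 32 := by
      rw [mul_right_comm, mul_comm _ 32, Nat.add_mul_mod_self_left]
    rw [h1, h2, bs_mod, ih _ _ (by rw [pow_succ] at h; omega), pow_succ 2, pow_mul]; ring

lemma wt_lt {ν : List ℕ} : ∀ {c}, wtEq ν c = true → c < 32 ^ ν.length := by
  induction ν with
  | nil => intro c h; rw [wtEq_nil] at h; simp [h]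
  | cons a ν ih =>
    intro c h
    have := ih ((wtEq_cons _ _ _).1 h).2
    rw [List.length_cons, pow_succ]; omega

lemma wt_app {ν ρ : List ℕ} : ∀ {k g}, wtEq ν k = true → wtEq ρ g = true → wtEq (ν ++ ρ) (k + 32 ^ ν.length * g) = true := by
  induction ν with
  | nil => intro k g h h2; rw [wtEq_nil] at h; simpa [h] using h2
  | cons a ν ih =>
    intro k g h h2
    rw [wtEq_cons] at h
    rw [List.cons_append, wtEq_cons, List.length_cons, pow_succ, mul_right_comm, mul_comm _ 32]
    rw [← pc_mod, Nat.add_mul_mod_self_left, pc_mod, Nat.add_mul_div_left _ _ (by norm_num)]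
    exact ⟨h.1, ih h.2 h2⟩

lemma SS_map_mul (t : List ℕ) (F G : ℕ → ℕ) (z : R5) (h : ∀ a ∈ t, mon (F a) = mon (G a) * z) :
    SS (t.map F) = SS (t.map G) * z := by
  induction t with
  | nil => simp [SS_nil]
  | cons a t ih =>
    rw [List.map_cons, List.map_cons, SS_cons, SS_cons, add_mul, h a List.mem_cons_self, ih fun b hb => h b (List.mem_cons_of_mem _ hb)]

lemma GT_TT {D : Tr} (hD : GoodT D) {μ : List ℕ} {d : ℕ} {t : List ℕ} (hd : wtEq μ d = true) (h : D.get d = some t) : TT μ d t := by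
  obtain ⟨M, k, ⟨ν, h1, rfl, h3, h4, h5⟩, h6⟩ := get_GT hD h
  obtain ⟨ρ, rfl, h8⟩ := wt_pre h1 hd (by rw [h6]; exact h3)
  have hk := wt_lt h3
  have hdk : d = k + 32 ^ ν.length * (d / 32 ^ ν.length) := by rw [← h6, Nat.mod_add_div]
  generalize d / 32 ^ ν.length = g at *
  have hda : ∀ a ∈ t, d - a = (k - a) + 32 ^ ν.length * g := fun a ha => by have := (h5 a ha).2.1; omega
  refine ⟨?_, fun a ha => ⟨(h5 a ha).1, by have := (h5 a ha).2.1; omega, ?_⟩⟩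
  · rw [SS_map_mul t (fun a => d - a) (fun a => k - a) (mon g ^ 2 ^ ν.length), hdk, mon_app _ _ _ hk, ← add_mul]
    · exact NN_pow h4 _ _
    · intro a ha
      rw [hda a ha, mon_app _ _ _ (by omega)]
  · rw [hda a ha]; exact wt_app (h5 a ha).2.2 h8

lemma TT_shift {b : ℕ} {μ : List ℕ} {c : ℕ} {t : List ℕ} (hc : wtEq (b :: μ) c = true) (h : TT μ (c / 32) t) :
    TT (b :: μ) c (t.map (32 * ·)) := by
  rw [wtEq_cons] at hc
  have hda : ∀ a ∈ t, c - 32 * a = c % 32 + 32 * (c / 32 - a) := fun a ha => by have := (h.2 a ha).2.1; omega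
  constructor
  · have := NN_sq (bs c) h.1
    rw [← pc_eq, hc.1] at this
    convert this using 1
    rw [mul_sq_add, ← mon_rec]
    congr 1
    rw [List.map_map]
    have h2 := fun a ha => (h.2 a ha).2.1
    clear h this
    induction t with
    | nil => simp [SS_nil]
    | cons a t ih =>
      rw [List.map_cons, SS_cons, ih (fun a ha => hda a (List.mem_cons_of_mem _ ha)) (fun a ha => h2 a (List.mem_cons_of_mem _ ha)),
        List.map_cons, SS_cons, mul_sq_add, Function.comp, hda a List.mem_cons_self, mon_cons (Nat.mod_lt _ (by norm_num)), bs_mod]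
  · intro a' ha'
    obtain ⟨a, ha, rfl⟩ := List.mem_map.1 ha'
    obtain ⟨h1, h2, h3⟩ := h.2 a ha
    refine ⟨by omega, by omega, ?_⟩
    rw [hda a ha, wtEq_cons, ← pc_mod, show (c % 32 + 32 * (c / 32 - a)) % 32 = c % 32 by omega, pc_mod,
      show (c % 32 + 32 * (c / 32 - a)) / 32 = c / 32 - a by omega]
    exact ⟨hc.1, h3⟩

def InvR (ν : List ℕ) (c d s : ℕ) : Prop := ∃ μ, wtEq μ d = true ∧ ∀ t, TT μ d t → TT ν c (t.map (· * s))

lemma InvR_init {ν : List ℕ} {c : ℕ} (h : wtEq ν c = true) : InvR ν c c 1 := ⟨ν, h, fun t ht => by simpa using ht⟩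

lemma InvR_step {ν : List ℕ} {c d s : ℕ} (h : InvR ν c d s) : InvR ν c (d / 32) (32 * s) := by
  obtain ⟨μ, h1, h2⟩ := h
  cases μ with
  | nil =>
    rw [wtEq_nil] at h1; subst h1
    refine ⟨[], by simp [wtEq_nil], fun t ht => ?_⟩
    have : t = [] := by
      cases t with
      | nil => rfl
      | cons a t => have := ht.2 a List.mem_cons_self; omega
    subst this; exact h2 [] ht
  | cons b μ =>
    refine ⟨μ, ((wtEq_cons _ _ _).1 h1).2, fun t ht => ?_⟩
    have := h2 _ (TT_shift h1 ht)
    rw [List.map_map] at this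
    convert this using 2
    ext a; simp only [Function.comp]; ring

lemma mapS_eq (c s : ℕ) (l : List ℕ) : mapS c s l = l.map fun a => c - a * s := by
  induction l with
  | nil => rfl
  | cons a l ih => change (c - a * s) :: mapS c s l = _; rw [ih]; rfl

lemma rwK_sound {β : Type} {D : Tr} (hD : GoodT D) (ν : List ℕ) (c : ℕ) (kn : β) (ks : List ℕ → β) (P : β → Prop) (hn : P kn)
    (hs : ∀ t, TT ν c t → P (ks (t.map fun a => c - a))) (n : ℕ) : ∀ d s, InvR ν c d s → P (rwK D n c kn ks d s) := by
  induction n with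
  | zero => intro d s _; exact hn
  | succ n ih =>
    intro d s hi
    have : rwK D (n + 1) c kn ks d s = frc d fun d => Option.rec (rwK D n c kn ks (Nat.div d 32) (Nat.mul 32 s)) (fun t => ks (mapS c s t)) (D.get d) := rfl
    rw [this, frc_eq]
    cases hg : D.get d with
    | none => exact ih _ _ (InvR_step hi)
    | some t =>
      obtain ⟨μ, h1, h2⟩ := hi
      have := hs _ (h2 t (GT_TT hD h1 hg))
      rw [List.map_map] at this
      change P (ks (mapS c s t))
      rw [mapS_eq]; exact this

lemma mrg_all (Q : ℕ → Prop) (a : List ℕ) : ∀ b, (∀ x ∈ a, Q x) → (∀ x ∈ b, Q x) → ∀ x ∈ mrg a b, Q x := by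
  induction a with
  | nil => intro b _ h; exact h
  | cons x a ih =>
    intro b h1 h2
    induction b with
    | nil => exact h1
    | cons y b ihb =>
      change ∀ z ∈ (@Bool.rec (fun _ => _) (@Bool.rec (fun _ => _) (y :: mrg (x :: a) b) (x :: mrg a (y :: b)) _) (mrg a b) _), Q z
      rw [bbeq, brec]
      rw [List.forall_mem_cons] at h1 h2
      split_ifs with h
      · exact ih b h1.2 h2.2
      · rw [List.forall_mem_cons]; exact ⟨h1.1, ih _ h1.2 (by rw [List.forall_mem_cons]; exact h2)⟩
      · rw [List.forall_mem_cons]; exact ⟨h2.1, ihb h2.2⟩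

lemma redL_sound {D : Tr} (hD : GoodT D) (ν : List ℕ) (L : ℕ) (n : ℕ) : ∀ p, (∀ c ∈ p, wtEq ν c = true) →
    (∀ c ∈ redL D L n p, wtEq ν c = true) ∧ SS (redL D L n p) + SS p ∈ NN ν := by
  induction n with
  | zero => intro p hp; refine ⟨hp, ?_⟩; change SS p + SS p ∈ _; rw [add_self2]; exact zero_mem _
  | succ n ih =>
    intro p hp
    cases p with
    | nil => refine ⟨hp, ?_⟩; change SS [] + SS [] ∈ _; rw [add_self2]; exact zero_mem _
    | cons c r =>
      have : redL D L (n + 1) (c :: r) = frc c fun c => rwK D L c (c :: r) (fun t => redL D L n (mrg r t)) c 1 := rfl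
      rw [this, frc_eq]
      have hp' := List.forall_mem_cons.1 hp
      refine rwK_sound hD ν c (c :: r) (fun t => redL D L n (mrg r t)) 
        (fun l => (∀ c ∈ l, wtEq ν c = true) ∧ SS l + SS (c :: r) ∈ NN ν) ⟨hp, ?_⟩ ?_ L c 1 (InvR_init hp'.1)
      · rw [add_self2]; exact zero_mem _
      · intro t ht
        obtain ⟨h1, h2⟩ := ih (mrg r (t.map fun a => c - a)) (mrg_all _ _ _ hp'.2 fun x hx => by
          obtain ⟨a, ha, rfl⟩ := List.mem_map.1 hx
          exact (ht.2 a ha).2.2)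
        refine ⟨h1, ?_⟩
        rw [SS_mrg] at h2
        convert add_mem h2 ht.1 using 1
        rw [SS_cons]
        linear_combination - add_self2 (SS (t.map fun a => c - a))

lemma expd_sound (ν : List ℕ) (its : List ℕ) : SS (expd ν its) ∈ NN ν := by
  induction its with
  | nil => exact zero_mem _
  | cons N its ih =>
    have : expd ν (N :: its) = iF Nat.beq (Nat.mod N 32) 0 thN expd ν its elS 
      iF Nat.blt (Nat.mod N 32) (Nat.pow 2 ν.length) thN iF Nat.blt (Nat.div N 32) (Nat.pow 32 7) thN
      List.rec (expd ν its) (fun x _ ih => insX x ih) (sqG 8 ν (Nat.div N 32) (Nat.mod N 32) 0)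
      elS expd ν its elS expd ν its := rfl
    rw [this, bbeq, bblt, bblt]
    split_ifs with h1 h2 h3
    · exact ih
    · have hl : ∀ l acc : List ℕ, SS (List.rec (motive := fun _ => List ℕ) acc (fun x _ ih => insX x ih) l) = SS l + SS acc := by
        intro l acc
        induction l with
        | nil => simp [SS_nil]
        | cons a l ihl => change SS (insX a _) = _; rw [SS_insX, ihl, SS_cons, add_assoc]
      rw [hl]
      refine add_mem ?_ ih
      have h4 := sqG_sound 7 ν (N / 32) (N % 32) 0 h3 le_rfl (by norm_num)
      rw [bs_zero, xs_empty, one_mul] at h4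
      refine (Submodule.add_mem_iff_right _ ?_).1 (Submodule.mem_sup_right h4)
      exact Submodule.mem_sup_left (Submodule.subset_span ⟨_, _, Nat.pos_of_ne_zero h1, h2, rfl⟩)
    · exact ih
    · exact ih

lemma chW_sound {β : Type} (p : ℕ → Bool) (kf : β) (P : β → Prop) (hf : P kf) (l : List ℕ) : ∀ k : List ℕ → β,
    ((∀ c ∈ l, p c = true) → P (k l)) → P (chW p kf l k) := by
  induction l with
  | nil => intro k h; exact h (by simp)
  | cons c l ih =>
    intro k h
    have : chW p kf (c :: l) k = frc c fun c => iF p c thN chW p kf l (fun r => k (c :: r)) elS kf := rfl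
    rw [this, frc_eq, brec]
    split_ifs with h1
    · exact ih _ fun h2 => h (by rw [List.forall_mem_cons]; exact ⟨h1, h2⟩)
    · exact hf

lemma tlK_sound {β : Type} (c : ℕ) (kf : β) (P : β → Prop) (hf : P kf) (l : List ℕ) : ∀ k : List ℕ → β,
    ((∀ u ∈ l, u < c) → P (k (l.map fun u => c - u))) → P (tlK c kf l k) := by
  induction l with
  | nil => intro k h; exact h (by simp)
  | cons u l ih =>
    intro k h
    have : tlK c kf (u :: l) k = frc u fun u => iF Nat.blt u c thN tlK c kf l (fun r => frc (Nat.sub c u) fun d => k (d :: r)) elS kf := rfl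
    rw [this, frc_eq, bblt]
    simp only [frc_eq]
    split_ifs with h1
    · exact ih _ fun h2 => h (by rw [List.forall_mem_cons]; exact ⟨h1, h2⟩)
    · exact hf

lemma mkN_GT (m c : ℕ) {l D : Tr} (hl : GoodT l) (hD : GoodT D) : GoodT (mkN m c l D) := by
  rw [mkN, brec]; split_ifs
  · exact ⟨hl, hD⟩
  · exact ⟨hD, hl⟩

lemma insK_sound {β : Type} (c m : ℕ) {l : Tr} (hl : GoodT l) (P : β → Prop) (D : Tr) : ∀ k : Tr → β, GoodT D → (∀ D', GoodT D' → P (k D')) → P (Tr.insK c m l D k) := by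
  induction D with
  | e => intro k _ h; exact h l hl
  | lf M c' t =>
    intro k hD h
    change P (@Bool.rec (fun _ => _) _ _ _)
    rw [bbeq]; split_ifs
    · exact h _ hl
    · exact h _ (mkN_GT _ _ hl hD)
  | n m' a b iha ihb =>
    intro k hD h
    have : Tr.insK c m l (.n m' a b) k = iF Nat.blt m m' thN k (mkN m c l (.n m' a b)) elS
      iF Nat.beq (Nat.land c m') 0 thN Tr.insK c m l a (fun a' => k (.n m' a' b)) elS Tr.insK c m l b (fun b' => k (.n m' a b')) := rfl
    rw [this, bblt, bbeq]
    split_ifs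
    · exact h _ (mkN_GT _ _ hl hD)
    · exact iha _ hD.1 fun a' ha => h _ ⟨ha, hD.2⟩
    · exact ihb _ hD.2 fun b' hb => h _ ⟨hD.1, hb⟩

lemma addR_sound {β : Type} {ν : List ℕ} (hν : ∀ a ∈ ν, 0 < a) {D : Tr} (hD : GoodT D) (its : List ℕ) (P : β → Prop) (k : Tr → β)
    (hk : ∀ D', GoodT D' → P (k D')) : P (addR ν D its k) := by
  refine chW_sound _ _ P (hk D hD) _ _ fun h1 => ?_
  obtain ⟨h2, h3⟩ := redL_sound hD ν ν.length 100000 (expd ν its) h1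
  have h4 := (Submodule.add_mem_iff_left _ (expd_sound ν its)).1 h3
  generalize redL D ν.length 100000 (expd ν its) = l at *
  cases l with
  | nil => exact hk D hD
  | cons c t =>
    change P (frc c fun c => _)
    rw [frc_eq]
    refine tlK_sound c _ P (hk D hD) t _ fun h5 => ?_
    rw [frc_eq, frc_eq]
    refine insK_sound _ _ ?_ P D _ hD hk
    rw [List.forall_mem_cons] at h2
    refine ⟨ν, hν, rfl, h2.1, ?_, ?_⟩
    · rw [SS_cons] at h4
      convert h4 using 3
      rw [List.map_map]
      conv_rhs => rw [← List.map_id t]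
      refine List.map_congr_left fun u hu => ?_
      have := h5 u hu
      simp only [Function.comp, id]; omega
    · intro a ha
      obtain ⟨u, hu, rfl⟩ := List.mem_map.1 ha
      have := h5 u hu
      refine ⟨by omega, by omega, ?_⟩
      rw [show c - (c - u) = u by omega]; exact h2.2 u hu

lemma allL_iff {α : Type} (p : α → Bool) (l : List α) : allL p l = true ↔ ∀ a ∈ l, p a = true := by
  induction l with
  | nil => simp [allL]
  | cons a l ih =>
    have : allL p (a :: l) = iF p a thN allL p l elS false := rfl
    rw [this, brec, List.forall_mem_cons]
    split_ifs with h
    · rw [ih]; simp [h]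
    · simp [h]

lemma addG_sound {β : Type} {ν : List ℕ} (hν : ∀ a ∈ ν, 0 < a) (P : β → Prop) (rs : List (List ℕ)) : ∀ (D : Tr) (k : Tr → β), GoodT D →
    (∀ D', GoodT D' → P (k D')) → P (addG ν rs D k) := by
  induction rs with
  | nil => intro D k hD hk; exact hk D hD
  | cons r rs ih => intro D k hD hk; exact addR_sound hν hD r P _ fun D' h' => ih D' k h' hk

lemma build_sound {β : Type} (P : β → Prop) (gs : List (List ℕ × List (List ℕ))) : ∀ (D : Tr) (k : Tr → β), GoodT D →
    (∀ D', GoodT D' → P (k D')) → P (build gs D k) := by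
  induction gs with
  | nil => intro D k hD hk; exact hk D hD
  | cons g gs ih =>
    intro D k hD hk
    have : build (g :: gs) D k = iF allL (Nat.blt 0) g.1 thN addG g.1 g.2 D (fun D => build gs D k) elS build gs D k := rfl
    rw [this, brec]
    split_ifs with h
    · rw [allL_iff] at h
      exact addG_sound (fun a ha => by have := h a ha; rwa [Nat.blt_eq] at this) P _ D _ hD fun D' h' => ih D' k h' hk
    · exact ih D k hD hk

lemma exD : ∃ D, GoodT D ∧ ckAll D lbData = true := by
  by_contra h
  have := build_sound (fun b : Bool => b = false) rulesData Tr.e (fun D => ckAll D lbData) trivial fun D' h' => by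
    by_contra h2
    exact h ⟨D', h', by simpa using h2⟩
  rw [ckB] at this; cases this

def wt (c : ℕ) : List ℕ := if c = 0 then [] else pc c :: wt (c / 32)
termination_by c
decreasing_by omega

lemma wt_zero : wt 0 = [] := by rw [wt]; simp
lemma wt_rec {c : ℕ} (h : c ≠ 0) : wt c = pc c :: wt (c / 32) := by rw [wt, if_neg h]

def wd : List ℕ → ℕ
  | [] => 0
  | a :: ν => a + 2 * wd ν

lemma wt_eq (c : ℕ) : wtEq (wt c) c = true := by
  induction c using Nat.strong_induction_on with
  | _ c ih =>
    by_cases h : c = 0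
    · subst h; rw [wt_zero, wtEq_nil]
    · rw [wt_rec h, wtEq_cons]; exact ⟨rfl, ih _ (by omega)⟩

lemma pc_zero : pc 0 = 0 := rfl

def dg (c : ℕ) : ℕ := wd (wt c)
lemma dg_zero : dg 0 = 0 := by rw [dg, wt_zero]; rfl
lemma dg_rec (c : ℕ) : dg c = pc c + 2 * dg (c / 32) := by
  by_cases h : c = 0
  · subst h; simp [dg_zero, pc_zero]
  · rw [dg, wt_rec h]; rfl

lemma dg_pos {c : ℕ} (h : c ≠ 0) : 0 < dg c := by
  induction c using Nat.strong_induction_on with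
  | _ c ih =>
    rw [dg_rec]
    by_cases h2 : c / 32 = 0
    · have : bs c ≠ ∅ := fun h3 => h (bs_inj (by omega) (by norm_num) (h3.trans bs_zero.symm))
      have := Finset.card_pos.2 (Finset.nonempty_iff_ne_empty.2 this)
      rw [← pc_eq] at this; omega
    · have := ih (c / 32) (by omega) h2; omega

lemma wt_len (n : ℕ) : ∀ {c}, dg c < 2 ^ n → (wt c).length ≤ n := by
  induction n with
  | zero =>
    intro c h
    by_cases h2 : c = 0
    · rw [h2, wt_zero]; simp
    · have := dg_pos h2; simp at h; omega
  | succ n ih =>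
    intro c h
    by_cases h2 : c = 0
    · rw [h2, wt_zero]; simp
    · rw [wt_rec h2, List.length_cons]
      rw [dg_rec, pow_succ] at h
      have := ih (c := c / 32) (by omega); omega

lemma wd_dg {ν : List ℕ} : ∀ {c}, wtEq ν c = true → dg c = wd ν := by
  induction ν with
  | nil => intro c h; rw [(wtEq_nil c).1 h, dg_zero]; rfl
  | cons a ν ih => intro c h; rw [wtEq_cons] at h; rw [dg_rec, h.1, ih h.2]; rfl

lemma mon_hom (c : ℕ) : (mon c).IsHomogeneous (dg c) := by
  induction c using Nat.strong_induction_on with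
  | _ c ih =>
    by_cases h : c = 0
    · subst h; rw [mon_zero, dg_zero]; exact isHomogeneous_one _ _
    · rw [mon_rec, dg_rec, pc_eq, mul_comm 2]
      exact (xs_hom _).mul ((ih (c / 32) (by omega)).pow 2)

def keyN : ℕ → ℕ → ℕ
  | 0, _ => 0
  | n + 1, c => pc c * 8 ^ n + keyN n (c / 32)

lemma keyN_lt (n c : ℕ) : keyN n c < 8 ^ n := by
  induction n generalizing c with
  | zero => simp [keyN]
  | succ n ih => 
    have := ih (c / 32); have := pc_le c
    rw [keyN, pow_succ]; nlinarith

lemma key_lt {ν : List ℕ} : ∀ {n c c'}, ν.length ≤ n → wtEq ν c = true → ltC ν c' = true → keyN n c' < keyN n c := by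
  induction ν with
  | nil => intro n c c' _ _ h; rw [ltC_nil] at h; cases h
  | cons a ν ih =>
    intro n c c' hn h h'
    obtain ⟨n, rfl⟩ := Nat.exists_eq_succ_of_ne_zero (show n ≠ 0 by rw [List.length_cons] at hn; omega)
    rw [List.length_cons] at hn
    rw [wtEq_cons] at h
    rw [keyN, keyN]
    rcases (ltC_cons _ _ _).1 h' with h2 | ⟨h2, h3⟩
    · have h4 := keyN_lt n (c' / 32)
      have h5 := Nat.mul_le_mul_right (8 ^ n) (show pc c' + 1 ≤ pc c by omega)
      rw [add_mul] at h5
      omega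
    · have := ih (n := n) (by omega) h.2 h3
      rw [h.1, h2]; omega

lemma keyN_zero (n : ℕ) : keyN n 0 = 0 := by
  induction n with
  | zero => rfl
  | succ n ih => rw [keyN, pc_zero, Nat.zero_div, ih]; simp

lemma key_eq {ν : List ℕ} : ∀ {n c c'}, wtEq ν c = true → wtEq ν c' = true → keyN n c' = keyN n c := by
  induction ν with
  | nil => intro n c c' h h'; rw [wtEq_nil] at h h'; rw [h, h']
  | cons a ν ih =>
    intro n c c' h h'
    cases n with
    | zero => rfl
    | succ n => 
      rw [wtEq_cons] at h h'
      rw [keyN, keyN, h.1, h'.1, ih h.2 h'.2]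

lemma pop_pc (m : ℕ) : pop m = pc m + pop (m / 32) := by
  have h : pc m = m % 2 + m / 2 % 2 + m / 4 % 2 + m / 8 % 2 + m / 16 % 2 := by
    have : ∀ J < 32, pc J = J % 2 + J / 2 % 2 + J / 4 % 2 + J / 8 % 2 + J / 16 % 2 := by decide +kernel
    rw [← pc_mod, this _ (Nat.mod_lt _ (by norm_num))]; omega
  rw [pop_rec, pop_rec (m / 2), pop_rec (m / 2 / 2), pop_rec (m / 2 / 2 / 2), pop_rec (m / 2 / 2 / 2 / 2)]
  simp only [Nat.div_div_eq_div_mul, Nat.reduceMul]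
  omega

lemma pop_zero : pop 0 = 0 := by rw [pop]; simp

lemma pop_pc2 {m : ℕ} (h : m < 1024) : pop m = pc m + pc (m / 32) := by
  rw [pop_pc, pop_pc (m / 32), show m / 32 / 32 = 0 by omega, pop_zero, add_zero]

lemma wts_or (n : ℕ) : ∀ c, n ≤ 7 → dg c < 2 ^ n → wt c ∈ wts n (dg c) ∨ mon c ∈ HH ⊔ Low (wt c) := by
  induction n with
  | zero =>
    intro c _ h
    have : c = 0 := by
      by_contra h2
      have := dg_pos h2; simp at h; omega
    subst this; left; rw [wt_zero, dg_zero]; decide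
  | succ n ih =>
    intro c hn h
    by_cases h0 : c = 0
    · subst h0; left; rw [wt_zero, dg_zero]; simp [wts]
    · have hd := dg_rec c
      have hp := dg_pos h0
      have h128 : 2 ^ (n + 1) ≤ 2 ^ 7 := Nat.pow_le_pow_right (by norm_num) hn
      by_cases hw : pc c < pop (pc c + dg (c / 32))
      · right
        refine Submodule.mem_sup_left ?_
        rw [mon_rec]
        exact wood _ (mon_hom _) (by rwa [← pc_eq])
      rw [wt_rec h0]
      rcases ih (c / 32) (by omega) (by rw [pow_succ] at h; omega) with h1 | h1
      · left
        rw [wts, show Nat.beq (dg c) 0 = false by rw [← Bool.not_eq_true, Nat.beq_eq]; omega, cond_false, List.mem_flatMap]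
        refine ⟨pc c, ?_, ?_⟩
        · rw [List.mem_filter]
          constructor
          · have := pc_le c
            generalize pc c = a at *
            interval_cases a <;> simp
          · have e : (dg c - pc c) / 2 = dg (c / 32) := by omega
            rw [pop_pc2 (by have := pc_le c; omega)] at hw
            simp only [Bool.and_eq_true, Nat.ble_eq, Nat.beq_eq, e]
            omega
        · rw [show (dg c - pc c) / 2 = dg (c / 32) by omega]
          exact List.mem_map.2 ⟨_, h1, rfl⟩
      · right
        have := KK_sq (bs c) h1
        rwa [← mon_rec, ← pc_eq] at this

lemma bySize_spec {a I : ℕ} : I ∈ bySize a ↔ I < 32 ∧ pc I = a := by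
  have h1 : ∀ a ≤ 5, ∀ I < 32, (I ∈ bySize a ↔ pc I = a) := by decide +kernel
  have h2 : ∀ a ≤ 5, ∀ I ∈ bySize a, I < 32 := by decide +kernel
  by_cases ha : a ≤ 5
  · constructor
    · intro h; have := h2 a ha I h; exact ⟨this, (h1 a ha I this).1 h⟩
    · rintro ⟨h, h'⟩; exact (h1 a ha I h).2 h'
  · have : bySize a = [] := by
      have hb : ∀ b ≤ 5, b ≠ a := by intro b hb; omega
      simp only [bySize, sizeList, bbeq]
      rw [if_neg (hb 0 (by norm_num)), if_neg (hb 1 (by norm_num)), if_neg (hb 2 (by norm_num)), if_neg (hb 3 (by norm_num)),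
        if_neg (hb 4 (by norm_num)), if_neg (hb 5 (by norm_num))]
    rw [this]
    have := pc_le I
    constructor
    · intro h; cases h
    · rintro ⟨_, h⟩; omega

lemma mem_enum (D : Tr) (a : ℕ) (ν : List ℕ) (c : ℕ) : c ∈ enum D (a :: ν) ↔ pc c = a ∧ c / 32 ∈ enum D ν ∧ D.get c = none := by
  have e : enum D (a :: ν) = List.rec [] (fun s _ acc => List.rec acc (fun I _ acc2 => frc (Nat.add I (Nat.mul 32 s)) fun c =>
    Option.rec (c :: acc2) (fun _ => acc2) (D.get c)) (bySize a)) (enum D ν) := rfl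
  have h1 : ∀ (s : ℕ) (l acc : List ℕ), c ∈ (List.rec acc (fun I _ acc2 => frc (Nat.add I (Nat.mul 32 s)) fun c =>
    Option.rec (c :: acc2) (fun _ => acc2) (D.get c)) l : List ℕ) ↔ (∃ I ∈ l, c = I + 32 * s) ∧ D.get c = none ∨ c ∈ acc := by
    intro s l acc
    induction l with
    | nil => simp
    | cons I l ih =>
      change c ∈ (frc (I + 32 * s) _ : List ℕ) ↔ _
      have hx : (∃ I' ∈ I :: l, c = I' + 32 * s) ↔ c = I + 32 * s ∨ ∃ I' ∈ l, c = I' + 32 * s := by simp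
      rw [frc_eq, hx]
      cases hg : D.get (I + 32 * s) with
      | none =>
        change c ∈ _ :: _ ↔ _
        rw [List.mem_cons, ih]
        by_cases hc : c = I + 32 * s
        · subst hc; simp [hg]
        · simp [hc]
      | some t =>
        change c ∈ (List.rec _ _ _ : List ℕ) ↔ _
        rw [ih]
        by_cases hc : c = I + 32 * s
        · subst hc; simp [hg]
        · simp [hc]
  rw [e]
  generalize enum D ν = L
  induction L with
  | nil => simp
  | cons s L ih =>
    refine (h1 s (bySize a) _).trans ?_
    rw [List.mem_cons]
    have : (∃ I ∈ bySize a, c = I + 32 * s) ↔ pc c = a ∧ c / 32 = s := by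
      constructor
      · rintro ⟨I, hI, rfl⟩
        rw [bySize_spec] at hI
        rw [← pc_mod, show (I + 32 * s) % 32 = I by omega]; exact ⟨hI.2, by omega⟩
      · rintro ⟨h, rfl⟩
        refine ⟨c % 32, bySize_spec.2 ⟨Nat.mod_lt _ (by norm_num), by rwa [pc_mod]⟩, by omega⟩
    rw [this]; refine (or_congr_right ih).trans ?_; tauto

lemma enum_wt {D : Tr} {ν : List ℕ} : ∀ {c}, c ∈ enum D ν → wtEq ν c = true := by
  induction ν with
  | nil => intro c h; rw [wtEq_nil]; simpa [enum] using h
  | cons a ν ih => intro c h; rw [mem_enum] at h; rw [wtEq_cons]; exact ⟨h.1, ih h.2.1⟩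

lemma enum_or {D : Tr} (hD : GoodT D) {ν : List ℕ} : ∀ {c}, wtEq ν c = true → c ∈ enum D ν ∨ ∃ t, TT ν c t := by
  induction ν with
  | nil => intro c h; rw [wtEq_nil] at h; left; simp [enum, h]
  | cons a ν ih =>
    intro c h
    have h' := (wtEq_cons _ _ _).1 h
    rcases ih h'.2 with h1 | ⟨t, h1⟩
    · cases hg : D.get c with
      | none => left; exact (mem_enum _ _ _ _).2 ⟨h'.1, h1, hg⟩
      | some t => right; exact ⟨t, GT_TT hD h hg⟩
    · right; exact ⟨_, TT_shift h h1⟩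

lemma comp_low {ν : List ℕ} {u : R5} (hu : u ∈ HH ⊔ Low ν) (d : ℕ) : 
    homogeneousComponent d u ∈ HH ⊔ Submodule.span (ZMod 2) {v | ∃ c, ltC ν c = true ∧ dg c = d ∧ v = mon c} := by
  obtain ⟨y, hy, z, hz, rfl⟩ := Submodule.mem_sup.1 hu
  rw [map_add]
  refine add_mem (Submodule.mem_sup_left (HH_comp d hy)) (Submodule.mem_sup_right ?_)
  clear hu
  induction hz using Submodule.span_induction with
  | mem x hx =>
    obtain ⟨c, hc, rfl⟩ := hx
    rw [comp_of_hom (mon_hom c)]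
    split_ifs with h
    · exact Submodule.subset_span ⟨c, hc, h, rfl⟩
    · exact zero_mem _
  | zero => simp
  | add x y _ _ hx hy => rw [map_add]; exact add_mem hx hy
  | smul a x _ hx => rw [map_smul]; exact Submodule.smul_mem _ _ hx

def WW (D : Tr) : List ℕ := (wts 7 67).flatMap (enum D)

def Spn (D : Tr) : Submodule (ZMod 2) R5 := HH ⊔ Submodule.span (ZMod 2) {v | ∃ c ∈ WW D, v = mon c}

lemma span_main {D : Tr} (hD : GoodT D) (m : ℕ) : ∀ c, keyN 7 c * 32 ^ 7 + c = m → dg c = 67 → mon c ∈ Spn D := by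
  induction m using Nat.strong_induction_on with
  | _ m ih =>
    intro c hm hd
    have hl : (wt c).length ≤ 7 := wt_len 7 (by rw [hd]; norm_num)
    have hle : HH ⊔ Submodule.span (ZMod 2) {v | ∃ c', ltC (wt c) c' = true ∧ dg c' = 67 ∧ v = mon c'} ≤ Spn D := by
      refine sup_le le_sup_left (Submodule.span_le.2 ?_)
      rintro _ ⟨c', h1, h2, rfl⟩
      refine ih _ ?_ c' rfl h2
      have h3 := key_lt hl (wt_eq c) h1
      have h4 : c' < 32 ^ 7 := lt_of_lt_of_le (wt_lt (wt_eq c')) (Nat.pow_le_pow_right (by norm_num) (wt_len 7 (by rw [h2]; norm_num)))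
      have h5 := Nat.mul_le_mul_right (32 ^ 7) (show keyN 7 c' + 1 ≤ keyN 7 c by omega)
      omega
    rcases wts_or 7 c le_rfl (by rw [hd]; norm_num) with h1 | h1
    · rcases enum_or hD (wt_eq c) with h2 | ⟨t, h2, h3⟩
      · refine Submodule.mem_sup_right (Submodule.subset_span ⟨c, ?_, rfl⟩)
        rw [hd] at h1
        exact List.mem_flatMap.2 ⟨_, h1, h2⟩
      · have h4 := hle (comp_low (NN_HH _ h2) 67)
        have h5 : ∀ t : List ℕ, (∀ a ∈ t, 0 < a ∧ a ≤ c ∧ wtEq (wt c) (c - a) = true) → homogeneousComponent 67 (SS (t.map fun a => c - a)) ∈ Spn D := by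
          intro t ht
          induction t with
          | nil => simp [SS_nil]
          | cons a t iht =>
            rw [List.map_cons, SS_cons, map_add]
            refine add_mem ?_ (iht fun b hb => ht b (List.mem_cons_of_mem _ hb))
            obtain ⟨h6, h7, h8⟩ := ht a List.mem_cons_self
            have h9 : dg (c - a) = 67 := by rw [wd_dg h8]; exact hd
            rw [comp_of_hom (mon_hom _), if_pos h9]
            refine ih _ ?_ _ rfl h9
            rw [key_eq (wt_eq c) h8]; omega
        rw [map_add, comp_of_hom (mon_hom c), if_pos hd] at h4
        exact (Submodule.add_mem_iff_left _ (h5 t h3)).1 h4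
    · have h4 := hle (comp_low h1 67)
      rwa [comp_of_hom (mon_hom c), if_pos hd] at h4

lemma len_eq (l : List ℕ) : len l = l.length := by
  induction l with
  | nil => rfl
  | cons a l ih => change 1 + len l = _; rw [ih, List.length_cons]; omega

lemma lenS_eq (l : List (List ℕ)) (f : List ℕ → List ℕ) : lenS l (fun ν => len (f ν)) = (l.flatMap f).length := by
  induction l with
  | nil => rfl
  | cons a l ih => 
    change len (f a) + lenS l (fun ν => len (f ν)) = _
    rw [ih, List.flatMap_cons, List.length_append, len_eq]

/-- projection to the cohits -/
def prj (d : ℕ) : R5 →ₗ[ZMod 2] QP 5 d := ((hitSub 5 d).comap (homSub 5 d).subtype).mkQ ∘ₗ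
  (homogeneousComponent d).codRestrict (homSub 5 d) fun u => homogeneousComponent_mem d u

lemma prj_HH {d : ℕ} {u : R5} (h : u ∈ HH) : prj d u = 0 := by
  rw [prj, LinearMap.comp_apply, Submodule.mkQ_apply, Submodule.Quotient.mk_eq_zero]
  exact HH_hit d h

lemma prj_zero {d : ℕ} {u : R5} (h : homogeneousComponent d u = 0) : prj d u = 0 := by
  rw [prj, LinearMap.comp_apply, Submodule.mkQ_apply, Submodule.Quotient.mk_eq_zero]
  change homogeneousComponent d u ∈ hitSub 5 d
  rw [h]; exact zero_mem _

lemma prj_surj (d : ℕ) : Function.Surjective (prj d) := by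
  refine (Submodule.mkQ_surjective _).comp fun v => ⟨v.1, Subtype.ext ?_⟩
  change homogeneousComponent d v.1 = v.1
  rw [comp_of_hom ((mem_homogeneousSubmodule _ _).1 v.2), if_pos rfl]

lemma upper {D : Tr} (hD : GoodT D) (h : lenS (wts 7 67) (fun ν => len (enum D ν)) = 1487) : Module.Finite (ZMod 2) (QP 5 67) ∧ Module.finrank (ZMod 2) (QP 5 67) ≤ 1487 := by
  classical
  have hs : Submodule.span (ZMod 2) (((WW D).map fun c => prj 67 (mon c)).toFinset : Set (QP 5 67)) = ⊤ := by
    rw [eq_top_iff]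
    rintro v -
    obtain ⟨u, rfl⟩ := prj_surj 67 v
    have hu : u ∈ Submodule.span (ZMod 2) (Set.range mon) := by rw [mon_span]; trivial
    induction hu using Submodule.span_induction with
    | mem x hx =>
      obtain ⟨c, rfl⟩ := hx
      by_cases hc : dg c = 67
      · obtain ⟨y, hy, z, hz, h2⟩ := Submodule.mem_sup.1 (span_main hD _ c rfl hc)
        rw [← h2, map_add, prj_HH hy, zero_add]
        clear h2
        induction hz using Submodule.span_induction with
        | mem x hx =>
          obtain ⟨c', hc', rfl⟩ := hx
          refine Submodule.subset_span ?_
          rw [Finset.mem_coe, List.mem_toFinset]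
          exact List.mem_map.2 ⟨c', hc', rfl⟩
        | zero => simp
        | add x y _ _ hx hy => rw [map_add]; exact add_mem hx hy
        | smul a x _ hx => rw [map_smul]; exact Submodule.smul_mem _ _ hx
      · have : prj 67 (mon c) = 0 := by
          refine prj_zero ?_
          rw [comp_of_hom (mon_hom c), if_neg hc]
        rw [this]; exact zero_mem _
    | zero => simp
    | add x y _ _ hx hy => rw [map_add]; exact add_mem hx hy
    | smul a x _ hx => rw [map_smul]; exact Submodule.smul_mem _ _ hx
  refine ⟨⟨⟨_, hs⟩⟩, ?_⟩
  have h3 := finrank_span_finset_le_card (R := ZMod 2) ((WW D).map fun c => prj 67 (mon c)).toFinset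
  rw [Set.finrank, hs, finrank_top] at h3
  refine h3.trans ((List.toFinset_card_le _).trans ?_)
  rw [List.length_map, WW, ← lenS_eq, h]

lemma SqT_xs (s : Finset (Fin 5)) : SqT 5 (xs s) = ∑ t ∈ s.powerset, xs (s \ t) * xs t ^ 2 := by
  rw [← sqt_eval1, sqt_xs, Polynomial.eval_finset_sum]
  refine Finset.sum_congr rfl fun t _ => ?_
  rw [Polynomial.eval_mul, Polynomial.eval_pow, Polynomial.eval_X, Polynomial.eval_C, one_pow, one_mul]

lemma kap_SqT_xs (J s : Finset (Fin 5)) : kap J (SqT 5 (xs s)) = if J ⊆ s then xs (s \ J) else 0 := by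
  rw [SqT_xs, map_sum]
  simp only [kap_mul]
  split_ifs with h
  · rw [Finset.sum_eq_single (s \ J)]
    · rw [if_pos (by rw [Finset.sdiff_sdiff_eq_self h])]
    · intro t ht hne
      rw [if_neg]
      rintro rfl
      exact hne (Finset.sdiff_sdiff_eq_self (Finset.mem_powerset.1 ht)).symm
    · intro h2; exact absurd (Finset.mem_powerset.2 Finset.sdiff_subset) h2
  · refine Finset.sum_eq_zero fun t ht => ?_
    rw [if_neg]
    rintro rfl
    exact h Finset.sdiff_subset

lemma kap_xs (J S : Finset (Fin 5)) (v : R5) : kap J (xs S * v) = xs (S \ J) * kap (symmDiff S J) v := by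
  conv_lhs => rw [kap_dec v, Finset.mul_sum, map_sum]
  have h : ∀ T : Finset (Fin 5), kap J (xs S * (xs T * kap T v ^ 2)) = if T = symmDiff S J then xs (S \ J) * kap (symmDiff S J) v else 0 := by
    intro T
    rw [← mul_assoc, xs_mul, mul_assoc, ← mul_pow, kap_mul]
    by_cases hT : T = symmDiff S J
    · subst hT
      rw [if_pos (by rw [symmDiff_symmDiff_cancel_left]), if_pos rfl]
      congr 2
      ext i; simp only [Finset.mem_inter, Finset.mem_symmDiff, Finset.mem_sdiff]; tauto
    · rw [if_neg hT, if_neg]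
      rintro rfl
      exact hT (by rw [symmDiff_symmDiff_cancel_left])
  simp only [h, Finset.sum_ite_eq', Finset.mem_univ, if_true]

def cf : ℕ → ℕ → R5 →ₗ[ZMod 2] ZMod 2
  | 0, _ => lcoeff (ZMod 2) 0
  | n + 1, K => cf n (K / 32) ∘ₗ kap (bs K)

lemma cf_succ (n K : ℕ) (u : R5) : cf (n + 1) K u = cf n (K / 32) (kap (bs K) u) := rfl
lemma cf_0 (K : ℕ) (u : R5) : cf 0 K u = coeff 0 u := rfl

lemma cf_zero (n : ℕ) (u : R5) : cf n 0 u = coeff 0 u := by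
  induction n generalizing u with
  | zero => rfl
  | succ n ih =>
    rw [cf_succ, Nat.zero_div, ih, kap_coeff, bs_zero]
    congr 1; ext i; simp [ind_apply]

lemma coeff_xs0 {S : Finset (Fin 5)} (h : S ≠ ∅) (v : R5) : coeff 0 (xs S * v) = 0 := by
  obtain ⟨i, hi⟩ := Finset.nonempty_iff_ne_empty.2 h
  rw [← Finset.insert_erase hi, xs_insert (Finset.notMem_erase i S), mul_assoc, coeff_X_mul']
  simp

lemma dv_succ (n S w : ℕ) : dv (n + 1) S w = if S = 0 then w + 1 else if w = 0 then 0 else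
    Nat.rec 0 (fun r _ => (S ^^^ (w % 32)) + 32 * r + 1) (dv n (S ^^^ (S &&& w)) (w / 32)) := by
  change (@Bool.rec (fun _ => _) _ _ _) = _
  rw [bbeq, bbeq]; rfl

lemma lt32_xor {a b : ℕ} (h : a < 32) (h' : b < 32) : a ^^^ b < 32 := Nat.xor_lt_two_pow (n := 5) h h'

lemma dv_sound (n : ℕ) : ∀ S w, S < 32 → ∀ v, cf n w (xs (bs S) * v) = Nat.rec 0 (fun r _ => cf n r v) (dv n S w) := by
  induction n with
  | zero =>
    intro S w hS v
    change _ = (Nat.rec 0 (fun r _ => cf 0 r v) (@Bool.rec (fun _ => ℕ) 0 1 _) : ZMod 2)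
    rw [bbeq, cf_0]
    split_ifs with h
    · subst h; rw [bs_zero, xs_empty, one_mul]; rfl
    · exact coeff_xs0 (fun h2 => h (bs_inj hS (by norm_num) (h2.trans bs_zero.symm))) _
  | succ n ih =>
    intro S w hS v
    rw [dv_succ]
    split_ifs with h h2
    · subst h; rw [bs_zero, xs_empty, one_mul]
    · subst h2
      exact (cf_zero _ _).trans (coeff_xs0 (fun h2 => h (bs_inj hS (by norm_num) (h2.trans bs_zero.symm))) _)
    · rw [cf_succ, kap_xs]
      have e : bs S \ bs w = bs (S ^^^ (S &&& w)) := by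
        rw [bs_xor, bs_and]
        ext i; simp only [Finset.mem_inter, Finset.mem_symmDiff, Finset.mem_sdiff]; tauto
      have hl : S ^^^ (S &&& w) < 32 := lt32_xor hS (lt_of_le_of_lt Nat.and_le_left hS)
      rw [e, ih _ _ hl]
      cases dv n (S ^^^ (S &&& w)) (w / 32) with
      | zero => rfl
      | succ r =>
        change cf n r _ = cf (n + 1) ((S ^^^ (w % 32)) + 32 * r) v
        have h3 : S ^^^ (w % 32) < 32 := lt32_xor hS (Nat.mod_lt _ (by norm_num))
        rw [cf_succ, ← bs_mod ((S ^^^ (w % 32)) + _), show ((S ^^^ (w % 32)) + 32 * r) % 32 = S ^^^ (w % 32) by omega,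
          show ((S ^^^ (w % 32)) + 32 * r) / 32 = r by omega, bs_xor, bs_mod]

def cfs (n : ℕ) (f : List ℕ) : R5 →ₗ[ZMod 2] ZMod 2 := (f.map (cf n)).sum

lemma cfs_nil (n : ℕ) : cfs n [] = 0 := rfl
lemma cfs_cons (n a : ℕ) (l : List ℕ) : cfs n (a :: l) = cf n a + cfs n l := by simp [cfs]

lemma lin2 (u : R5 →ₗ[ZMod 2] ZMod 2) : u + u = 0 := by
  ext v; simp [CharTwo.add_self_eq_zero]

lemma cfs_mrg (n : ℕ) (a : List ℕ) : ∀ b, cfs n (mrg a b) = cfs n a + cfs n b := by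
  induction a with
  | nil => intro b; rw [cfs_nil, zero_add]; rfl
  | cons x a ih =>
    intro b
    induction b with
    | nil => rw [cfs_nil, add_zero]; rfl
    | cons y b ihb =>
      have e : mrg (x :: a) (y :: b) = if x = y then mrg a b else if y ≤ x then x :: mrg a (y :: b) else y :: mrg (x :: a) b := by
        change (@Bool.rec (fun _ => _) _ _ _) = _
        rw [bbeq, bble]; rfl
      rw [e]
      split_ifs with h1 h2
      · subst h1
        rw [ih, cfs_cons, cfs_cons]
        rw [show cf n x + cfs n a + (cf n x + cfs n b) = (cf n x + cf n x) + (cfs n a + cfs n b) by abel, lin2, zero_add]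
      · rw [cfs_cons, ih, cfs_cons, cfs_cons]; abel
      · rw [cfs_cons, ihb, cfs_cons, cfs_cons]; abel

lemma flush_push (n : ℕ) (s : List (List ℕ)) : ∀ r, cfs n (flush (push s r)) = cfs n r + cfs n (flush s) := by
  induction s with
  | nil => 
    intro r
    change cfs n (mrg r []) = _
    rw [cfs_mrg]; rfl
  | cons x s ih =>
    intro r
    cases x with
    | nil =>
      change cfs n (mrg r (flush s)) = cfs n r + cfs n (mrg [] (flush s))
      rw [cfs_mrg, cfs_mrg, cfs_nil, zero_add]
    | cons a x =>
      change cfs n (mrg [] (flush (push s (mrg r (a :: x))))) = cfs n r + cfs n (mrg (a :: x) (flush s))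
      rw [cfs_mrg, cfs_nil, zero_add, ih, cfs_mrg, cfs_mrg]; abel

lemma cfs_gI (n I : ℕ) (hI : I < 32) (f : List ℕ) (u : R5) :
    cfs (n + 1) f (SqT 5 (xs (bs I)) * u ^ 2) = cfs n (flush (gI n I f)) u := by
  induction f with
  | nil => rfl
  | cons c f ih =>
    have e : gI n I (c :: f) = if I &&& (c % 32) = c % 32 then Nat.rec (gI n I f) (fun r _ => push (gI n I f) [r]) (dv n (I ^^^ (c % 32)) (c / 32)) else gI n I f := by
      change (@Bool.rec (fun _ => _) _ _ _) = _
      rw [bbeq]; rfl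
    rw [cfs_cons, LinearMap.add_apply, ih, e, cf_succ, kap_mulsq, kap_SqT_xs]
    have hc : c % 32 < 32 := Nat.mod_lt _ (by norm_num)
    have hs : I &&& (c % 32) = c % 32 ↔ bs c ⊆ bs I := by
      rw [← bs_mod c, ← bs_sub hc, Nat.mod_eq_of_lt hI, Nat.land_comm]
    by_cases h : bs c ⊆ bs I
    · rw [if_pos h, if_pos (hs.2 h)]
      have e2 : bs I \ bs c = bs (I ^^^ (c % 32)) := by
        rw [bs_xor, bs_mod]
        ext i; have := @h i; simp only [Finset.mem_symmDiff, Finset.mem_sdiff]; tauto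
      rw [e2, dv_sound n _ _ (lt32_xor hI hc)]
      cases dv n (I ^^^ (c % 32)) (c / 32) with
      | zero => exact zero_add _
      | succ r =>
        change cf n r u + _ = cfs n (flush (push (gI n I f) [r])) u
        rw [flush_push, cfs_cons, cfs_nil, add_zero]; rfl
    · rw [if_neg h, if_neg (fun h2 => h (hs.1 h2)), zero_mul, map_zero, zero_add]

lemma cfs_hI (n I : ℕ) (hl : I < 32) (f : List ℕ) (u : R5) :
    cfs (n + 1) f (xs (bs I) * u ^ 2) = cfs n (hI I f) u := by
  induction f with
  | nil => rfl
  | cons c f ih =>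
    have e : hI I (c :: f) = if c % 32 = I then c / 32 :: hI I f else hI I f := by
      change (@Bool.rec (fun _ => _) _ _ _) = _
      rw [bbeq, frc_eq]; rfl
    rw [cfs_cons, LinearMap.add_apply, ih, e, cf_succ, kap_mul]
    by_cases h : c % 32 = I
    · rw [if_pos h, if_pos (by rw [← h, bs_mod]), cfs_cons]; rfl
    · rw [if_neg h, if_neg, map_zero, zero_add]
      intro h2
      exact h (bs_inj (Nat.mod_lt _ (by norm_num)) hl (by rw [bs_mod, h2]))

lemma isE_iff (f : List ℕ) : isE f = true ↔ f = [] := by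
  cases f with
  | nil => exact ⟨fun _ => rfl, fun _ => rfl⟩
  | cons a l => exact ⟨(nomatch ·), (nomatch ·)⟩

lemma isZ_iff (f : List ℕ) : isZ f = true ↔ f = [0] := by
  cases f with
  | nil => exact ⟨(nomatch ·), (nomatch ·)⟩
  | cons a l => 
    change (@Bool.rec (fun _ => _) _ _ _) = _ ↔ _
    rw [bbeq]
    split_ifs with h
    · subst h; rw [isE_iff]; simp
    · simp [h]

lemma SqT_c0 (u : R5) : coeff 0 (SqT 5 u) = coeff 0 u := by
  change constantCoeff (SqT 5 u) = constantCoeff u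
  induction u using MvPolynomial.induction_on with
  | C a => simp [SqT]
  | add p q hp hq => rw [map_add, map_add, map_add, hp, hq]
  | mul_X p i hp => rw [map_mul, map_mul, map_mul, hp]; simp [SqT]

lemma chk_EZ {n : ℕ} {f h : List ℕ} {b : Bool} (hb : b = true → ∀ u, cfs n f (SqT 5 u) = cfs n h u)
    (hc : (iF isE f thN isE h elS iF isZ f thN isZ h elS b) = true) (u : R5) : cfs n f (SqT 5 u) = cfs n h u := by
  rw [brec, brec] at hc
  split_ifs at hc with h1 h2
  · rw [(isE_iff f).1 h1, (isE_iff h).1 hc]; rfl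
  · rw [(isZ_iff f).1 h2, (isZ_iff h).1 hc, cfs_cons, cfs_nil, add_zero, cf_zero, cf_zero, SqT_c0]
  · exact hb hc u

lemma l32_all : ∀ I < 32, I ∈ l32 := by decide +kernel

lemma chk_sound (n : ℕ) : ∀ f h, chk n f h = true → ∀ u, cfs n f (SqT 5 u) = cfs n h u := by
  induction n with
  | zero => exact fun f h hc => chk_EZ (fun h => by cases h) hc
  | succ n ih =>
    intro f h hc
    refine chk_EZ (fun hb u => ?_) hc
    rw [allL_iff] at hb
    conv_lhs => rw [kap_dec u]
    conv_rhs => rw [kap_dec u]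
    simp only [map_sum]
    refine Finset.sum_congr rfl fun J _ => ?_
    obtain ⟨I, hI, rfl⟩ := bs_surj J
    rw [map_mul, map_pow, cfs_gI n I hI, cfs_hI n I hI]
    exact ih _ _ (hb I (l32_all I hI)) _

lemma degC_succ (n c : ℕ) : degC (n + 1) c = pc c + 2 * degC n (c / 32) := rfl

lemma cf_deg (n : ℕ) : ∀ K (u : R5) d, u.IsHomogeneous d → d ≠ degC n K → cf n K u = 0 := by
  induction n with
  | zero => 
    intro K u d hu hd
    rw [cf_0]
    by_contra h
    exact hd ((hom_iff.1 hu 0 h).symm.trans (by simp; rfl))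
  | succ n ih =>
    intro K u d hu hd
    rw [cf_succ]
    rw [degC_succ] at hd
    by_cases h : ∃ m, d = (bs K).card + 2 * m
    · obtain ⟨m, hm⟩ := h
      refine ih _ _ m (kap_hom hu hm) ?_
      rintro rfl
      exact hd (by rw [pc_eq, hm])
    · push Not at h
      rw [kap_hom0 hu h, map_zero]

lemma cfs_comp {n d : ℕ} {f : List ℕ} (hf : ∀ c ∈ f, degC n c = d) (u : R5) : cfs n f (homogeneousComponent d u) = cfs n f u := by
  induction f with
  | nil => rfl
  | cons c f ih =>
    rw [cfs_cons, LinearMap.add_apply, LinearMap.add_apply, ih fun c hc => hf c (List.mem_cons_of_mem _ hc)]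
    congr 1
    conv_rhs => rw [← sum_homogeneousComponent u, map_sum]
    have hc := hf c List.mem_cons_self
    by_cases h : d ∈ Finset.range (u.totalDegree + 1)
    · rw [Finset.sum_eq_single_of_mem d h]
      intro e _ he
      exact cf_deg n c _ e (homogeneousComponent_isHomogeneous e u) (by rw [hc]; exact he)
    · rw [homogeneousComponent_eq_zero d u (by simpa using h), map_zero, Finset.sum_eq_zero]
      intro e he
      exact cf_deg n c _ e (homogeneousComponent_isHomogeneous e u) (by rw [hc]; rintro rfl; exact h he)

lemma cfs_HH {n d : ℕ} {f : List ℕ} (hf : ∀ c ∈ f, degC n c = d) (hc : chk n f f = true) {u : R5} (hu : u ∈ HH) : cfs n f u = 0 := by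
  induction hu using Submodule.span_induction with
  | mem x hx =>
    obtain ⟨q, u, hq, rfl⟩ := hx
    rw [← cfs_comp hf, comp_stq]
    split_ifs with h
    · have h1 := homogeneousComponent_isHomogeneous (d - q) u
      have h2 := comp_SqT h1 (show d - q ≤ d by omega)
      rw [show d - (d - q) = q by omega] at h2
      rw [← h2, cfs_comp hf, chk_sound n f f hc, ← cfs_comp hf, comp_of_hom h1, if_neg (by omega), map_zero]
    · rw [map_zero]
  | zero => simp
  | add x y _ _ hx hy => rw [map_add, hx, hy, add_zero]
  | smul a x _ hx => rw [map_smul, hx, smul_zero]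

def bz (b : Bool) : ZMod 2 := if b = true then 1 else 0

lemma bz_xor (a b : Bool) : bz (a ^^ b) = bz a + bz b := by revert a b; decide
lemma bz_and (a b : Bool) : bz (a && b) = bz a * bz b := by revert a b; decide

def LL (V : ℕ) (i : Fin 5) : R5 := ∑ k : Fin 5, bz (V.testBit (5 * i + k)) • X k

def gV (V : ℕ) : R5 →ₐ[ZMod 2] R5 := aeval (LL V)

lemma gV_X (V : ℕ) (i : Fin 5) : gV V (X i) = LL V i := by simp [gV]

lemma LL_sq (V : ℕ) (i : Fin 5) : LL V i ^ 2 = ∑ k : Fin 5, bz (V.testBit (5 * i + k)) • X k ^ 2 := by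
  rw [LL, sq_sum2]
  refine Finset.sum_congr rfl fun k _ => ?_
  rw [_root_.smul_pow, z2sq]

lemma sqt_LL (V : ℕ) (i : Fin 5) : sqt (LL V i) = Polynomial.C (LL V i) + Polynomial.X * Polynomial.C (∑ k : Fin 5, bz (V.testBit (5 * i + k)) • X k ^ 2) := by
  have h : ∀ k : Fin 5, sqt (bz (V.testBit (5 * i + k)) • X k) = Polynomial.C (bz (V.testBit (5 * i + k)) • X k) + Polynomial.X * Polynomial.C (bz (V.testBit (5 * i + k)) • X k ^ 2) := by
    intro k
    cases V.testBit (5 * i + k)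
    · simp [bz]
    · simp [bz, sqt_X]
  rw [LL, map_sum, map_sum, map_sum, Finset.mul_sum, ← Finset.sum_add_distrib]
  exact Finset.sum_congr rfl fun k _ => h k

lemma sqt_gX (V : ℕ) (i : Fin 5) : sqt (gV V (X i)) = (sqt (X i)).map (gV V : R5 →+* R5) := by
  rw [gV_X, sqt_X, Polynomial.map_add, Polynomial.map_mul, Polynomial.map_C, Polynomial.map_C, Polynomial.map_X]
  have e1 : (gV V : R5 →+* R5) (X i) = LL V i := gV_X V i
  have e2 : (gV V : R5 →+* R5) (X i ^ 2) = LL V i ^ 2 := by rw [map_pow, e1]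
  rw [e1, e2, LL_sq]
  exact sqt_LL V i

lemma sqt_gV (V : ℕ) (u : R5) : sqt (gV V u) = (sqt u).map (gV V : R5 →+* R5) := by
  induction u using MvPolynomial.induction_on with
  | C a => simp [gV, sqt_C]
  | add p q hp hq => rw [map_add, map_add, map_add, hp, hq, Polynomial.map_add]
  | mul_X p i hp =>
    rw [map_mul, map_mul, map_mul, hp, Polynomial.map_mul, sqt_gX]

lemma gV_stq (V q : ℕ) (u : R5) : gV V (stq q u) = stq q (gV V u) := by
  rw [stq_def, stq_def, sqt_gV, Polynomial.coeff_map]; rfl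

lemma gV_HH (V : ℕ) {u : R5} (hu : u ∈ HH) : gV V u ∈ HH := by
  induction hu using Submodule.span_induction with
  | mem x hx => obtain ⟨q, f, hq, rfl⟩ := hx; rw [gV_stq]; exact stq_mem hq _
  | zero => simp
  | add x y _ _ hx hy => rw [map_add]; exact add_mem hx hy
  | smul a x _ hx => rw [map_smul]; exact Submodule.smul_mem _ _ hx

lemma LL_hom (V : ℕ) (i : Fin 5) : (LL V i).IsHomogeneous 1 :=
  IsHomogeneous.sum _ _ _ fun k _ => by
    rw [smul_eq_C_mul]
    simpa using (isHomogeneous_C (Fin 5) (bz (V.testBit (5 * i + k)))).mul (isHomogeneous_X (ZMod 2) k)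

lemma gV_xs (V : ℕ) (s : Finset (Fin 5)) : gV V (xs s) = ∏ i ∈ s, LL V i := by
  rw [xs, map_prod]; simp only [gV_X]

lemma gV_hom (V : ℕ) (s : Finset (Fin 5)) : (gV V (xs s)).IsHomogeneous s.card := by
  have := IsHomogeneous.prod s (fun i => LL V i) (fun _ => 1) (fun i _ => LL_hom V i)
  rw [gV_xs]; simpa using this

def ee (V a b : ℕ) : ZMod 2 := coeff (ind (bs b)) (gV V (xs (bs a)))

lemma term_k (L E M k m : ℕ) (hm : m < 1024) (hM : ∀ j < 1024, M.testBit j = !j.testBit k) :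
    (if L &&& 2 ^ k = 0 then 0 else bz (((E &&& M) <<< 2 ^ k).testBit m)) =
    bz (L.testBit k) * (if m.testBit k = true then bz (E.testBit (m - 2 ^ k)) else 0) := by
  rw [Nat.and_two_pow]
  cases hL : L.testBit k with
  | false => simp [bz]
  | true =>
    rw [if_neg (by simp)]
    rw [show bz true = 1 from rfl, one_mul, Nat.testBit_shiftLeft, Nat.testBit_and]
    by_cases h : 2 ^ k ≤ m
    · obtain ⟨j, rfl⟩ := Nat.exists_eq_add_of_le h
      rw [Nat.testBit_two_pow_add_eq, Nat.add_sub_cancel_left, hM j (lt_of_le_of_lt (Nat.le_add_left _ _) hm)]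
      cases j.testBit k <;> simp [bz]
    · rw [Nat.testBit_lt_two_pow (not_le.1 h)]
      simp [h, bz]

lemma MM_ok : ∀ k < 5, ∃ M, MMs[k]? = some (2 ^ k, M, 2 ^ k) ∧ ∀ j < 1024, M.testBit j = !j.testBit k := by
  have h : ∀ k < 5, ((MMs.getD k default).1 = 2 ^ k ∧ (MMs.getD k default).2.2 = 2 ^ k) ∧ ∀ j < 1024, (MMs.getD k default).2.1.testBit j = !j.testBit k := by
    decide +kernel
  intro k hk
  obtain ⟨⟨h1, h2⟩, h3⟩ := h k hk
  refine ⟨_, ?_, h3⟩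
  have hl : k < MMs.length := hk
  rw [List.getElem?_eq_getElem hl]
  congr 1
  rw [List.getD_eq_getElem _ _ hl] at *
  ext
  · exact h1
  · rfl
  · exact h2

def wl (L E : ℕ) (l : List (ℕ × ℕ × ℕ)) : ℕ := List.rec 0 (fun p _ ih => iF Nat.beq (Nat.land L p.1) 0 thN ih elS
  Nat.xor (Nat.shiftLeft (Nat.land E p.2.1) p.2.2) ih) l

lemma wl_bit (L E m : ℕ) (l : List (ℕ × ℕ × ℕ)) : bz ((wl L E l).testBit m) =
    (l.map fun p => if L &&& p.1 = 0 then 0 else bz (((E &&& p.2.1) <<< p.2.2).testBit m)).sum := by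
  induction l with
  | nil => simp [wl, bz]
  | cons p l ih =>
    have e : wl L E (p :: l) = if L &&& p.1 = 0 then wl L E l else ((E &&& p.2.1) <<< p.2.2) ^^^ wl L E l := by
      change (@Bool.rec (fun _ => _) _ _ _) = _
      rw [bbeq]; rfl
    rw [e, List.map_cons, List.sum_cons, ← ih]
    split_ifs
    · rw [zero_add]
    · rw [Nat.testBit_xor, bz_xor]

lemma wedge_bit (L E m : ℕ) (hm : m < 1024) : bz ((wedge L E).testBit m) = ∑ k : Fin 5,
    bz (L.testBit k) * (if m.testBit k = true then bz (E.testBit (m - 2 ^ (k : ℕ))) else 0) := by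
  obtain ⟨M0, a0, b0⟩ := MM_ok 0 (by norm_num)
  obtain ⟨M1, a1, b1⟩ := MM_ok 1 (by norm_num)
  obtain ⟨M2, a2, b2⟩ := MM_ok 2 (by norm_num)
  obtain ⟨M3, a3, b3⟩ := MM_ok 3 (by norm_num)
  obtain ⟨M4, a4, b4⟩ := MM_ok 4 (by norm_num)
  have e : MMs = [(2 ^ 0, M0, 2 ^ 0), (2 ^ 1, M1, 2 ^ 1), (2 ^ 2, M2, 2 ^ 2), (2 ^ 3, M3, 2 ^ 3), (2 ^ 4, M4, 2 ^ 4)] := by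
    refine List.ext_getElem? fun i => ?_
    match i with
    | 0 => exact a0
    | 1 => exact a1
    | 2 => exact a2
    | 3 => exact a3
    | 4 => exact a4
    | i + 5 => rw [List.getElem?_eq_none (show MMs.length ≤ i + 5 from Nat.le_add_left 5 i), List.getElem?_eq_none (Nat.le_add_left 5 i)]
  change bz ((wl L E MMs).testBit m) = _
  rw [wl_bit, e, Fin.sum_univ_five]
  simp only [List.map_cons, List.map_nil, List.sum_cons, List.sum_nil, add_zero]
  rw [term_k L E M0 0 m hm b0, term_k L E M1 1 m hm b1, term_k L E M2 2 m hm b2, term_k L E M3 3 m hm b3, term_k L E M4 4 m hm b4]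
  simp only [← add_assoc]; rfl

def Es (V : ℕ) : ℕ → ℕ
  | 0 => 1
  | i + 1 => Es V i ||| wedge (V >>> (5 * i)) (Es V i) <<< (32 * 2 ^ i)

lemma EE_eq (V : ℕ) : EE V = Es V 5 := by
  simp only [EE, frc_eq, Es]; rfl

lemma bs_ins : ∀ i : Fin 5, ∀ a < 16, a < 2 ^ (i : ℕ) → i ∉ bs a ∧ bs (2 ^ (i : ℕ) + a) = insert i (bs a) := by decide +kernel
lemma bs_ers : ∀ k : Fin 5, ∀ b < 32, b.testBit k = true → 2 ^ (k : ℕ) ≤ b ∧ bs (b - 2 ^ (k : ℕ)) = (bs b).erase k := by decide +kernel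

lemma ee_step (V : ℕ) (i : Fin 5) (a b : ℕ) (ha : a < 2 ^ (i : ℕ)) (hb : b < 32) : ee V (2 ^ (i : ℕ) + a) b =
    ∑ k : Fin 5, bz (V.testBit (5 * i + k)) * (if b.testBit k = true then ee V a (b - 2 ^ (k : ℕ)) else 0) := by
  have h16 : a < 16 := lt_of_lt_of_le ha (Nat.pow_le_pow_right (n := 2) (j := 4) (by norm_num) (by omega))
  obtain ⟨h1, h2⟩ := bs_ins i a h16 ha
  rw [ee, h2, xs_insert h1, map_mul, gV_X, LL, Finset.sum_mul, coeff_sum]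
  refine Finset.sum_congr rfl fun k _ => ?_
  rw [smul_mul_assoc, coeff_smul, smul_eq_mul]
  congr 1
  rw [coeff_X_mul']
  by_cases hk : b.testBit k = true
  · rw [if_pos hk, if_pos (by rw [Finsupp.mem_support_iff, ind_apply, if_pos (mem_bs.2 hk)]; norm_num), ee, (bs_ers k b hb hk).2]
    congr 1
    ext j
    rw [Finsupp.tsub_apply, ind_apply, ind_apply, Finsupp.single_apply]
    simp only [Finset.mem_erase]
    by_cases hj : k = j
    · subst hj; rw [if_pos (mem_bs.2 hk)]; simp
    · simp [hj, Ne.symm hj]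
  · rw [if_neg hk, if_neg]
    rw [Finsupp.mem_support_iff, ind_apply, if_neg fun h => hk (mem_bs.1 h)]; simp

lemma tb32 (a : ℕ) {b k : ℕ} (hb : b < 32) (hk : k < 5) : (32 * a + b).testBit k = b.testBit k := by
  have := Nat.testBit_two_pow_mul_add a (show b < 2 ^ 5 from hb) k
  rw [if_pos hk] at this; exact this

lemma Es_ok (V i : ℕ) (hi : i ≤ 5) : ∀ a b, a < 32 → b < 32 → bz ((Es V i).testBit (32 * a + b)) = if a < 2 ^ i then ee V a b else 0 := by
  induction i with
  | zero =>
    intro a b ha hb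
    rw [Es]
    by_cases h : a = 0
    · subst h
      rw [if_pos (by norm_num), mul_zero, zero_add, ee, bs_zero, xs_empty, map_one, coeff_one]
      by_cases h2 : b = 0
      · subst h2; rw [if_pos (by ext i; simp [ind_apply, bs_zero])]; rfl
      · rw [if_neg]
        · have : (1 : ℕ).testBit b = false := Bool.eq_false_iff.2 fun h3 => h2 (Nat.testBit_one_eq_true_iff_self_eq_zero.1 h3)
          rw [this]; rfl
        · intro h3
          refine h2 (bs_inj hb (by norm_num) ?_)
          rw [bs_zero]
          refine Finset.eq_empty_of_forall_notMem fun j hj => ?_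
          have := DFunLike.congr_fun h3 j
          rw [ind_apply, if_pos hj] at this; simp at this
    · rw [if_neg (by omega)]
      have : (1 : ℕ).testBit (32 * a + b) = false := Bool.eq_false_iff.2 fun h3 => by
        have := Nat.testBit_one_eq_true_iff_self_eq_zero.1 h3; omega
      rw [this]; rfl
  | succ i ih =>
    intro a b ha hb
    have ih := ih (by omega)
    rw [Es, Nat.testBit_or, Nat.testBit_shiftLeft]
    by_cases h : a < 2 ^ i
    · have h2 : ¬ (32 * a + b ≥ 32 * 2 ^ i) := by omega
      rw [if_pos (lt_trans h (Nat.pow_lt_pow_right (by norm_num) (by omega)))]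
      simp only [h2, decide_false, Bool.false_and, Bool.or_false]
      rw [ih a b ha hb, if_pos h]
    · have h0 := ih a b ha hb
      rw [if_neg h] at h0
      have h1 : (Es V i).testBit (32 * a + b) = false := by
        cases hh : (Es V i).testBit (32 * a + b)
        · rfl
        · rw [hh] at h0; exact absurd h0 (by decide)
      obtain ⟨a', rfl⟩ := Nat.exists_eq_add_of_le (not_lt.1 h)
      have h2 : 32 * (2 ^ i + a') + b ≥ 32 * 2 ^ i := by omega
      rw [h1]
      simp only [h2, decide_true, Bool.true_and, Bool.false_or]
      rw [show 32 * (2 ^ i + a') + b - 32 * 2 ^ i = 32 * a' + b by omega, wedge_bit _ _ _ (by omega)]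
      have h3 : ∀ k : Fin 5, bz ((V >>> (5 * i)).testBit k) * (if (32 * a' + b).testBit k = true then bz ((Es V i).testBit (32 * a' + b - 2 ^ (k : ℕ))) else 0)
          = bz (V.testBit (5 * i + k)) * (if b.testBit k = true then (if a' < 2 ^ i then ee V a' (b - 2 ^ (k : ℕ)) else 0) else 0) := by
        intro k
        rw [Nat.testBit_shiftRight, tb32 a' hb k.2]
        congr 1
        split_ifs with h4 h5
        · have h6 := (bs_ers k b hb h4).1
          rw [show 32 * a' + b - 2 ^ (k : ℕ) = 32 * a' + (b - 2 ^ (k : ℕ)) by omega, ih _ _ (by omega) (lt_of_le_of_lt (Nat.sub_le _ _) hb), if_pos h5]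
        · have h6 := (bs_ers k b hb h4).1
          rw [show 32 * a' + b - 2 ^ (k : ℕ) = 32 * a' + (b - 2 ^ (k : ℕ)) by omega, ih _ _ (by omega) (lt_of_le_of_lt (Nat.sub_le _ _) hb), if_neg h5]
        · rfl
      rw [Finset.sum_congr rfl fun k _ => h3 k]
      by_cases h4 : a' < 2 ^ i
      · rw [if_pos (by rw [pow_succ]; omega)]
        have := ee_step V ⟨i, by omega⟩ a' b h4 hb
        rw [this]
        simp only [h4, if_true]
      · rw [if_neg (by rw [pow_succ]; omega)]
        simp [h4]

lemma EE_ok (V a b : ℕ) : ee V a b = bz ((EE V).testBit (32 * (a % 32) + b % 32)) := by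
  have ha : a % 32 < 32 := Nat.mod_lt _ (by norm_num)
  rw [EE_eq, Es_ok V 5 le_rfl _ _ ha (Nat.mod_lt _ (by norm_num)), if_pos (by simpa using ha)]
  rw [ee, ee, bs_mod, bs_mod]

lemma hom0 {f : R5} (hf : f.IsHomogeneous 0) : f = C (coeff 0 f) := by
  ext a
  rw [coeff_C]
  split_ifs with h
  · rw [h]
  · by_contra h2
    exact h ((Finsupp.degree_eq_zero_iff a).1 (hom_iff.1 hf a h2)).symm

lemma cf_gV_eq (V n K w : ℕ) (h : pc w = pc K) : cf (n + 1) K (gV V (mon w)) = ee V w K * cf n (K / 32) (gV V (mon (w / 32))) := by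
  rw [mon_rec w, map_mul, map_pow, cf_succ, kap_mulsq]
  have h1 := kap_hom (J := bs K) (m := 0) (gV_hom V (bs w)) (by rw [← pc_eq, ← pc_eq, h, mul_zero, add_zero])
  rw [hom0 h1, kap_coeff, smul_zero, add_zero, ← smul_eq_C_mul, map_smul]; rfl

lemma cf_gV_lt (V n K w : ℕ) (h : pc w < pc K) : cf (n + 1) K (gV V (mon w)) = 0 := by
  rw [mon_rec w, map_mul, map_pow, cf_succ, kap_mulsq]
  have h1 := kap_hom0 (J := bs K) (gV_hom V (bs w)) (by rw [← pc_eq, ← pc_eq]; omega)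
  rw [h1, zero_mul, map_zero]

lemma cf_gV_key (V n : ℕ) : ∀ K w, keyN n w < keyN n K → cf n K (gV V (mon w)) = 0 := by
  induction n with
  | zero => intro K w h; simp [keyN] at h
  | succ n ih =>
    intro K w h
    rw [keyN, keyN] at h
    have h1 := keyN_lt n (K / 32)
    rcases lt_trichotomy (pc w) (pc K) with h2 | h2 | h2
    · exact cf_gV_lt _ _ _ _ h2
    · rw [cf_gV_eq _ _ _ _ h2, ih, mul_zero]
      rw [h2] at h; omega
    · have h5 := Nat.mul_le_mul_right (8 ^ n) (show pc K + 1 ≤ pc w by omega)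
      rw [add_mul] at h5
      omega

def kl : ℕ → List ℕ → ℕ
  | 0, _ => 0
  | _ + 1, [] => 0
  | n + 1, a :: ν => a * 8 ^ n + kl n ν

lemma kl_eq {ν : List ℕ} : ∀ {n w}, wtEq ν w = true → keyN n w = kl n ν := by
  induction ν with
  | nil => intro n w h; rw [(wtEq_nil w).1 h, keyN_zero]; cases n <;> rfl
  | cons a ν ih =>
    intro n w h
    rw [wtEq_cons] at h
    cases n with
    | zero => rfl
    | succ n => rw [keyN, kl, h.1, ih h.2]

lemma key_pos {n : ℕ} : ∀ {K}, K < 32 ^ n → K ≠ 0 → 0 < keyN n K := by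
  induction n with
  | zero => intro K h h2; simp at h; omega
  | succ n ih =>
    intro K h h2
    rw [keyN]
    by_cases h3 : K / 32 = 0
    · have h4 : bs K ≠ ∅ := fun h3 => h2 (bs_inj (by omega) (by norm_num) (h3.trans bs_zero.symm))
      have h5 := Finset.card_pos.2 (Finset.nonempty_iff_ne_empty.2 h4)
      rw [← pc_eq] at h5
      have := Nat.mul_pos h5 (show 0 < 8 ^ n by positivity); omega
    · have := ih (K := K / 32) (by rw [pow_succ] at h; omega) h3; omega

lemma kl_lt (n : ℕ) (ν : List ℕ) (h : ∀ a ∈ ν, a ≤ 5) : kl n ν < 8 ^ n := by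
  induction n generalizing ν with
  | zero => simp [kl]
  | succ n ih =>
    cases ν with
    | nil => simp [kl]
    | cons a ν =>
      have h1 := ih ν fun b hb => h b (List.mem_cons_of_mem _ hb)
      have h2 := h a List.mem_cons_self
      rw [kl, pow_succ]; nlinarith

lemma kl_le {ν : List ℕ} : ∀ {n K}, (∀ a ∈ ν, a ≤ 5) → ν.length ≤ n → K < 32 ^ n → ltC ν K = false → kl n ν ≤ keyN n K ∧ (wtEq ν K = false → kl n ν < keyN n K) := by
  induction ν with
  | nil =>
    intro n K _ _ h _
    have e : kl n [] = 0 := by cases n <;> rfl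
    rw [e]
    refine ⟨Nat.zero_le _, fun h2 => key_pos h fun h3 => ?_⟩
    rw [(wtEq_nil K).2 h3] at h2; cases h2
  | cons a ν ih =>
    intro n K hv hn hK hl
    obtain ⟨n, rfl⟩ := Nat.exists_eq_succ_of_ne_zero (show n ≠ 0 by rw [List.length_cons] at hn; omega)
    rw [List.length_cons] at hn
    have h1 := kl_lt n ν fun b hb => hv b (List.mem_cons_of_mem _ hb)
    have hl' := (ltC_cons a ν K).not.1 (by rw [hl]; simp)
    rw [Nat.succ_eq_add_one, kl, keyN]
    by_cases h2 : pc K = a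
    · have h3 := ih (n := n) (K := K / 32) (fun b hb => hv b (List.mem_cons_of_mem _ hb)) (by omega) (by rw [Nat.succ_eq_add_one, pow_succ] at hK; omega)
        (Bool.eq_false_iff.2 fun h => hl' (Or.inr ⟨h2, h⟩))
      rw [h2]
      refine ⟨by omega, fun h4 => ?_⟩
      have := h3.2 (Bool.eq_false_iff.2 fun h => by rw [(wtEq_cons a ν K).2 ⟨h2, h⟩] at h4; cases h4)
      omega
    · have h5 := Nat.mul_le_mul_right (8 ^ n) (show a + 1 ≤ pc K by by_contra h; exact hl' (Or.inl (by omega)))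
      rw [add_mul] at h5
      omega

lemma mapF_eq {α β : Type} (f : α → ℕ) (l : List α) : ∀ k : List ℕ → β, mapF f l k = k (l.map f) := by
  induction l with
  | nil => intro k; rfl
  | cons a l ih =>
    intro k
    change frc (f a) (fun b => mapF f l fun r => k (b :: r)) = _
    rw [frc_eq, ih]; rfl

lemma mskT_eq {β : Type} (ws as : List ℕ) : ∀ k : List (ℕ × ℕ) → β, mskT ws as k = k (as.map fun a => (2 ^ (32 * a), msk a ws)) := by
  induction as with
  | nil => intro k; rfl
  | cons a l ih =>
    intro k
    change frc (2 ^ (32 * a)) (fun p => frc (msk a ws) fun m => mskT ws l fun r => k ((p, m) :: r)) = _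
    rw [frc_eq, frc_eq, ih]; rfl

def mTs : List ℕ → List ℕ → List (List (ℕ × ℕ))
  | [], _ => []
  | a :: ν, ws => ((bySize a).map fun a => (2 ^ (32 * a), msk a ws)) :: mTs ν (ws.map fun w => w / 32)

lemma mskTs_eq {β : Type} (ν : List ℕ) : ∀ (ws : List ℕ) (k : List (List (ℕ × ℕ)) → β), mskTs ν ws k = k (mTs ν ws) := by
  induction ν with
  | nil => intro ws k; rfl
  | cons a l ih =>
    intro ws k
    change mskT ws (bySize a) (fun t => mapF (fun w => w / 32) ws fun ws' => mskTs l ws' fun r => k (t :: r)) = _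
    rw [mskT_eq, mapF_eq, ih]; rfl

lemma msk_bit (I : ℕ) (ws : List ℕ) : ∀ j (h : j < ws.length), (msk I ws).testBit j = decide (ws[j] % 32 = I) := by
  induction ws with
  | nil => intro j h; simp at h
  | cons w ws ih =>
    intro j h
    have e : msk I (w :: ws) = if w % 32 = I then 1 + 2 * msk I ws else 2 * msk I ws := bbeq _ _ _ _
    rw [e]
    cases j with
    | zero =>
      rw [Nat.testBit_zero]
      by_cases hw : w % 32 = I
      · simp [hw]
      · simp [hw]
    | succ j =>
      rw [Nat.testBit_succ]
      have : (if w % 32 = I then 1 + 2 * msk I ws else 2 * msk I ws) / 2 = msk I ws := by split <;> omega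
      rw [this, ih j (by simpa using h)]; rfl

lemma rowT_bit (e : ℕ) (ws : List ℕ) (j : ℕ) (h : j < ws.length) (as : List ℕ) :
    (rowT e (as.map fun a => (2 ^ (32 * a), msk a ws))).testBit j = true ↔ ws[j] % 32 ∈ as ∧ e.testBit (32 * (ws[j] % 32)) = true := by
  induction as with
  | nil => simp [rowT]
  | cons a l ih =>
    have e1 : rowT e ((a :: l).map fun a => (2 ^ (32 * a), msk a ws)) = if e &&& 2 ^ (32 * a) = 0 then rowT e (l.map fun a => (2 ^ (32 * a), msk a ws))
      else msk a ws ||| rowT e (l.map fun a => (2 ^ (32 * a), msk a ws)) := bbeq _ _ _ _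
    rw [e1, Nat.and_two_pow]
    cases he : e.testBit (32 * a) with
    | false =>
      rw [if_pos (by simp), ih, List.mem_cons]
      constructor
      · rintro ⟨h1, h2⟩; exact ⟨Or.inr h1, h2⟩
      · rintro ⟨h1 | h1, h2⟩
        · rw [h1, he] at h2; simp at h2
        · exact ⟨h1, h2⟩
    | true =>
      rw [if_neg (by simp), Nat.testBit_or, Bool.or_eq_true, ih, msk_bit a ws j h, decide_eq_true_iff, List.mem_cons]
      constructor
      · rintro (h1 | ⟨h1, h2⟩)
        · exact ⟨Or.inl h1, by rw [h1, he]⟩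
        · exact ⟨Or.inr h1, h2⟩
      · rintro ⟨h1 | h1, h2⟩
        · exact Or.inl h1
        · exact Or.inr ⟨h1, h2⟩

lemma rowK_bit (V N : ℕ) (ν : List ℕ) : ∀ (n K : ℕ) (ws : List ℕ), ν.length ≤ n → wtEq ν K = true → (∀ w ∈ ws, wtEq ν w = true) →
    ∀ j (h : j < ws.length), N.testBit j = true → bz ((rowK (EE V) N (mTs ν ws) K).testBit j) = cf n K (gV V (mon ws[j])) := by
  induction ν with
  | nil =>
    intro n K ws _ hK hw j h hN
    have h1 := (wtEq_nil _).1 (hw _ (List.getElem_mem h))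
    rw [(wtEq_nil _).1 hK, h1, mon_zero, map_one, cf_zero, coeff_zero_one]
    change bz (N.testBit j) = 1
    rw [hN]; rfl
  | cons a ν ih =>
    intro n K ws hn hK hw j h hN
    obtain ⟨m, rfl⟩ : ∃ m, n = m + 1 := ⟨n - 1, by simp at hn; omega⟩
    obtain ⟨hK1, hK2⟩ := (wtEq_cons _ _ _).1 hK
    obtain ⟨hw1, hw2⟩ := (wtEq_cons _ _ _).1 (hw _ (List.getElem_mem h))
    rw [cf_gV_eq V m K _ (hw1.trans hK1.symm)]
    have h2 := ih m (K / 32) (ws.map fun w => w / 32) (by simpa using hn) hK2 (by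
      intro w hw'
      obtain ⟨w0, h0, rfl⟩ := List.mem_map.1 hw'
      exact ((wtEq_cons _ _ _).1 (hw _ h0)).2) j (by simpa using h) hN
    rw [List.getElem_map] at h2
    rw [← h2, EE_ok, ← bz_and]
    have e1 : rowK (EE V) N (mTs (a :: ν) ws) K = frc (EE V >>> (K % 32)) fun e => rowT e ((bySize a).map fun a => (2 ^ (32 * a), msk a ws)) &&& 
      rowK (EE V) N (mTs ν (ws.map fun w => w / 32)) (K / 32) := rfl
    rw [e1, frc_eq, Nat.testBit_and]
    congr 2
    rw [Bool.eq_iff_iff, rowT_bit _ _ _ h, Nat.testBit_shiftRight, Nat.add_comm]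
    refine ⟨fun h => h.2, fun h => ⟨bySize_spec.2 ⟨Nat.mod_lt _ (by norm_num), by rw [pc_mod, hw1]⟩, h⟩⟩

lemma row_bit (V N : ℕ) (ν ws f : List ℕ) (hν : ∀ a ∈ ν, a ≤ 5) (hl : ν.length ≤ 7) (hw : ∀ w ∈ ws, wtEq ν w = true)
    (hf : ∀ K ∈ f, K < 32 ^ 7 ∧ ltC ν K = false) (j : ℕ) (h : j < ws.length) (hN : N.testBit j = true) :
    bz ((row (EE V) N (mTs ν ws) (filt (wtEq ν) f)).testBit j) = cfs 7 f (gV V (mon ws[j])) := by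
  induction f with
  | nil => rw [cfs_nil]; change bz (Nat.testBit 0 j) = 0; rw [Nat.zero_testBit]; rfl
  | cons K f ih =>
    have ih := ih fun K hK => hf K (List.mem_cons_of_mem _ hK)
    obtain ⟨h1, h2⟩ := hf K List.mem_cons_self
    rw [cfs_cons, LinearMap.add_apply, ← ih]
    have e : filt (wtEq ν) (K :: f) = if wtEq ν K = true then K :: filt (wtEq ν) f else filt (wtEq ν) f := brec _ _ _
    rw [e]
    cases hK : wtEq ν K with
    | true =>
      rw [if_pos rfl]
      change bz (Nat.testBit (rowK (EE V) N (mTs ν ws) K ^^^ row (EE V) N (mTs ν ws) (filt (wtEq ν) f)) j) = _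
      rw [Nat.testBit_xor, bz_xor, rowK_bit V N ν 7 K ws hl hK hw j h hN]
    | false =>
      rw [if_neg (by simp), cf_gV_key, zero_add]
      rw [kl_eq (hw _ (List.getElem_mem h))]
      exact (kl_le hν hl h1 h2).2 hK

lemma rows_sound {β : Type} (M : β → Prop) (Q : ℕ → Prop) (N : ℕ) (ts : List (List (ℕ × ℕ))) (f Vs acc : List ℕ)
    (hV : ∀ V ∈ Vs, Q (row (EE V) N ts f)) (ha : ∀ r ∈ acc, Q r) :
    ∀ k : List ℕ → β, (∀ rs, (∀ r ∈ rs, Q r) → M (k rs)) → M (rows N ts f Vs acc k) := by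
  induction Vs with
  | nil => intro k hk; exact hk acc ha
  | cons V Vs ih =>
    intro k hk
    have e : rows N ts f (V :: Vs) acc k = frc (EE V) fun E => frc (row E N ts f) fun r => rows N ts f Vs acc fun l => k (r :: l) := rfl
    rw [e, frc_eq, frc_eq]
    refine ih (fun V hV' => hV V (List.mem_cons_of_mem _ hV')) _ fun rs hrs => hk _ ?_
    intro r hr
    rcases List.mem_cons.1 hr with rfl | hr
    · exact hV V List.mem_cons_self
    · exact hrs r hr

lemma rowsF_sound {β : Type} (M : β → Prop) (Q : ℕ → Prop) (ν : List ℕ) (N : ℕ) (ts : List (List (ℕ × ℕ))) (fs : List (List ℕ × List ℕ))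
    (hV : ∀ p ∈ fs, ∀ V, Q (row (EE V) N ts (filt (wtEq ν) p.1))) :
    ∀ k : List ℕ → β, (∀ rs, (∀ r ∈ rs, Q r) → M (k rs)) → M (rowsF ν N ts fs k) := by
  induction fs with
  | nil => intro k hk; exact hk [] (by simp)
  | cons p fs ih =>
    intro k hk
    refine ih (fun p hp => hV p (List.mem_cons_of_mem _ hp)) _ fun acc hacc => ?_
    exact rows_sound M Q N ts _ p.2 acc (fun V _ => hV p List.mem_cons_self V) hacc k hk

def GQ (Q : ℕ → Prop) : Tr → Prop
  | .e => True
  | .lf r _ _ => Q r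
  | .n _ a b => GQ Q a ∧ GQ Q b

lemma insR_sound {β : Type} (M : β → Prop) (Q : ℕ → Prop) (r : ℕ) (hr : Q r) (D : Tr) : ∀ (kx : ℕ → β) (k : Tr → β), GQ Q D →
    (∀ p, Q p → M (kx p)) → (∀ D', GQ Q D' → M (k D')) → M (insR r D kx k) := by
  induction D with
  | e => intro kx k _ _ hk; exact hk _ hr
  | lf p _ _ => intro kx k hD hx _; exact hx _ hD
  | n m a b iha ihb =>
    intro kx k hD hx hk
    have e : insR r (.n m a b) kx k = if r &&& m = 0 then insR r a kx (fun a' => k (.n m a' b)) else insR r b kx (fun b' => k (.n m a b')) := bbeq _ _ _ _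
    rw [e]
    split
    · exact iha _ _ hD.1 hx fun D' h' => hk _ ⟨h', hD.2⟩
    · exact ihb _ _ hD.2 hx fun D' h' => hk _ ⟨hD.1, h'⟩

lemma redR_sound {β : Type} (M : β → Prop) (Q : ℕ → Prop) (hQ : ∀ a b, Q a → Q b → Q (a ^^^ b)) (D : Tr) (hD : GQ Q D) (k : Tr → β)
    (hk : ∀ D', GQ Q D' → M (k D')) (n : ℕ) : ∀ r, Q r → M (redR n D k r) := by
  induction n with
  | zero => intro r _; exact hk D hD
  | succ n ih =>
    intro r hr
    have e : redR (n + 1) D k r = insR r D (fun p => frc (r ^^^ p) (redR n D k)) k := rfl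
    rw [e]
    refine insR_sound M Q r hr D _ _ hD (fun p hp => ?_) hk
    rw [frc_eq]; exact ih _ (hQ _ _ hr hp)

lemma redRs_sound {β : Type} (M : β → Prop) (Q : ℕ → Prop) (hQ : ∀ a b, Q a → Q b → Q (a ^^^ b)) (rs : List ℕ) : ∀ (D : Tr) (k : Tr → β), GQ Q D →
    (∀ D', GQ Q D' → M (k D')) → (∀ r ∈ rs, Q r) → M (redRs rs D k) := by
  induction rs with
  | nil => intro D k hD hk _; exact hk D hD
  | cons r rs ih =>
    intro D k hD hk hr
    have e : redRs (r :: rs) D k = redR 2000 D (fun D => redRs rs D k) r := rfl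
    rw [e]
    refine redR_sound M Q hQ D hD _ (fun D' hD' => ?_) _ r (hr r List.mem_cons_self)
    exact ih D' k hD' hk fun r h => hr r (List.mem_cons_of_mem _ h)

lemma mkT_sound {β : Type} (M : β → Prop) (Q : ℕ → Prop) (d : ℕ) : ∀ (p : ℕ) (k : Tr → β), (∀ D', GQ Q D' → M (k D')) → M (mkT d p k) := by
  induction d with
  | zero => intro p k hk; exact hk _ trivial
  | succ d ih =>
    intro p k hk
    have e : mkT (d + 1) p k = frc (2 ^ d) fun h => frc (Nat.pred (2 ^ h) <<< (p + h)) fun m => mkT d p fun a => mkT d (p + h) fun b => k (.n m a b) := rfl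
    rw [e, frc_eq, frc_eq]
    exact ih _ _ fun a ha => ih _ _ fun b hb => hk _ ⟨ha, hb⟩

lemma flat_sound (Q : ℕ → Prop) (D : Tr) : ∀ l, GQ Q D → (∀ r ∈ l, Q r) → ∀ r ∈ flat D l, Q r := by
  induction D with
  | e => intro l _ hl; exact hl
  | lf p _ _ =>
    intro l hD hl r hr
    rcases List.mem_cons.1 hr with rfl | hr
    · exact hD
    · exact hl r hr
  | n m a b iha ihb => intro l hD hl; exact iha _ hD.1 (ihb l hD.2 hl)

lemma ech_sound (Q : ℕ → Prop) (n : ℕ) : ∀ l i, (∀ r ∈ l, Q r) → ech n l (2 ^ i) = true → ∀ j < n, ∃ r, Q r ∧ r / 2 ^ (i + j) = 1 := by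
  induction n with
  | zero => intro l i _ _ j hj; omega
  | succ n ih =>
    intro l i hl h j hj
    cases l with
    | nil => exact absurd h (by simp [ech])
    | cons r l =>
      have e : ech (n + 1) (r :: l) (2 ^ i) = if r / 2 ^ i = 1 then frc (2 * 2 ^ i) (ech n l) else false := bbeq _ _ _ _
      rw [e, frc_eq, ← pow_succ'] at h
      split at h
      next h1 =>
        cases j with
        | zero => exact ⟨r, hl r List.mem_cons_self, h1⟩
        | succ j =>
          have := ih l (i + 1) (fun r hr => hl r (List.mem_cons_of_mem _ hr)) h j (by omega)
          rwa [show i + 1 + j = i + (j + 1) by omega] at this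
      next => cases h

lemma elim_sound (Q : ℕ → Prop) (hQ : ∀ a b, Q a → Q b → Q (a ^^^ b)) (n : ℕ) (rs : List ℕ) (hr : ∀ r ∈ rs, Q r) (h : elim n rs = true) :
    ∀ j < n, ∃ r, Q r ∧ r / 2 ^ j = 1 := by
  revert h
  refine mkT_sound (fun b => b = true → ∀ j < n, ∃ r, Q r ∧ r / 2 ^ j = 1) Q 10 0 _ fun D hD => ?_
  refine redRs_sound (fun b => b = true → ∀ j < n, ∃ r, Q r ∧ r / 2 ^ j = 1) Q hQ rs D _ hD (fun D' hD' => ?_) hr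
  intro h
  have := ech_sound Q n (flat D' []) 0 (flat_sound Q D' [] hD' (by simp)) h
  simpa using this

lemma okF_iff {ν f : List ℕ} (h : okF ν f = true) : (∀ K ∈ f, degC 7 K = 67 ∧ K < 32 ^ 7 ∧ ltC ν K = false) ∧ chk 7 f f = true := by
  have e : okF ν f = if allL (fun c => iF Nat.beq (degC 7 c) 67 thN iF Nat.blt c (Nat.pow 32 7) thN Bool.rec true false (ltC ν c) elS false elS false) f = true then chk 7 f f else false := brec _ _ _
  rw [e] at h
  split at h
  next h1 =>
    refine ⟨fun K hK => ?_, h⟩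
    have h2 := (allL_iff _ _).1 h1 K hK
    simp only [bbeq, bblt] at h2
    split at h2
    · split at h2
      · refine ⟨by assumption, by assumption, ?_⟩
        cases h3 : ltC ν K with
        | false => rfl
        | true => rw [h3] at h2; cases h2
      · cases h2
    · cases h2
  next => cases h

lemma block {ν ws : List ℕ} {fs : List (List ℕ × List ℕ)} (hν : ∀ a ∈ ν, a ≤ 5) (hl : ν.length ≤ 7) (hw : ∀ w ∈ ws, wtEq ν w = true)
    (hf : ∀ p ∈ fs, okF ν p.1 = true) (k : Bool) (h : (rowsF ν (Nat.pred (Nat.pow 2 ws.length)) (mTs ν ws) fs fun rs => iF elim ws.length rs thN k elS false) = true) :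
    k = true ∧ ∀ i (hi : i < ws.length), ∃ Φ : R5 →ₗ[ZMod 2] ZMod 2, (∀ u ∈ HH, Φ u = 0) ∧ (∀ w, keyN 7 w < kl 7 ν → Φ (mon w) = 0) ∧
      Φ (mon ws[i]) = 1 ∧ ∀ j (hj : j < ws.length), i < j → Φ (mon ws[j]) = 0 := by
  revert h
  refine rowsF_sound (fun b => b = true → _) (fun r => ∃ Φ : R5 →ₗ[ZMod 2] ZMod 2, (∀ u ∈ HH, Φ u = 0) ∧ (∀ w, keyN 7 w < kl 7 ν → Φ (mon w) = 0) ∧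
    ∀ j (hj : j < ws.length), Φ (mon ws[j]) = bz (r.testBit j)) ν _ _ fs ?_ _ ?_
  · intro p hp V
    obtain ⟨h1, h2⟩ := okF_iff (hf p hp)
    refine ⟨cfs 7 p.1 ∘ₗ (gV V).toLinearMap, fun u hu => ?_, fun w hw' => ?_, fun j hj => ?_⟩
    · exact cfs_HH (fun c hc => (h1 c hc).1) h2 (gV_HH V hu)
    · change cfs 7 p.1 (gV V (mon w)) = 0
      have : ∀ K ∈ p.1, cf 7 K (gV V (mon w)) = 0 := fun K hK =>
        cf_gV_key V 7 K w (lt_of_lt_of_le hw' (kl_le hν hl (h1 K hK).2.1 (h1 K hK).2.2).1)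
      clear h1 h2 hp
      generalize p.1 = f at this
      induction f with
      | nil => rw [cfs_nil]; rfl
      | cons a f ih =>
        rw [cfs_cons, LinearMap.add_apply, this a List.mem_cons_self, ih fun K hK => this K (List.mem_cons_of_mem _ hK), add_zero]
    · refine (row_bit V _ ν ws p.1 hν hl hw (fun K hK => (h1 K hK).2) j hj ?_).symm
      change (2 ^ ws.length - 1).testBit j = true
      rw [Nat.testBit_two_pow_sub_one]; simpa using hj
  · intro rs hrs h
    rw [brec] at h
    split at h
    next h1 =>
      refine ⟨h, fun i hi => ?_⟩
      obtain ⟨r, ⟨Φ, a1, a2, a3⟩, hr⟩ := elim_sound _ (fun a b ha hb => by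
        obtain ⟨Φ, a1, a2, a3⟩ := ha
        obtain ⟨Ψ, b1, b2, b3⟩ := hb
        refine ⟨Φ + Ψ, fun u hu => ?_, fun w hw' => ?_, fun j hj => ?_⟩
        · rw [LinearMap.add_apply, a1 u hu, b1 u hu, add_zero]
        · rw [LinearMap.add_apply, a2 w hw', b2 w hw', add_zero]
        · rw [LinearMap.add_apply, a3 j hj, b3 j hj, Nat.testBit_xor, bz_xor]) ws.length rs hrs h1 i hi
      refine ⟨Φ, a1, a2, ?_, fun j hj hij => ?_⟩
      · rw [a3 i hi, Nat.testBit_eq_decide_div_mod_eq, hr]; rfl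
      · have hlt : r < 2 ^ (i + 1) := by
          rw [pow_succ]
          by_contra hc
          have h2 : 2 ≤ r / 2 ^ i := (Nat.le_div_iff_mul_le (by positivity)).2 (by omega)
          omega
        rw [a3 j hj, Nat.testBit_lt_two_pow (lt_of_lt_of_le hlt (Nat.pow_le_pow_right (by norm_num) hij))]; rfl
    next => cases h

def TriW : List ℕ → Prop
  | [] => True
  | c :: l => (∃ Φ : R5 →ₗ[ZMod 2] ZMod 2, (∀ u ∈ HH, Φ u = 0) ∧ Φ (mon c) = 1 ∧ ∀ c' ∈ l, Φ (mon c') = 0) ∧ TriW l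

lemma TriW_app {l : List ℕ} (hl : TriW l) (ws : List ℕ) (h : ∀ i (hi : i < ws.length), ∃ Φ : R5 →ₗ[ZMod 2] ZMod 2, (∀ u ∈ HH, Φ u = 0) ∧
    (∀ w ∈ l, Φ (mon w) = 0) ∧ Φ (mon ws[i]) = 1 ∧ ∀ j (hj : j < ws.length), i < j → Φ (mon ws[j]) = 0) : TriW (ws ++ l) := by
  induction ws with
  | nil => exact hl
  | cons w ws ih =>
    refine ⟨?_, ih fun i hi => ?_⟩
    · obtain ⟨Φ, h1, h2, h3, h4⟩ := h 0 (by simp)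
      refine ⟨Φ, h1, h3, fun c hc => ?_⟩
      rcases List.mem_append.1 hc with hc | hc
      · obtain ⟨j, hj, rfl⟩ := List.getElem_of_mem hc
        exact h4 (j + 1) (by simpa using hj) (by omega)
      · exact h2 c hc
    · obtain ⟨Φ, h1, h2, h3, h4⟩ := h (i + 1) (by simpa using hi)
      exact ⟨Φ, h1, h2, h3, fun j hj hij => h4 (j + 1) (by simpa using hj) (by omega)⟩

lemma desc (d : ℕ) (Φ : R5 →ₗ[ZMod 2] ZMod 2) (h : ∀ u ∈ HH, Φ u = 0) : ∃ Ψ : QP 5 d →ₗ[ZMod 2] ZMod 2, ∀ c, dg c = d → Ψ (prj d (mon c)) = Φ (mon c) := by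
  refine ⟨Submodule.liftQ _ (Φ ∘ₗ (homSub 5 d).subtype) fun u hu => h _ (hit_le d hu), fun c hc => ?_⟩
  change Φ (homogeneousComponent d (mon c)) = _
  rw [comp_of_hom (mon_hom c), if_pos hc]

lemma TriW_rank (hfin : Module.Finite (ZMod 2) (QP 5 67)) (l : List ℕ) (hl : TriW l) (hd : ∀ c ∈ l, dg c = 67) :
    l.length ≤ Module.finrank (ZMod 2) (Submodule.span (ZMod 2) ((fun c => prj 67 (mon c)) '' {c | c ∈ l})) := by
  induction l with
  | nil => simp
  | cons c l ih =>
    obtain ⟨⟨Φ, h1, h2, h3⟩, h4⟩ := hl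
    have hd' : ∀ c ∈ l, dg c = 67 := fun c hc => hd c (List.mem_cons_of_mem _ hc)
    refine Nat.succ_le_of_lt (lt_of_le_of_lt (ih h4 hd') (Submodule.finrank_lt_finrank_of_lt (lt_of_le_of_ne ?_ ?_)))
    · exact Submodule.span_mono (Set.image_mono fun x hx => List.mem_cons_of_mem _ hx)
    · intro he
      obtain ⟨Ψ, hΨ⟩ := desc 67 Φ h1
      have hc : prj 67 (mon c) ∈ Submodule.span (ZMod 2) ((fun c => prj 67 (mon c)) '' {c | c ∈ l}) := by
        rw [he]; exact Submodule.subset_span ⟨c, List.mem_cons_self, rfl⟩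
      have hle : Submodule.span (ZMod 2) ((fun c => prj 67 (mon c)) '' {c | c ∈ l}) ≤ LinearMap.ker Ψ := by
        refine Submodule.span_le.2 ?_
        rintro _ ⟨x, hx, rfl⟩
        change Ψ (prj 67 (mon x)) = 0
        rw [hΨ x (hd' x hx), h3 x hx]
      have h5 : Ψ (prj 67 (mon c)) = 0 := hle hc
      rw [hΨ c (hd c List.mem_cons_self), h2] at h5
      exact one_ne_zero h5

lemma rev_eq (l : List ℕ) : ∀ a, rev l a = l.reverse ++ a := by
  induction l with
  | nil => intro a; rfl
  | cons x l ih =>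
    intro a
    change rev l (x :: a) = _
    rw [ih]; simp

lemma lbB_sound {D : Tr} {ν : List ℕ} {fs : List (List ℕ × List ℕ)} {k : ℕ → Bool} (hν : ∀ a ∈ ν, a ≤ 5) (hl : ν.length ≤ 7)
    (hf : ∀ p ∈ fs, okF ν p.1 = true) (h : lbB D ν fs false k = true) : ∃ ws : List ℕ, (∀ w ∈ ws, wtEq ν w = true) ∧ k ws.length = true ∧
    ∀ i (hi : i < ws.length), ∃ Φ : R5 →ₗ[ZMod 2] ZMod 2, (∀ u ∈ HH, Φ u = 0) ∧ (∀ w, keyN 7 w < kl 7 ν → Φ (mon w) = 0) ∧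
      Φ (mon ws[i]) = 1 ∧ ∀ j (hj : j < ws.length), i < j → Φ (mon ws[j]) = 0 := by
  have hw : ∀ w ∈ rev (enum D ν) [], wtEq ν w = true := by
    intro w hw
    rw [rev_eq] at hw
    exact enum_wt (D := D) (by simpa using hw)
  rw [lbB, mapF_eq, List.map_id', frc_eq, frc_eq, mskTs_eq, len_eq] at h
  obtain ⟨h1, h2⟩ := block hν hl hw hf (k (rev (enum D ν) []).length) h
  exact ⟨_, hw, h1, h2⟩

lemma lbA_sound (D : Tr) (gs : List (List ℕ × List (List ℕ × List ℕ))) : ∀ a, (∀ g ∈ gs, (∀ b ∈ g.1, b ≤ 5) ∧ g.1.length ≤ 7 ∧ wd g.1 = 67 ∧ ∀ p ∈ g.2, okF g.1 p.1 = true) →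
    gs.Pairwise (fun g g' => kl 7 g'.1 < kl 7 g.1) → lbA D gs a = true →
    ∃ L : List ℕ, L.length + a = 1487 ∧ TriW L ∧ ∀ c ∈ L, ∃ g ∈ gs, wtEq g.1 c = true := by
  induction gs with
  | nil =>
    intro a _ _ h
    exact ⟨[], by simpa using Nat.eq_of_beq_eq_true h, trivial, by simp⟩
  | cons g gs ih =>
    intro a hg hp h
    obtain ⟨g1, g2, g3, g4⟩ := hg g List.mem_cons_self
    have e : lbA D (g :: gs) a = lbB D g.1 g.2 false fun n => frc (n + a) (lbA D gs) := rfl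
    rw [e] at h
    obtain ⟨ws, w1, w2, w3⟩ := lbB_sound g1 g2 g4 h
    rw [frc_eq] at w2
    obtain ⟨L, l1, l2, l3⟩ := ih _ (fun g hg' => hg g (List.mem_cons_of_mem _ hg')) (List.pairwise_cons.1 hp).2 w2
    refine ⟨ws ++ L, by rw [List.length_append]; omega, TriW_app l2 ws fun i hi => ?_, fun c hc => ?_⟩
    · obtain ⟨Φ, h1, h2, h3, h4⟩ := w3 i hi
      refine ⟨Φ, h1, fun w hw => h2 w ?_, h3, h4⟩
      obtain ⟨g', hg', hwt⟩ := l3 w hw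
      rw [kl_eq hwt]
      exact (List.pairwise_cons.1 hp).1 g' hg'
    · rcases List.mem_append.1 hc with hc | hc
      · exact ⟨g, List.mem_cons_self, w1 c hc⟩
      · obtain ⟨g', hg', hwt⟩ := l3 c hc
        exact ⟨g', List.mem_cons_of_mem _ hg', hwt⟩

lemma lbK : ∀ g ∈ lbData.map Prod.fst, (∀ b ∈ g, b ≤ 5) ∧ g.length ≤ 7 ∧ wd g = 67 := by decide +kernel

lemma lbP : (lbData.map Prod.fst).Pairwise (fun g g' => kl 7 g' < kl 7 g) := by decide +kernel

lemma fin67 : Module.finrank (ZMod 2) (QP 5 67) = 1487 := by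
  obtain ⟨D, hD, hk⟩ := exD
  rw [ckAll, bbeq] at hk
  split at hk
  next h1 =>
    obtain ⟨hf, hu⟩ := upper hD h1
    refine le_antisymm hu ?_
    obtain ⟨L, l1, l2, l3⟩ := lbA_sound D lbData 0 (fun g hg => by
      obtain ⟨a, b, c⟩ := lbK g.1 (List.mem_map_of_mem hg)
      exact ⟨a, b, c, (allL_iff _ _).1 ((allL_iff _ _).1 ckA g hg)⟩) (List.pairwise_map.1 lbP) hk
    have h3 := TriW_rank hf L l2 fun c hc => by
      obtain ⟨g, hg, hw⟩ := l3 c hc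
      rw [wd_dg hw]; exact (lbK g.1 (List.mem_map_of_mem hg)).2.2
    have h4 := h3.trans (Submodule.finrank_le _)
    omega
  next => cases hk

/-- for every `s ≥ 3`, `(QP_5)_{5(2^s-1)+13·2^s}` has dimension `1487`. -/
theorem statement7 (s : ℕ) (hs : 3 ≤ s) :
    Module.finrank (ZMod 2) (QP 5 (5 * (2 ^ s - 1) + 13 * 2 ^ s)) = 1487 := by
  have h : 5 * (2 ^ s - 1) + 13 * 2 ^ s = 18 * 2 ^ s - 5 := by
    have : 0 < 2 ^ s := by positivity
    omega
  rw [h, red67 s (by omega), fin67]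

end
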